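/- Let V ∈ L¹(ℝ³) with Fourier transform V̂ satisfying ∫ |V̂(p)|(1+|p|²) dp < ∞. Let W : ℝ × ℝ³ × ℝ³ → ℝ, (t,x,v) ↦ W_t(x,v), be smooth, Schwartz in (x,v) for each t, and a solution of the relativistic Vlasov equation ∂_t W_t + (v/√(1+|v|²))·∇_x W_t = ∇(V * ρ_t)·∇_v W_t, where ρ_t(x) = ∫_{ℝ³} W_t(x,v) dv. Then for every k ∈ {1,2,3,4,5,6} and every D > 0 there exists a constant C > 0, depending only on k, V and D, such that whenever ‖W_0‖_{H²_4} ≤ D, one has ‖W_t‖_{H^k_2} ≤ C e^{C|t|} ‖W_0‖_{H^k_2} for all t ∈ ℝ. -/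

import Mathlib

noncomputable section

open MeasureTheory
open scoped FourierTransform

abbrev E3 := EuclideanSpace ℝ (Fin 3)
abbrev P6 := E3 × E3

/-- Coordinate directions on phase space `ℝ³ × ℝ³`: the first three are position
directions, the last three are velocity directions. -/
def dir6 (j : Fin 6) : P6 :=
  if h : (j : ℕ) < 3 then (EuclideanSpace.single (⟨j, h⟩ : Fin 3) 1, 0)
  else (0, EuclideanSpace.single (⟨(j : ℕ) - 3, by omega⟩ : Fin 3) 1)

/-- Directional derivative on phase space. -/
def pdP (d : P6) (f : P6 → ℝ) : P6 → ℝ := fun z => fderiv ℝ f z d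

/-- Multi-index iterated partial derivative `∂^β` on phase space, `β ∈ ℕ⁶`. -/
def mderivP (β : Fin 6 → ℕ) (f : P6 → ℝ) : P6 → ℝ :=
  (pdP (dir6 0))^[β 0] <| (pdP (dir6 1))^[β 1] <| (pdP (dir6 2))^[β 2] <|
    (pdP (dir6 3))^[β 3] <| (pdP (dir6 4))^[β 4] <| (pdP (dir6 5))^[β 5] f

/-- Weighted Sobolev norm
`‖f‖²_{H^s_a} = Σ_{|β|≤s} ∫ (1+|x|²+|v|²)^a |∂^β f(x,v)|² dx dv`. -/
def sobNorm (s a : ℕ) (f : P6 → ℝ) : ℝ :=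
  Real.sqrt (∑' β : Fin 6 → ℕ,
    if (∑ i, β i) ≤ s then
      ∫ z : P6, (1 + ‖z.1‖ ^ 2 + ‖z.2‖ ^ 2) ^ a * (mderivP β f z) ^ 2
    else 0)

/-- The relativistic velocity map `ν(v) = v/√(1+|v|²)`. -/
def relVel (v : E3) : E3 := (Real.sqrt (1 + ‖v‖ ^ 2))⁻¹ • v

section Helpers

open scoped ENNReal LineDeriv SchwartzMap

/-! ### Weights, quadratic functionals and finite differences -/

def wt (z : P6) : ℝ := 1 + ‖z.1‖ ^ 2 + ‖z.2‖ ^ 2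

lemma wt_one_le (z : P6) : 1 ≤ wt z := by unfold wt; nlinarith [sq_nonneg ‖z.1‖, sq_nonneg ‖z.2‖]
lemma wt_pos (z : P6) : 0 < wt z := lt_of_lt_of_le one_pos (wt_one_le z)

lemma wt_cont : Continuous wt := by unfold wt; fun_prop

def Qe (a : ℕ) (f : P6 → ℝ) : ℝ≥0∞ := ∫⁻ z, ENNReal.ofReal (wt z ^ a * f z ^ 2)

/-- shift -/
def shf (s : ℝ) (i : Fin 6) (f : P6 → ℝ) : P6 → ℝ := fun z => f (z + s • dir6 i)
/-- difference quotient -/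
def dff (h : ℝ) (i : Fin 6) (f : P6 → ℝ) : P6 → ℝ := fun z => (f (z + h • dir6 i) - f z) / h

def dlf (h : ℝ) : List (Fin 6) → (P6 → ℝ) → (P6 → ℝ)
  | [], f => f
  | i :: L, f => dlf h L (dff h i f)

lemma dir6_norms (i : Fin 6) :
    (‖(dir6 i).1‖ = 1 ∧ ‖(dir6 i).2‖ = 0) ∨ (‖(dir6 i).1‖ = 0 ∧ ‖(dir6 i).2‖ = 1) := by
  unfold dir6
  split_ifs with h
  · left; simp
  · right; simp

lemma wt_shift (s : ℝ) (i : Fin 6) (z : P6) :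
    wt (z + s • dir6 i) ≤ (1 + |s| + s ^ 2) * wt z := by
  unfold wt
  have h1 : ‖(z + s • dir6 i).1‖ ≤ ‖z.1‖ + |s| * ‖(dir6 i).1‖ := by
    simpa [norm_smul] using norm_add_le z.1 (s • (dir6 i).1)
  have h2 : ‖(z + s • dir6 i).2‖ ≤ ‖z.2‖ + |s| * ‖(dir6 i).2‖ := by
    simpa [norm_smul] using norm_add_le z.2 (s • (dir6 i).2)
  have hs : 0 ≤ |s| := abs_nonneg s
  have hss : s ^ 2 = |s| ^ 2 := (sq_abs s).symm
  have e1 := pow_le_pow_left₀ (norm_nonneg _) h1 2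
  have e2 := pow_le_pow_left₀ (norm_nonneg _) h2 2
  have n1 := norm_nonneg z.1
  have n2 := norm_nonneg z.2
  rw [hss]
  rcases dir6_norms i with ⟨a, b⟩ | ⟨a, b⟩ <;> rw [a] at e1 <;> rw [b] at e2 <;>
    nlinarith [mul_nonneg hs (sq_nonneg (‖z.1‖ - 1)), mul_nonneg hs (sq_nonneg (‖z.2‖ - 1)),
      mul_nonneg (sq_nonneg (|s|)) (sq_nonneg ‖z.1‖), mul_nonneg (sq_nonneg (|s|)) (sq_nonneg ‖z.2‖),
      mul_nonneg hs (sq_nonneg ‖z.1‖), mul_nonneg hs (sq_nonneg ‖z.2‖)]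

instance instHaarP6 : (volume : Measure P6).IsAddHaarMeasure := by
  rw [Measure.volume_eq_prod]; infer_instance

lemma Qe_mono {a : ℕ} {f g : P6 → ℝ} (h : ∀ z, |f z| ≤ |g z|) : Qe a f ≤ Qe a g := by
  unfold Qe
  refine lintegral_mono fun z => ENNReal.ofReal_le_ofReal ?_
  exact mul_le_mul_of_nonneg_left (sq_le_sq.mpr (h z)) (pow_nonneg (wt_pos z).le _)

lemma Qe_shf (a : ℕ) (s : ℝ) (i : Fin 6) (f : P6 → ℝ) :
    Qe a (shf s i f) ≤ ENNReal.ofReal ((1 + |s| + s ^ 2) ^ a) * Qe a f := by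
  unfold Qe shf
  rw [← lintegral_const_mul' _ _ ENNReal.ofReal_ne_top]
  have key := lintegral_add_right_eq_self (μ := (volume : Measure P6))
    (fun z : P6 => ENNReal.ofReal (wt (z - s • dir6 i) ^ a * f z ^ 2)) (s • dir6 i)
  simp only [add_sub_cancel_right] at key
  rw [key]
  refine lintegral_mono fun z => ?_
  have hh : wt (z - s • dir6 i) ^ a ≤ ((1 + |s| + s ^ 2) * wt z) ^ a := by
    have := wt_shift (-s) i z
    simp only [neg_smul, abs_neg, neg_sq, ← sub_eq_add_neg] at this
    exact pow_le_pow_left₀ (wt_pos _).le this a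
  rw [← ENNReal.ofReal_mul (by positivity)]
  refine ENNReal.ofReal_le_ofReal ?_
  rw [← mul_assoc, ← mul_pow]
  exact mul_le_mul_of_nonneg_right hh (sq_nonneg _)

lemma Qe_add (a : ℕ) {f g : P6 → ℝ} (hf : Measurable f) :
    Qe a (fun z => f z + g z) ≤ 2 * Qe a f + 2 * Qe a g := by
  unfold Qe
  rw [← lintegral_const_mul' _ _ (by simp), ← lintegral_const_mul' _ _ (by simp),
    ← lintegral_add_left]
  · refine lintegral_mono fun z => ?_
    have h2 : (2 : ℝ≥0∞) = ENNReal.ofReal 2 := by simp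
    have hw := pow_nonneg (wt_pos z).le a
    rw [h2, ← ENNReal.ofReal_mul (by norm_num), ← ENNReal.ofReal_mul (by norm_num),
      ← ENNReal.ofReal_add (by positivity) (by positivity)]
    refine ENNReal.ofReal_le_ofReal ?_
    nlinarith [mul_nonneg hw (sq_nonneg (f z - g z))]
  · have := wt_cont.measurable
    fun_prop

lemma Qe_mul (a : ℕ) {b f : P6 → ℝ} {B : ℝ≥0∞} (hb : ∀ z, ENNReal.ofReal (b z ^ 2) ≤ B)
    (hf : Measurable f) :
    Qe a (fun z => b z * f z) ≤ B * Qe a f := by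
  unfold Qe
  rw [← lintegral_const_mul _ (by have := wt_cont.measurable; fun_prop)]
  refine lintegral_mono fun z => ?_
  have hw := pow_nonneg (wt_pos z).le a
  calc ENNReal.ofReal (wt z ^ a * (b z * f z) ^ 2)
      = ENNReal.ofReal (b z ^ 2) * ENNReal.ofReal (wt z ^ a * f z ^ 2) := by
        rw [← ENNReal.ofReal_mul (sq_nonneg _)]; congr 1; ring
    _ ≤ _ := by gcongr; exact hb z

lemma Qe_const_mul (a : ℕ) (c : ℝ) (f : P6 → ℝ) :
    Qe a (fun z => c * f z) = ENNReal.ofReal (c ^ 2) * Qe a f := by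
  unfold Qe
  rw [← lintegral_const_mul' _ _ ENNReal.ofReal_ne_top]
  refine lintegral_congr fun z => ?_
  rw [← ENNReal.ofReal_mul (sq_nonneg _)]; congr 1; ring

lemma dff_meas {h : ℝ} {i : Fin 6} {f : P6 → ℝ} (hf : Measurable f) : Measurable (dff h i f) := by
  unfold dff; fun_prop
lemma shf_meas {h : ℝ} {i : Fin 6} {f : P6 → ℝ} (hf : Measurable f) : Measurable (shf h i f) := by
  unfold shf; fun_prop
lemma dlf_meas {h : ℝ} {L : List (Fin 6)} : ∀ {f : P6 → ℝ}, Measurable f → Measurable (dlf h L f) := by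
  induction L with
  | nil => intro f hf; exact hf
  | cons i L ih => intro f hf; exact ih (dff_meas hf)

lemma dff_add (h : ℝ) (i : Fin 6) (f g : P6 → ℝ) :
    dff h i (fun z => f z + g z) = fun z => dff h i f z + dff h i g z := by
  unfold dff; funext z; ring
lemma dlf_add (h : ℝ) (L : List (Fin 6)) : ∀ (f g : P6 → ℝ),
    dlf h L (fun z => f z + g z) = fun z => dlf h L f z + dlf h L g z := by
  induction L with
  | nil => intro f g; rfl
  | cons i L ih => intro f g; simp only [dlf]; rw [dff_add, ih]
lemma dff_smul (h : ℝ) (i : Fin 6) (c : ℝ) (f : P6 → ℝ) :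
    dff h i (fun z => c * f z) = fun z => c * dff h i f z := by
  unfold dff; funext z; ring
lemma dlf_smul (h : ℝ) (L : List (Fin 6)) (c : ℝ) : ∀ (f : P6 → ℝ),
    dlf h L (fun z => c * f z) = fun z => c * dlf h L f z := by
  induction L with
  | nil => intro f; rfl
  | cons i L ih => intro f; simp only [dlf]; rw [dff_smul, ih]
lemma dlf_sum {ι : Type*} (h : ℝ) (L : List (Fin 6)) (s : Finset ι) (f : ι → P6 → ℝ) :
    dlf h L (fun z => ∑ j ∈ s, f j z) = fun z => ∑ j ∈ s, dlf h L (f j) z := by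
  classical
  induction s using Finset.induction_on with
  | empty => simpa using dlf_smul h L 0 (fun _ => 0)
  | insert j s hj ih => simp only [Finset.sum_insert hj]; rw [dlf_add, ih]

lemma dff_shf (h s : ℝ) (i j : Fin 6) (f : P6 → ℝ) :
    dff h i (shf s j f) = shf s j (dff h i f) := by
  unfold dff shf; funext z; simp only [add_right_comm]
lemma dff_comm (h s : ℝ) (i j : Fin 6) (f : P6 → ℝ) :
    dff h i (dff s j f) = dff s j (dff h i f) := by
  unfold dff; funext z; simp only [add_right_comm z]; ring
lemma dlf_shf (h s : ℝ) (j : Fin 6) (L : List (Fin 6)) : ∀ (f : P6 → ℝ),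
    dlf h L (shf s j f) = shf s j (dlf h L f) := by
  induction L with
  | nil => intro f; rfl
  | cons i L ih => intro f; simp only [dlf]; rw [dff_shf, ih]
lemma dlf_dff (h s : ℝ) (j : Fin 6) (L : List (Fin 6)) : ∀ (f : P6 → ℝ),
    dlf h L (dff s j f) = dff s j (dlf h L f) := by
  induction L with
  | nil => intro f; rfl
  | cons i L ih => intro f; simp only [dlf]; rw [dff_comm, ih]

lemma dff_mul (h : ℝ) (i : Fin 6) (b f : P6 → ℝ) :
    dff h i (fun z => b z * f z) = fun z => b z * dff h i f z + dff h i b z * shf h i f z := by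
  unfold dff shf; funext z; ring

lemma shift_const {h : ℝ} (h0 : 0 < h) (h1 : h ≤ 1) (a : ℕ) :
    ENNReal.ofReal ((1 + |h| + h ^ 2) ^ a) ≤ 3 ^ a := by
  rw [ENNReal.ofReal_pow (by positivity)]
  gcongr
  rw [show (3 : ℝ≥0∞) = ENNReal.ofReal 3 by simp]
  apply ENNReal.ofReal_le_ofReal
  rw [abs_of_pos h0]; nlinarith

/-- Discrete Leibniz bound. -/
lemma leib1 (a : ℕ) {h : ℝ} (h0 : 0 < h) (h1 : h ≤ 1) : ∀ (L : List (Fin 6)) (b f : P6 → ℝ)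
    (B n : ℕ → ℝ≥0∞), Measurable b → Measurable f →
    (∀ S : List (Fin 6), S.length ≤ L.length → ∀ z, ENNReal.ofReal (dlf h S b z ^ 2) ≤ B S.length) →
    (∀ S : List (Fin 6), S.length ≤ L.length → Qe a (dlf h S f) ≤ n S.length) →
    Qe a (dlf h L (fun z => b z * f z)) ≤
      (4 * 3 ^ a) ^ L.length * ∑ j ∈ Finset.range (L.length + 1), B j * n (L.length - j) := by
  intro L
  induction L with
  | nil =>
    intro b f B n hb hf hB hn
    simp only [dlf, List.length_nil, pow_zero, one_mul, zero_add, Finset.sum_range_one, Nat.sub_zero]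
    refine (Qe_mul a (fun z => hB [] (by simp) z) hf).trans ?_
    exact mul_le_mul' le_rfl (hn [] (by simp))
  | cons i L ih =>
    intro b f B n hb hf hB hn
    simp only [dlf]
    rw [dff_mul, dlf_add]
    refine (Qe_add a (dlf_meas (hb.mul (dff_meas hf)))).trans ?_
    have e1 := ih b (dff h i f) B (fun k => n (k + 1)) hb (dff_meas hf)
      (fun S hS z => hB S (by simp; omega) z)
      (fun S hS => hn (i :: S) (by simp; omega))
    have e2 := ih (dff h i b) (shf h i f) (fun k => B (k + 1)) (fun k => 3 ^ a * n k) (dff_meas hb)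
      (shf_meas hf)
      (fun S hS z => hB (i :: S) (by simp; omega) z)
      (fun S hS => by
        rw [dlf_shf]
        exact (Qe_shf a h i _).trans (mul_le_mul' (shift_const h0 h1 a) (hn S (by simp; omega))))
    set X := ∑ j ∈ Finset.range ((i :: L).length + 1), B j * n ((i :: L).length - j) with hX
    have s1 : ∑ j ∈ Finset.range (L.length + 1), B j * n (L.length - j + 1) ≤ X := by
      rw [hX, List.length_cons, Finset.sum_range_succ _ (L.length + 1)]
      refine le_trans (le_of_eq ?_) (self_le_add_right _ _)
      refine Finset.sum_congr rfl fun j hj => ?_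
      rw [Finset.mem_range] at hj
      congr 2; omega
    have s2 : ∑ j ∈ Finset.range (L.length + 1), B (j + 1) * (3 ^ a * n (L.length - j)) ≤ 3 ^ a * X := by
      rw [hX, List.length_cons, Finset.sum_range_succ' _ (L.length + 1), mul_add, Finset.mul_sum]
      refine le_trans (le_of_eq ?_) (self_le_add_right _ _)
      refine Finset.sum_congr rfl fun j hj => ?_
      rw [show L.length + 1 - (j + 1) = L.length - j by omega]; ring
    have h3 : (1 : ℝ≥0∞) ≤ 3 ^ a := one_le_pow₀ (by norm_num)
    calc _ ≤ 2 * ((4 * 3 ^ a) ^ L.length * X) + 2 * ((4 * 3 ^ a) ^ L.length * (3 ^ a * X)) := by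
          gcongr
          · exact e1.trans (by gcongr)
          · exact e2.trans (by gcongr)
      _ ≤ 2 * ((4 * 3 ^ a) ^ L.length * (3 ^ a * X)) + 2 * ((4 * 3 ^ a) ^ L.length * (3 ^ a * X)) := by
          gcongr
          exact le_mul_of_one_le_left' h3
      _ = _ := by rw [List.length_cons, pow_succ]; ring

lemma leib2 (a : ℕ) {h : ℝ} (h0 : 0 < h) (h1 : h ≤ 1) : ∀ (L : List (Fin 6)) (b f : P6 → ℝ)
    (B n : ℕ → ℝ≥0∞), Measurable b → Measurable f →
    (∀ S : List (Fin 6), 1 ≤ S.length → S.length ≤ L.length →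
      ∀ z, ENNReal.ofReal (dlf h S b z ^ 2) ≤ B S.length) →
    (∀ S : List (Fin 6), S.length < L.length → Qe a (dlf h S f) ≤ n S.length) →
    Qe a (fun z => dlf h L (fun z => b z * f z) z - b z * dlf h L f z) ≤
      (4 * 3 ^ a) ^ L.length * ∑ j ∈ Finset.range L.length, B (j + 1) * n (L.length - (j + 1)) := by
  intro L
  induction L with
  | nil =>
    intro b f B n hb hf hB hn
    simp [dlf, Qe]
  | cons i L ih =>
    intro b f B n hb hf hB hn
    simp only [dlf]
    rw [dff_mul, dlf_add]
    have e0 : (fun z => dlf h L (fun z => b z * dff h i f z) z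
        + dlf h L (fun z => dff h i b z * shf h i f z) z - b z * dlf h L (dff h i f) z)
        = fun z => (dlf h L (fun z => b z * dff h i f z) z - b z * dlf h L (dff h i f) z)
        + dlf h L (fun z => dff h i b z * shf h i f z) z := by funext z; ring
    rw [e0]
    refine (Qe_add a ((dlf_meas (hb.mul (dff_meas hf))).sub (hb.mul (dlf_meas (dff_meas hf))))).trans ?_
    have e1 := ih b (dff h i f) B (fun k => n (k + 1)) hb (dff_meas hf)
      (fun S hS hS' z => hB S hS (by simp; omega) z)
      (fun S hS => hn (i :: S) (by simp; omega))
    have e2 := leib1 a h0 h1 L (dff h i b) (shf h i f) (fun k => B (k + 1)) (fun k => 3 ^ a * n k)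
      (dff_meas hb) (shf_meas hf)
      (fun S hS z => hB (i :: S) (by simp) (by simp; omega) z)
      (fun S hS => by
        rw [dlf_shf]
        exact (Qe_shf a h i _).trans (mul_le_mul' (shift_const h0 h1 a) (hn S (by simp; omega))))
    set X := ∑ j ∈ Finset.range (i :: L).length, B (j + 1) * n ((i :: L).length - (j + 1)) with hX
    have s1 : ∑ j ∈ Finset.range L.length, B (j + 1) * n (L.length - (j + 1) + 1) ≤ X := by
      rw [hX, List.length_cons, Finset.sum_range_succ]
      refine le_trans (le_of_eq ?_) (self_le_add_right _ _)
      refine Finset.sum_congr rfl fun j hj => ?_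
      rw [Finset.mem_range] at hj
      congr 2; omega
    have s2 : ∑ j ∈ Finset.range (L.length + 1), B (j + 1) * (3 ^ a * n (L.length - j)) ≤ 3 ^ a * X := by
      rw [hX, List.length_cons, Finset.mul_sum]
      refine Finset.sum_le_sum fun j hj => le_of_eq ?_
      rw [show L.length + 1 - (j + 1) = L.length - j by omega]; ring
    have h3 : (1 : ℝ≥0∞) ≤ 3 ^ a := one_le_pow₀ (by norm_num)
    calc _ ≤ 2 * ((4 * 3 ^ a) ^ L.length * X) + 2 * ((4 * 3 ^ a) ^ L.length * (3 ^ a * X)) := by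
          gcongr
          · exact e1.trans (by gcongr)
          · exact e2.trans (by gcongr)
      _ ≤ 2 * ((4 * 3 ^ a) ^ L.length * (3 ^ a * X)) + 2 * ((4 * 3 ^ a) ^ L.length * (3 ^ a * X)) := by
          gcongr
          exact le_mul_of_one_le_left' h3
      _ = _ := by rw [List.length_cons, pow_succ]; ring

/-! ### Schwartz functions: derivatives versus differences -/

abbrev SP := SchwartzMap P6 ℝ

def dS (i : Fin 6) (f : SP) : SP := ∂_{dir6 i} f

lemma dS_apply (i : Fin 6) (f : SP) (z : P6) : dS i f z = fderiv ℝ f z (dir6 i) :=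
  SchwartzMap.lineDerivOp_apply_eq_fderiv _ _ _

lemma dS_comm (i j : Fin 6) (f : SP) : dS i (dS j f) = dS j (dS i f) := by
  ext z
  have key : ∀ (i j : Fin 6), dS i (dS j f) z = fderiv ℝ (fderiv ℝ f) z (dir6 i) (dir6 j) := by
    intro i j
    have e : (dS j f : P6 → ℝ) = fun z => fderiv ℝ f z (dir6 j) := by funext z; exact dS_apply j f z
    have hd : DifferentiableAt ℝ (fderiv ℝ f) z :=
      ((f.smooth 2).fderiv_right (m := 1) (by norm_num)).differentiable (by norm_num) z
    rw [dS_apply, e, fderiv_clm_apply hd (differentiableAt_const _)]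
    simp
  rw [key, key]
  have hs : IsSymmSndFDerivAt ℝ f z :=
    (f.smooth 2).contDiffAt.isSymmSndFDerivAt (by simp)
  exact hs _ _

def plS : List (Fin 6) → SP → SP
  | [], f => f
  | i :: L, f => plS L (dS i f)

lemma plS_dS (L : List (Fin 6)) (i : Fin 6) : ∀ f, plS L (dS i f) = dS i (plS L f) := by
  induction L with
  | nil => intro f; rfl
  | cons j L ih => intro f; simp only [plS]; rw [dS_comm, ih]

lemma plS_append (L L' : List (Fin 6)) : ∀ f, plS (L ++ L') f = plS L' (plS L f) := by
  induction L with
  | nil => intro f; rfl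
  | cons j L ih => intro f; simp only [plS, List.cons_append]; rw [ih]

lemma plS_perm {L L' : List (Fin 6)} (h : L.Perm L') : ∀ f, plS L f = plS L' f := by
  induction h with
  | nil => intro f; rfl
  | cons x _ ih => intro f; simp only [plS]; rw [ih]
  | swap x y l => intro f; simp only [plS]; rw [dS_comm]
  | trans _ _ ih1 ih2 => intro f; rw [ih1, ih2]

lemma S_hasDeriv_line (f : SP) (i : Fin 6) (z : P6) (s : ℝ) :
    HasDerivAt (fun s : ℝ => f (z + s • dir6 i)) (dS i f (z + s • dir6 i)) s := by
  have h1 := f.hasFDerivAt (z + s • dir6 i)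
  have h2 : HasDerivAt (fun s : ℝ => z + s • dir6 i) (dir6 i) s := by
    simpa using ((hasDerivAt_id s).smul_const (dir6 i)).const_add z
  rw [dS_apply]
  exact h1.comp_hasDerivAt s h2

def shS (h : ℝ) (i : Fin 6) (f : SP) : SP := SchwartzMap.compSubConstCLM ℝ (-(h • dir6 i)) f
lemma shS_apply (h : ℝ) (i : Fin 6) (f : SP) (z : P6) : shS h i f z = f (z + h • dir6 i) := by
  simp [shS]
def dfS (h : ℝ) (i : Fin 6) (f : SP) : SP := h⁻¹ • (shS h i f - f)
lemma dfS_apply (h : ℝ) (i : Fin 6) (f : SP) : (dfS h i f : P6 → ℝ) = dff h i f := by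
  funext z; simp [dfS, dff, shS_apply]; ring

lemma dS_shS (h : ℝ) (i j : Fin 6) (f : SP) : dS i (shS h j f) = shS h j (dS i f) := by
  ext z
  rw [shS_apply, dS_apply, dS_apply]
  have : (shS h j f : P6 → ℝ) = fun z => f (z + h • dir6 j) := by funext z; rw [shS_apply]
  rw [this, fderiv_comp_add_right]

lemma dS_sub (i : Fin 6) (f g : SP) : dS i (f - g) = dS i f - dS i g := by
  unfold dS; exact map_sub (LineDeriv.lineDerivOpCLM ℝ SP (dir6 i)) f g
lemma dS_smul (i : Fin 6) (c : ℝ) (f : SP) : dS i (c • f) = c • dS i f := by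
  unfold dS; exact map_smul (LineDeriv.lineDerivOpCLM ℝ SP (dir6 i)) c f

lemma dS_dfS (h : ℝ) (i j : Fin 6) (f : SP) : dS i (dfS h j f) = dfS h j (dS i f) := by
  unfold dfS; rw [dS_smul, dS_sub, dS_shS]

lemma plS_sub (L : List (Fin 6)) : ∀ f g, plS L (f - g) = plS L f - plS L g := by
  induction L with
  | nil => intro f g; rfl
  | cons j L ih => intro f g; simp only [plS]; rw [dS_sub, ih]
lemma plS_dfS (h : ℝ) (j : Fin 6) (L : List (Fin 6)) : ∀ f, plS L (dfS h j f) = dfS h j (plS L f) := by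
  induction L with
  | nil => intro f; rfl
  | cons j L ih => intro f; simp only [plS]; rw [dS_dfS, ih]

/-- iterated difference at Schwartz level -/
def dlS (h : ℝ) : List (Fin 6) → SP → SP
  | [], f => f
  | i :: L, f => dlS h L (dfS h i f)
lemma dlS_apply (h : ℝ) (L : List (Fin 6)) : ∀ f : SP, (dlS h L f : P6 → ℝ) = dlf h L f := by
  induction L with
  | nil => intro f; rfl
  | cons i L ih => intro f; simp only [dlS, dlf]; rw [ih, dfS_apply]
lemma dS_dlS (h : ℝ) (i : Fin 6) (L : List (Fin 6)) : ∀ f, dS i (dlS h L f) = dlS h L (dS i f) := by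
  induction L with
  | nil => intro f; rfl
  | cons j L ih => intro f; simp only [dlS]; rw [ih, dS_dfS]

lemma S_bdd (f : SP) : ∃ C, 0 ≤ C ∧ ∀ z, |f z| ≤ C := by
  obtain ⟨C, hC⟩ := f.decay' 0 0
  refine ⟨|C|, abs_nonneg _, fun z => ?_⟩
  have := hC z
  simp only [pow_zero, one_mul, norm_iteratedFDeriv_zero] at this
  exact (this.trans (le_abs_self C))

lemma dff_bound {h : ℝ} (h0 : 0 < h) (i : Fin 6) (f : SP) {C : ℝ} (hC : ∀ z, |dS i f z| ≤ C) (z : P6) :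
    |dff h i f z| ≤ C := by
  have := Convex.norm_image_sub_le_of_norm_hasDerivWithin_le (f := fun s : ℝ => f (z + s • dir6 i))
    (f' := fun s => dS i f (z + s • dir6 i)) (s := Set.univ) (x := 0) (y := h) (C := C)
    (fun s _ => (S_hasDeriv_line f i z s).hasDerivWithinAt) (fun s _ => hC _) convex_univ trivial trivial
  simp only [zero_smul, add_zero, sub_zero, Real.norm_eq_abs] at this
  unfold dff
  rw [abs_div, abs_of_pos h0, div_le_iff₀ h0]
  rwa [abs_of_pos h0] at this

lemma dff_sub_bound {h : ℝ} (h0 : 0 < h) (i : Fin 6) (f : SP) {C : ℝ}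
    (hC : ∀ z, |dS i (dS i f) z| ≤ C) (z : P6) :
    |dff h i f z - dS i f z| ≤ h * C := by
  have hC0 : 0 ≤ C := (abs_nonneg _).trans (hC 0)
  have key : ∀ s ∈ Set.Icc 0 h, |dS i f (z + s • dir6 i) - dS i f z| ≤ h * C := by
    intro s hs
    rcases hs.1.eq_or_lt with rfl | hs0
    · simp; positivity
    have := dff_bound hs0 i (dS i f) hC z
    unfold dff at this
    rw [abs_div, abs_of_pos hs0, div_le_iff₀ hs0] at this
    nlinarith [hs.2]
  have := Convex.norm_image_sub_le_of_norm_hasDerivWithin_le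
    (f := fun s : ℝ => f (z + s • dir6 i) - s * dS i f z)
    (f' := fun s => dS i f (z + s • dir6 i) - dS i f z) (s := Set.Icc 0 h) (x := 0) (y := h) (C := h * C)
    (fun s _ => ((S_hasDeriv_line f i z s).sub (by simpa using (hasDerivAt_id s).mul_const (dS i f z))).hasDerivWithinAt)
    (fun s hs => key s hs) (convex_Icc _ _) (by simp [h0.le]) (by simp [h0.le])
  simp only [zero_smul, add_zero, sub_zero, Real.norm_eq_abs, zero_mul, abs_of_pos h0] at this
  unfold dff
  have e : (f (z + h • dir6 i) - f z) / h - dS i f z = (f (z + h • dir6 i) - h * dS i f z - f z) / h := by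
    field_simp; ring
  rw [e, abs_div, abs_of_pos h0, div_le_iff₀ h0]
  exact this

lemma dlf_bound {h : ℝ} (h0 : 0 < h) {C : ℝ} (L : List (Fin 6)) : ∀ (f : SP),
    (∀ z, |plS L f z| ≤ C) → ∀ z, |dlf h L f z| ≤ C := by
  induction L with
  | nil => intro f hf; exact hf
  | cons i L ih =>
    intro f hf z
    simp only [dlf]
    rw [← dfS_apply]
    refine ih _ (fun z => ?_) z
    rw [plS_dfS, dfS_apply]
    refine dff_bound h0 i _ (fun z => ?_) z
    rw [← plS_dS]; exact hf z

lemma dlf_conv (L : List (Fin 6)) : ∀ (f : SP), ∃ C, ∀ h : ℝ, 0 < h → ∀ z,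
    |dlf h L f z - plS L f z| ≤ h * C := by
  induction L with
  | nil => intro f; exact ⟨0, fun h h0 z => by simp [dlf, plS]⟩
  | cons i L ih =>
    intro f
    obtain ⟨C1, hC1⟩ := ih (dS i f)
    obtain ⟨C2, _, hC2⟩ := S_bdd (dS i (dS i (plS L f)))
    refine ⟨C2 + C1, fun h h0 z => ?_⟩
    have e1 : dlf h (i :: L) f z = dlf h L (dfS h i f - dS i f : SP) z + dlf h L (dS i f) z := by
      simp only [dlf]
      have := congrFun (dlf_add h L (dfS h i f - dS i f : SP) (dS i f)) z
      rw [← this, ← dfS_apply]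
      congr 1
      funext z; simp
    have e2 : |dlf h L (dfS h i f - dS i f : SP) z| ≤ h * C2 := by
      refine dlf_bound h0 L _ (fun z => ?_) z
      rw [plS_sub, plS_dfS, plS_dS, sub_apply, dfS_apply]
      exact dff_sub_bound h0 i _ hC2 z
    have e3 := hC1 h h0 z
    rw [e1]
    simp only [plS]
    calc _ = |dlf h L (dfS h i f - dS i f : SP) z + (dlf h L (dS i f) z - plS L (dS i f) z)| := by
          congr 1; ring
      _ ≤ _ := abs_add_le _ _
      _ ≤ h * (C2 + C1) := by linarith

lemma Qe_lt_top (a : ℕ) (f : SP) : Qe a f < ⊤ := by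
  obtain ⟨C, hC0, hC⟩ := S_bdd f
  have h1 : Integrable (fun z : P6 => ‖z‖ ^ (2 * a) * ‖f z‖) := f.integrable_pow_mul volume (2 * a)
  have h2 : Integrable (fun z : P6 => ‖f z‖) := f.integrable.norm
  have h3 := ((h1.const_mul (4 ^ a * 3 ^ a * C)).add (h2.const_mul (4 ^ a * 3 ^ a * C)))
  have h4 : Integrable (fun z => wt z ^ a * f z ^ 2) := by
    refine h3.mono' ?_ (Filter.Eventually.of_forall fun z => ?_)
    · exact ((wt_cont.pow a).mul (f.continuous.pow 2)).aestronglyMeasurable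
    · have hw := wt_pos z
      rw [Real.norm_of_nonneg (by positivity)]
      simp only [Pi.add_apply]
      have w1 : wt z ≤ 3 * max 1 (‖z‖ ^ 2) := by
        have a1 := pow_le_pow_left₀ (norm_nonneg _) (norm_fst_le z) 2
        have a2 := pow_le_pow_left₀ (norm_nonneg _) (norm_snd_le z) 2
        have := le_max_left 1 (‖z‖ ^ 2)
        have := le_max_right 1 (‖z‖ ^ 2)
        unfold wt; linarith
      have w2 : wt z ^ a ≤ 3 ^ a * (1 + ‖z‖ ^ (2 * a)) := by
        calc wt z ^ a ≤ (3 * max 1 (‖z‖ ^ 2)) ^ a := pow_le_pow_left₀ hw.le w1 a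
          _ = 3 ^ a * (max 1 (‖z‖ ^ 2)) ^ a := mul_pow _ _ _
          _ ≤ _ := by
            gcongr
            rcases max_choice 1 (‖z‖ ^ 2) with h | h <;> rw [h]
            · simp
            · rw [← pow_mul]; simp
      have hz := hC z
      have f2 : f z ^ 2 ≤ C * |f z| := by rw [← sq_abs, sq]; gcongr
      have p4 : (1 : ℝ) ≤ 4 ^ a := one_le_pow₀ (by norm_num)
      rw [Real.norm_eq_abs]
      calc wt z ^ a * f z ^ 2 ≤ (3 ^ a * (1 + ‖z‖ ^ (2 * a))) * (C * |f z|) := by gcongr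
        _ ≤ 4 ^ a * ((3 ^ a * (1 + ‖z‖ ^ (2 * a))) * (C * |f z|)) := le_mul_of_one_le_left (by positivity) p4
        _ = _ := by ring
  have := h4.lintegral_lt_top
  exact this

lemma Qe_dff (a : ℕ) {h : ℝ} (h0 : 0 < h) (i : Fin 6) (f : SP) :
    Qe a (dff h i f) ≤ ENNReal.ofReal ((1 + h + h ^ 2) ^ a) * Qe a (dS i f) := by
  have pt : ∀ z, ENNReal.ofReal (wt z ^ a * dff h i f z ^ 2) ≤
      ∫⁻ θ in Set.Ioc (0:ℝ) 1, ENNReal.ofReal (wt z ^ a * (dS i f (z + (θ * h) • dir6 i)) ^ 2) := by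
    intro z
    have hd : ∀ θ ∈ Set.uIcc (0:ℝ) 1, HasDerivAt (fun θ : ℝ => f (z + (θ * h) • dir6 i) / h)
        (dS i f (z + (θ * h) • dir6 i)) θ := by
      intro θ _
      have := ((S_hasDeriv_line f i z (θ * h)).scomp θ ((hasDerivAt_id θ).mul_const h)).div_const h
      refine this.congr_deriv ?_
      rw [smul_eq_mul, one_mul]; field_simp
    have hc : Continuous fun θ : ℝ => dS i f (z + (θ * h) • dir6 i) :=
      (dS i f).continuous.comp (by fun_prop)
    have ftc := intervalIntegral.integral_eq_sub_of_hasDerivAt hd (hc.intervalIntegrable _ _)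
    have e : dff h i f z = ∫ θ in (0:ℝ)..1, dS i f (z + (θ * h) • dir6 i) := by
      rw [ftc]; unfold dff; simp; ring
    set g := fun θ : ℝ => dS i f (z + (θ * h) • dir6 i) with hg
    have cs : (∫ θ in (0:ℝ)..1, g θ) ^ 2 ≤ ∫ θ in (0:ℝ)..1, g θ ^ 2 := by
      set m := ∫ θ in (0:ℝ)..1, g θ with hm
      have i2 : IntervalIntegrable (fun θ => g θ ^ 2) volume 0 1 := (hc.pow 2).intervalIntegrable _ _
      have i1 : IntervalIntegrable (fun θ => 2 * m * g θ) volume 0 1 := (hc.const_mul _).intervalIntegrable _ _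
      have : 0 ≤ ∫ θ in (0:ℝ)..1, (g θ ^ 2 - 2 * m * g θ + m ^ 2) := by
        refine intervalIntegral.integral_nonneg (by norm_num) fun θ _ => ?_
        nlinarith [sq_nonneg (g θ - m)]
      rw [intervalIntegral.integral_add (i2.sub i1) (by simp), intervalIntegral.integral_sub i2 i1,
        intervalIntegral.integral_const_mul] at this
      simp only [intervalIntegral.integral_const, sub_zero, one_smul, ← hm] at this
      nlinarith
    rw [← ofReal_integral_eq_lintegral_ofReal]
    · refine ENNReal.ofReal_le_ofReal ?_
      rw [← intervalIntegral.integral_of_le (by norm_num), intervalIntegral.integral_const_mul, e]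
      exact mul_le_mul_of_nonneg_left cs (pow_nonneg (wt_pos z).le _)
    · have := ((hc.pow 2).const_mul (wt z ^ a)).intervalIntegrable (μ := volume) 0 1
      exact (intervalIntegrable_iff_integrableOn_Ioc_of_le (by norm_num)).1 this
    · exact Filter.Eventually.of_forall fun θ => mul_nonneg (pow_nonneg (wt_pos z).le _) (sq_nonneg _)
  calc Qe a (dff h i f) ≤ ∫⁻ z, ∫⁻ θ in Set.Ioc (0:ℝ) 1,
        ENNReal.ofReal (wt z ^ a * (dS i f (z + (θ * h) • dir6 i)) ^ 2) := lintegral_mono pt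
    _ = ∫⁻ θ in Set.Ioc (0:ℝ) 1, ∫⁻ z,
        ENNReal.ofReal (wt z ^ a * (dS i f (z + (θ * h) • dir6 i)) ^ 2) := by
        refine lintegral_lintegral_swap ?_
        refine Measurable.aemeasurable ?_
        refine ENNReal.measurable_ofReal.comp (Continuous.measurable ?_)
        have := wt_cont
        have := (dS i f).continuous
        show Continuous fun p : P6 × ℝ => wt p.1 ^ a * (dS i f (p.1 + (p.2 * h) • dir6 i)) ^ 2
        fun_prop
    _ ≤ ∫⁻ θ in Set.Ioc (0:ℝ) 1, ENNReal.ofReal ((1 + h + h ^ 2) ^ a) * Qe a (dS i f) := by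
        refine setLIntegral_mono' measurableSet_Ioc fun θ hθ => ?_
        have := Qe_shf a (θ * h) i (dS i f)
        unfold Qe shf at this
        refine this.trans ?_
        refine mul_le_mul' (ENNReal.ofReal_le_ofReal ?_) le_rfl
        have p : 0 ≤ θ * h := mul_nonneg hθ.1.le h0.le
        have q : θ * h ≤ h := by nlinarith [hθ.2]
        rw [abs_of_nonneg p]
        gcongr
    _ = _ := by simp

lemma Qe_dlf (a : ℕ) {h : ℝ} (h0 : 0 < h) (L : List (Fin 6)) : ∀ (f : SP),
    Qe a (dlf h L f) ≤ ENNReal.ofReal ((1 + h + h ^ 2) ^ a) ^ L.length * Qe a (plS L f) := by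
  induction L with
  | nil => intro f; simp [dlf, plS]
  | cons i L ih =>
    intro f
    simp only [dlf, plS, List.length_cons]
    rw [← dfS_apply]
    refine (ih _).trans ?_
    rw [pow_succ _ L.length, mul_assoc, plS_dfS, dfS_apply, plS_dS]
    gcongr
    exact Qe_dff a h0 i _

lemma Qe_dlf3 (a : ℕ) {h : ℝ} (h0 : 0 < h) (h1 : h ≤ 1) (L : List (Fin 6)) (f : SP) :
    Qe a (dlf h L f) ≤ (3 ^ a) ^ L.length * Qe a (plS L f) := by
  refine (Qe_dlf a h0 L f).trans ?_
  have := shift_const h0 h1 a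
  rw [abs_of_pos h0] at this
  gcongr

/-- step sizes -/
def hn (n : ℕ) : ℝ := 1 / ((n : ℝ) + 1)
lemma hn_pos (n : ℕ) : 0 < hn n := by unfold hn; positivity
lemma hn_le (n : ℕ) : hn n ≤ 1 := by
  unfold hn; rw [div_le_one (by positivity)]; linarith [(Nat.cast_nonneg n : (0:ℝ) ≤ n)]
lemma hn_tendsto : Filter.Tendsto hn Filter.atTop (nhds 0) := tendsto_one_div_add_atTop_nhds_zero_nat

lemma Qe_fatou (a : ℕ) {g : ℕ → P6 → ℝ} {f : P6 → ℝ} (hg : ∀ n, Measurable (g n))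
    (hlim : ∀ z, Filter.Tendsto (fun n => g n z) Filter.atTop (nhds (f z))) :
    Qe a f ≤ Filter.liminf (fun n => Qe a (g n)) Filter.atTop := by
  unfold Qe
  refine le_trans (le_of_eq ?_) (lintegral_liminf_le ?_)
  · refine lintegral_congr fun z => ?_
    refine (Filter.Tendsto.liminf_eq ?_).symm
    exact (ENNReal.continuous_ofReal.tendsto _).comp (((hlim z).pow 2).const_mul _)
  · intro n
    have := wt_cont.measurable
    have := hg n
    fun_prop

lemma dlf_tendsto (L : List (Fin 6)) (f : SP) (z : P6) :
    Filter.Tendsto (fun n => dlf (hn n) L f z) Filter.atTop (nhds (plS L f z)) := by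
  obtain ⟨C, hC⟩ := dlf_conv L f
  rw [tendsto_iff_norm_sub_tendsto_zero]
  have : Filter.Tendsto (fun n => hn n * C) Filter.atTop (nhds 0) := by
    simpa using hn_tendsto.mul_const C
  exact squeeze_zero (fun n => norm_nonneg _) (fun n => hC _ (hn_pos n) z) this

lemma Qe_plS_le (a : ℕ) (L : List (Fin 6)) (f : SP) {B : ℝ≥0∞} {c : ℕ → ℝ≥0∞}
    (hc : Filter.Tendsto c Filter.atTop (nhds B))
    (h : ∀ n, Qe a (dlf (hn n) L f) ≤ c n) : Qe a (plS L f) ≤ B := by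
  refine (Qe_fatou a (fun n => dlf_meas f.continuous.measurable) (dlf_tendsto L f)).trans ?_
  rw [← hc.liminf_eq]
  exact Filter.liminf_le_liminf (Filter.Eventually.of_forall h)

lemma K_tendsto (a l : ℕ) : Filter.Tendsto
    (fun n => ENNReal.ofReal ((1 + hn n + hn n ^ 2) ^ a) ^ l) Filter.atTop (nhds 1) := by
  have h1 : Filter.Tendsto (fun n => ((1 + hn n + hn n ^ 2) ^ a) ^ l) Filter.atTop (nhds 1) := by
    have := (((hn_tendsto.const_add 1).add (hn_tendsto.pow 2)).pow a).pow l
    simpa using this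
  have := (ENNReal.continuous_ofReal.tendsto _).comp h1
  simp only [ENNReal.ofReal_one] at this
  refine this.congr fun n => ?_
  have := hn_pos n
  simp only [Function.comp]
  rw [ENNReal.ofReal_pow (by positivity)]

/-- The energy of order `l`. -/
def En (a l : ℕ) (f : SP) : ℝ≥0∞ := ⨆ (L : List (Fin 6)) (_ : L.length ≤ l), Qe a (plS L f)

lemma le_En {a l : ℕ} {L : List (Fin 6)} (h : L.length ≤ l) (f : SP) : Qe a (plS L f) ≤ En a l f :=
  le_iSup₂ (f := fun (L : List (Fin 6)) (_ : L.length ≤ l) => Qe a (plS L f)) L h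

lemma En_mono {a l l' : ℕ} (h : l ≤ l') (f : SP) : En a l f ≤ En a l' f :=
  iSup₂_le fun L hL => le_En (hL.trans h) f

lemma En_lt_top (a l : ℕ) (f : SP) : En a l f < ⊤ := by
  have hfin := List.finite_length_le (Fin 6) l
  unfold En
  have : (⨆ (L : List (Fin 6)) (_ : L.length ≤ l), Qe a (plS L f)) ≤ ∑ L ∈ hfin.toFinset, Qe a (plS L f) := by
    refine iSup₂_le fun L hL => ?_
    exact Finset.single_le_sum (f := fun L => Qe a (plS L f)) (fun _ _ => zero_le) (by simpa using hL)
  refine this.trans_lt ?_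
  exact ENNReal.sum_lt_top.2 fun _ _ => Qe_lt_top a _

/-! ### The interaction kernel -/

lemma inv_ae (V : E3 → ℝ) (hV1 : Integrable V)
    (hV2 : Integrable (𝓕 (fun x => (V x : ℂ)))) :
    ∀ᵐ x, (V x : ℂ) = 𝓕 (𝓕 (fun x => (V x : ℂ))) (-x) := by
  set Vc : E3 → ℂ := fun x => (V x : ℂ) with hVc
  have hVc1 : Integrable Vc := hV1.ofReal
  have hcont : Continuous (𝓕 (𝓕 Vc)) :=
    VectorFourier.fourierIntegral_continuous Real.continuous_fourierChar
      (by exact continuous_inner) hV2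
  refine ae_eq_of_integral_contDiff_smul_eq hVc1.locallyIntegrable
    (hcont.comp continuous_neg).locallyIntegrable ?_
  intro g hg hgs
  have hgc : ContDiff ℝ (⊤ : ℕ∞) (fun x => (g x : ℂ)) := Complex.ofRealCLM.contDiff.comp hg
  have hgcs : HasCompactSupport (fun x => (g x : ℂ)) := hgs.comp_left (g := fun x : ℝ => (x : ℂ)) (by simp)
  set φ : 𝓢(E3, ℂ) := hgcs.toSchwartzMap hgc with hφ
  have hφa : ∀ x, φ x = (g x : ℂ) := fun x => rfl
  set ψ : 𝓢(E3, ℂ) := 𝓕⁻ φ with hψ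
  have hψa : 𝓕 (ψ : E3 → ℂ) = φ := by
    rw [← SchwartzMap.fourier_coe, hψ]; simp
  have hψb : (ψ : E3 → ℂ) = 𝓕⁻ (φ : E3 → ℂ) := by
    rw [hψ, SchwartzMap.fourierInv_coe]
  have A : ∫ p, 𝓕 Vc p • ψ p = ∫ x, Vc x • φ x := by
    have := VectorFourier.integral_fourierIntegral_smul_eq_flip (L := innerₗ E3) (μ := volume) (ν := volume)
      Real.continuous_fourierChar continuous_inner hVc1 ψ.integrable
    rw [← hψa]
    simpa using! this
  have B : ∫ x, 𝓕 (𝓕 Vc) x • φ (-x) = ∫ p, 𝓕 Vc p • ψ p := by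
    have := VectorFourier.integral_fourierIntegral_smul_eq_flip (L := innerₗ E3) (μ := volume) (ν := volume)
      Real.continuous_fourierChar continuous_inner hV2 (φ.integrable.comp_neg)
    have e : (ψ : E3 → ℂ) = 𝓕 (fun x => φ (-x)) := by
      rw [hψb, Real.fourierInv_eq_fourier_comp_neg]
    rw [e]
    simpa using! this
  have C := integral_neg_eq_self (fun x => 𝓕 (𝓕 Vc) (-x) • φ x) (volume : Measure E3)
  simp only [neg_neg] at C
  calc ∫ x, g x • Vc x = ∫ x, Vc x • φ x := by
        refine integral_congr_ae (Filter.Eventually.of_forall fun x => ?_)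
        simp [hφa, mul_comm]
    _ = ∫ x, 𝓕 (𝓕 Vc) (-x) • φ x := by rw [← C, B, A]
    _ = _ := by
        refine integral_congr_ae (Filter.Eventually.of_forall fun x => ?_)
        simp [hφa, mul_comm]

lemma V_smooth (V : E3 → ℝ) (hV1 : Integrable V)
    (hV2 : Integrable fun p : E3 => ‖𝓕 (fun x => (V x : ℂ)) p‖ * (1 + ‖p‖ ^ 2)) :
    ∃ (V0 : E3 → ℝ) (c : ℝ), 0 < c ∧ V =ᵐ[volume] V0 ∧ Differentiable ℝ V0 ∧
      (∀ x, |V0 x| ≤ c) ∧ (∀ x, ‖fderiv ℝ V0 x‖ ≤ c) ∧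
      (∀ x y, ‖fderiv ℝ V0 x - fderiv ℝ V0 y‖ ≤ c * ‖x - y‖) := by
  set Vc : E3 → ℂ := fun x => (V x : ℂ) with hVc
  have hVc1 : Integrable Vc := hV1.ofReal
  have hcont : Continuous (𝓕 Vc) :=
    VectorFourier.fourierIntegral_continuous Real.continuous_fourierChar
      (by exact continuous_inner) hVc1
  have hn : ∀ n : ℕ, (n : ℕ∞) ≤ 2 → Integrable (fun v ↦ ‖v‖ ^ n * ‖𝓕 Vc v‖) := by
    intro n hn
    have hn2 : n ≤ 2 := by exact_mod_cast hn
    refine hV2.mono' ((continuous_norm.pow n).mul hcont.norm).aestronglyMeasurable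
      (Filter.Eventually.of_forall fun p => ?_)
    rw [Real.norm_of_nonneg (by positivity), mul_comm]
    gcongr
    interval_cases n
    · simp
    · simp; nlinarith [sq_nonneg (‖p‖ - 1)]
    · simp
  have hVint : Integrable (𝓕 Vc) := by
    have := hn 0 (by simp)
    simp only [pow_zero, one_mul] at this
    exact (integrable_norm_iff hcont.aestronglyMeasurable).1 this
  set G := 𝓕 (𝓕 Vc) with hG
  have hGd : ContDiff ℝ 2 G := Real.contDiff_fourier hn
  have hbound : ∀ n : ℕ, n ≤ 2 → ∃ c, ∀ x, ‖iteratedFDeriv ℝ n G x‖ ≤ c := by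
    intro n hn2
    refine ⟨∫ v, ‖VectorFourier.fourierPowSMulRight (innerSL ℝ) (𝓕 Vc) v n‖, fun x => ?_⟩
    rw [hG, Real.iteratedFDeriv_fourier hn hcont.aestronglyMeasurable (by exact_mod_cast hn2)]
    exact VectorFourier.norm_fourierIntegral_le_integral_norm _ _ _ _ _
  obtain ⟨c0, hc0⟩ := hbound 0 (by norm_num)
  obtain ⟨c1, hc1⟩ := hbound 1 (by norm_num)
  obtain ⟨c2, hc2⟩ := hbound 2 (by norm_num)
  simp only [norm_iteratedFDeriv_zero] at hc0
  simp only [norm_iteratedFDeriv_one] at hc1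
  have hc2' : ∀ x, ‖fderiv ℝ (fderiv ℝ G) x‖ ≤ c2 := by
    intro x
    rw [← norm_iteratedFDeriv_one, norm_iteratedFDeriv_fderiv]; exact hc2 x
  have hGdd : Differentiable ℝ (fderiv ℝ G) :=
    (hGd.fderiv_right (m := 1) (by norm_num)).differentiable (by norm_num)
  have hlip : ∀ x y, ‖fderiv ℝ G x - fderiv ℝ G y‖ ≤ c2 * ‖x - y‖ := fun x y =>
    Convex.norm_image_sub_le_of_norm_fderiv_le (s := Set.univ) (fun x _ => hGdd x) (fun x _ => hc2' x)
      convex_univ trivial trivial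
  have hGdiff : Differentiable ℝ G := hGd.differentiable (by norm_num)
  set V0 : E3 → ℝ := fun x => (G (-x)).re with hV0
  have hfd : ∀ x, HasFDerivAt V0 (-(Complex.reCLM.comp (fderiv ℝ G (-x)))) x := by
    intro x
    have h1 := (hGdiff (-x)).hasFDerivAt
    have h2 : HasFDerivAt (fun x : E3 => -x) (-(ContinuousLinearMap.id ℝ E3)) x := (hasFDerivAt_id x).neg
    have h3 := Complex.reCLM.hasFDerivAt.comp x (h1.comp x h2)
    refine h3.congr_fderiv ?_
    ext v; simp
  have hfd' : ∀ x, fderiv ℝ V0 x = -(Complex.reCLM.comp (fderiv ℝ G (-x))) := fun x => (hfd x).fderiv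
  have hre : ∀ T : E3 →L[ℝ] ℂ, ‖Complex.reCLM.comp T‖ ≤ ‖T‖ := by
    intro T
    refine (ContinuousLinearMap.opNorm_comp_le _ _).trans ?_
    simp
  refine ⟨V0, |c0| + |c1| + |c2| + 1, by positivity, ?_, fun x => (hfd x).differentiableAt, ?_, ?_, ?_⟩
  · filter_upwards [inv_ae V hV1 hVint] with x hx
    simp only [hV0, hG]; rw [← hx]; simp
  · intro x
    have := (Complex.abs_re_le_norm (G (-x))).trans (hc0 (-x))
    linarith [le_abs_self c0, abs_nonneg c1, abs_nonneg c2]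
  · intro x
    rw [hfd', norm_neg]
    have := (hre (fderiv ℝ G (-x))).trans (hc1 (-x))
    linarith [le_abs_self c1, abs_nonneg c0, abs_nonneg c2]
  · intro x y
    rw [hfd', hfd']
    have e : -(Complex.reCLM.comp (fderiv ℝ G (-x))) - -(Complex.reCLM.comp (fderiv ℝ G (-y)))
        = Complex.reCLM.comp (fderiv ℝ G (-y) - fderiv ℝ G (-x)) := by
      ext v; simp; ring
    rw [e]
    have := (hre _).trans (hlip (-y) (-x))
    have e2 : ‖-y - -x‖ = ‖x - y‖ := by congr 1; abel
    rw [e2] at this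
    refine this.trans ?_
    gcongr
    linarith [le_abs_self c2, abs_nonneg c0, abs_nonneg c1]

lemma line_fd {V0 : E3 → ℝ} (hd : Differentiable ℝ V0) (x d : E3) (s : ℝ) :
    HasDerivAt (fun s : ℝ => V0 (x + s • d)) (fderiv ℝ V0 (x + s • d) d) s := by
  have h2 : HasDerivAt (fun s : ℝ => x + s • d) d s := by
    simpa using ((hasDerivAt_id s).smul_const d).const_add x
  exact (hd _).hasFDerivAt.comp_hasDerivAt s h2

lemma V_L2 {V0 : E3 → ℝ} {c : ℝ} (hc : 0 < c) (hVint : Integrable V0) (hd : Differentiable ℝ V0)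
    (hb : ∀ x, |V0 x| ≤ c) (hlip : ∀ x y, ‖fderiv ℝ V0 x - fderiv ℝ V0 y‖ ≤ c * ‖x - y‖)
    (d : E3) (hdn : ‖d‖ = 1) :
    ∫⁻ x, ENNReal.ofReal (fderiv ℝ V0 x d ^ 2) ≤ ENNReal.ofReal (2 * c * ∫ x, |V0 x|) := by
  have hdl : ∀ x y, |fderiv ℝ V0 x d - fderiv ℝ V0 y d| ≤ c * ‖x - y‖ := by
    intro x y
    have := (fderiv ℝ V0 x - fderiv ℝ V0 y).le_opNorm d
    rw [hdn, mul_one] at this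
    exact this.trans (hlip x y)
  have second : ∀ x (h : ℝ), 0 < h → |V0 (x + h • d) + V0 (x - h • d) - 2 * V0 x| ≤ 2 * c * h ^ 2 := by
    intro x h h0
    have := Convex.norm_image_sub_le_of_norm_hasDerivWithin_le
      (f := fun s : ℝ => V0 (x + s • d) + V0 (x + s • (-d)))
      (f' := fun s => fderiv ℝ V0 (x + s • d) d + fderiv ℝ V0 (x + s • (-d)) (-d))
      (s := Set.Icc 0 h) (x := 0) (y := h) (C := 2 * c * h)
      (fun s _ => ((line_fd hd x d s).add (line_fd hd x (-d) s)).hasDerivWithinAt)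
      (fun s hs => by
        have := hdl (x + s • d) (x + s • (-d))
        have e : x + s • d - (x + s • (-d)) = (2 * s) • d := by rw [mul_comm, mul_smul, two_smul]; simp
        rw [e, norm_smul, hdn, mul_one, Real.norm_of_nonneg (by linarith [hs.1])] at this
        rw [map_neg, ← sub_eq_add_neg, Real.norm_eq_abs]
        nlinarith [hs.2])
      (convex_Icc _ _) (by simp [h0.le]) (by simp [h0.le])
    simp only [zero_smul, add_zero, sub_zero, Real.norm_eq_abs, abs_of_pos h0, smul_neg,
      ← sub_eq_add_neg] at this
    calc _ = |V0 (x + h • d) + V0 (x - h • d) - (V0 x + V0 x)| := by congr 1; ring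
      _ ≤ _ := this
      _ = _ := by ring
  have hcont := hd.continuous
  have prodint : ∀ y, Integrable (fun x => V0 x * V0 (x + y)) := by
    intro y
    refine hVint.mul_bdd (c := c) (hcont.comp (continuous_id.add continuous_const)).aestronglyMeasurable
      (Filter.Eventually.of_forall fun x => hb _)
  have sq_int : ∀ y, Integrable (fun x => V0 (x + y) ^ 2) := by
    intro y
    have := (prodint 0).comp_add_right y
    simpa [sq] using this
  have main : ∀ h : ℝ, 0 < h →
      ∫⁻ x, ENNReal.ofReal (((V0 (x + h • d) - V0 x) / h) ^ 2) ≤ ENNReal.ofReal (2 * c * ∫ x, |V0 x|) := by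
    intro h h0
    set y := h • d with hy
    have i0 : Integrable (fun x => V0 x ^ 2) := by simpa using sq_int 0
    have i1 := sq_int y
    have i2 := prodint y
    have i3 : Integrable (fun x => V0 x * V0 (x - y)) := by simpa [sub_eq_add_neg] using prodint (-y)
    have e0 : ∀ x, ((V0 (x + y) - V0 x) / h) ^ 2 = (h ^ 2)⁻¹ * (V0 (x + y) ^ 2 + V0 x ^ 2 - 2 * (V0 x * V0 (x + y))) := by
      intro x; field_simp; ring
    have i4 : Integrable (fun x => ((V0 (x + y) - V0 x) / h) ^ 2) := by
      simp_rw [e0]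
      exact ((i1.add i0).sub (i2.const_mul 2)).const_mul _
    rw [← ofReal_integral_eq_lintegral_ofReal i4 (Filter.Eventually.of_forall fun x => sq_nonneg _)]
    refine ENNReal.ofReal_le_ofReal ?_
    simp_rw [e0]
    have i01 : Integrable (fun x => V0 (x + y) ^ 2 + V0 x ^ 2) := i1.add i0
    have i00 : Integrable (fun x => V0 x ^ 2 + V0 x ^ 2) := i0.add i0
    have i23 : Integrable (fun x => V0 x * V0 (x + y) + V0 x * V0 (x - y)) := i2.add i3
    rw [integral_const_mul, integral_sub i01 (i2.const_mul 2), integral_add i1 i0, integral_const_mul,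
      integral_add_right_eq_self (fun x => V0 x ^ 2) y]
    have e1 : ∫ x, V0 x * V0 (x + y) = ∫ x, V0 x * V0 (x - y) := by
      rw [← integral_add_right_eq_self (fun x => V0 x * V0 (x - y)) y]
      refine integral_congr_ae (Filter.Eventually.of_forall fun x => ?_)
      simp [mul_comm]
    have e5 : ∀ x, -(V0 x * (V0 (x + y) + V0 (x - y) - 2 * V0 x))
          = V0 x ^ 2 + V0 x ^ 2 - (V0 x * V0 (x + y) + V0 x * V0 (x - y)) := by intro x; ring
    have i5 : Integrable (fun x => -(V0 x * (V0 (x + y) + V0 (x - y) - 2 * V0 x))) := by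
      simp_rw [e5]; exact i00.sub i23
    have e3 : (∫ x, V0 x ^ 2) + (∫ x, V0 x ^ 2) - 2 * ∫ x, V0 x * V0 (x + y)
        = ∫ x, -(V0 x * (V0 (x + y) + V0 (x - y) - 2 * V0 x)) := by
      simp_rw [e5]
      rw [integral_sub i00 i23, integral_add i0 i0, integral_add i2 i3, ← e1]; ring
    rw [e3]
    have e4 : ∫ x, -(V0 x * (V0 (x + y) + V0 (x - y) - 2 * V0 x)) ≤ ∫ x, 2 * c * h ^ 2 * |V0 x| := by
      refine integral_mono i5 (hVint.abs.const_mul _) fun x => ?_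
      have h1 := second x h h0
      calc _ ≤ |-(V0 x * (V0 (x + y) + V0 (x - y) - 2 * V0 x))| := le_abs_self _
        _ = |V0 (x + y) + V0 (x - y) - 2 * V0 x| * |V0 x| := by rw [abs_neg, abs_mul, mul_comm]
        _ ≤ _ := by gcongr
    rw [integral_const_mul] at e4
    calc _ ≤ (h ^ 2)⁻¹ * (2 * c * h ^ 2 * ∫ x, |V0 x|) := by gcongr
      _ = _ := by field_simp
  have hlim : ∀ x, Filter.Tendsto (fun n => (V0 (x + hn n • d) - V0 x) / hn n) Filter.atTop
      (nhds (fderiv ℝ V0 x d)) := by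
    intro x
    have h1 := (line_fd hd x d 0)
    rw [hasDerivAt_iff_tendsto_slope_zero] at h1
    have h2 : Filter.Tendsto hn Filter.atTop (nhdsWithin 0 {0}ᶜ) :=
      tendsto_nhdsWithin_iff.2 ⟨hn_tendsto, Filter.Eventually.of_forall fun n => (hn_pos n).ne'⟩
    have h3 := h1.comp h2
    simp only [zero_smul, add_zero, zero_add] at h3
    refine h3.congr fun n => ?_
    simp [div_eq_inv_mul]
  calc ∫⁻ x, ENNReal.ofReal (fderiv ℝ V0 x d ^ 2)
      = ∫⁻ x, Filter.liminf (fun n => ENNReal.ofReal (((V0 (x + hn n • d) - V0 x) / hn n) ^ 2)) Filter.atTop := by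
        refine lintegral_congr fun x => ?_
        refine (Filter.Tendsto.liminf_eq ?_).symm
        exact (ENNReal.continuous_ofReal.tendsto _).comp ((hlim x).pow 2)
    _ ≤ Filter.liminf (fun n => ∫⁻ x, ENNReal.ofReal (((V0 (x + hn n • d) - V0 x) / hn n) ^ 2)) Filter.atTop := by
        refine lintegral_liminf_le fun n => ?_
        have := hcont.measurable
        fun_prop
    _ ≤ Filter.liminf (fun _ : ℕ => ENNReal.ofReal (2 * c * ∫ x, |V0 x|)) Filter.atTop :=
        Filter.liminf_le_liminf (Filter.Eventually.of_forall fun n => main _ (hn_pos n))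
    _ = _ := by simp

/-! ### Force bounds -/

lemma cs_int {f g : P6 → ℝ} (hf : Measurable f) (hg : Measurable g) :
    ENNReal.ofReal ((∫ z, f z * g z) ^ 2) ≤
      (∫⁻ z, ENNReal.ofReal (f z ^ 2)) * (∫⁻ z, ENNReal.ofReal (g z ^ 2)) := by
  have e : ∀ x : ℝ, ENNReal.ofReal (x ^ 2) = ‖x‖ₑ ^ 2 := by
    intro x
    rw [Real.enorm_eq_ofReal_abs, ← ENNReal.ofReal_pow (abs_nonneg _), sq_abs]
  have h1 : ‖∫ z, f z * g z‖ₑ ≤ ∫⁻ z, ‖f z‖ₑ * ‖g z‖ₑ := by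
    refine (enorm_integral_le_lintegral_enorm _).trans (le_of_eq ?_)
    simp [enorm_mul]
  have h2 := ENNReal.lintegral_mul_le_Lp_mul_Lq (volume : Measure P6) (p := 2) (q := 2)
    ⟨by norm_num, by norm_num, by norm_num⟩ (f := fun z => ‖f z‖ₑ) (g := fun z => ‖g z‖ₑ) hf.enorm.aemeasurable hg.enorm.aemeasurable
  simp_rw [e]
  have h3 := h1.trans h2
  have h4 := pow_le_pow_left₀ (zero_le) h3 2
  refine h4.trans (le_of_eq ?_)
  rw [mul_pow]
  have r : ∀ x : ℝ≥0∞, (x ^ (1 / (2:ℝ))) ^ 2 = x := by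
    intro x
    rw [← ENNReal.rpow_natCast, ← ENNReal.rpow_mul]; norm_num
  rw [r, r]
  simp

lemma cs_wt (b : ℕ) {K g : P6 → ℝ} (hK : Measurable K) (hg : Measurable g) :
    ENNReal.ofReal ((∫ z, K z * g z) ^ 2) ≤
      (∫⁻ z, ENNReal.ofReal (K z ^ 2 * (wt z ^ (2 * b))⁻¹)) * Qe (2 * b) g := by
  have hw := wt_cont.measurable
  have h := cs_int (f := fun z => K z * (wt z ^ b)⁻¹) (g := fun z => wt z ^ b * g z) (by fun_prop) (by fun_prop)
  have e1 : (fun z => K z * (wt z ^ b)⁻¹ * (wt z ^ b * g z)) = fun z => K z * g z := by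
    funext z
    have := pow_pos (wt_pos z) b
    field_simp
  rw [e1] at h
  refine h.trans (le_of_eq ?_)
  unfold Qe
  congr 1
  · refine lintegral_congr fun z => ?_
    congr 1
    rw [mul_pow, inv_pow, ← pow_mul, mul_comm b 2]
  · refine lintegral_congr fun z => ?_
    congr 1
    rw [mul_pow, ← pow_mul, mul_comm b 2]

/-- one-variable weight -/
def jw (w : E3) : ℝ := (1 + ‖w‖ ^ 2) ^ (-(7/2 : ℝ) / 2)
lemma jw_pos (w : E3) : 0 < jw w := by unfold jw; positivity
lemma jw_meas : Measurable jw := by unfold jw; fun_prop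
def JJ : ℝ≥0∞ := ∫⁻ w, ENNReal.ofReal (jw w)
lemma JJ_lt : JJ < ⊤ := by
  have : Integrable jw := by
    unfold jw
    exact integrable_rpow_neg_one_add_norm_sq (by simp; norm_num)
  exact this.lintegral_lt_top

lemma sq_inv_le_jw (w : E3) : ((1 + ‖w‖ ^ 2) ^ 2)⁻¹ ≤ jw w := by
  have h : (1:ℝ) ≤ 1 + ‖w‖ ^ 2 := by nlinarith [sq_nonneg ‖w‖]
  unfold jw
  rw [← Real.rpow_natCast, ← Real.rpow_neg (by linarith)]
  exact Real.rpow_le_rpow_of_exponent_le h (by norm_num)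

lemma wt2_le (z : P6) : (wt z ^ 2)⁻¹ ≤ jw z.2 := by
  refine le_trans ?_ (sq_inv_le_jw z.2)
  have : 1 + ‖z.2‖ ^ 2 ≤ wt z := by unfold wt; nlinarith [sq_nonneg ‖z.1‖]
  gcongr

lemma wt4_le (z : P6) : (wt z ^ 4)⁻¹ ≤ jw z.1 * jw z.2 := by
  refine le_trans ?_ (mul_le_mul (sq_inv_le_jw z.1) (sq_inv_le_jw z.2) (by positivity) (jw_pos _).le)
  rw [← mul_inv, ← mul_pow]
  have h1 : (1 + ‖z.1‖ ^ 2) ≤ wt z := by unfold wt; nlinarith [sq_nonneg ‖z.2‖]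
  have h2 : (1 + ‖z.2‖ ^ 2) ≤ wt z := by unfold wt; nlinarith [sq_nonneg ‖z.1‖]
  have h3 : (1 + ‖z.1‖ ^ 2) * (1 + ‖z.2‖ ^ 2) ≤ wt z ^ 2 := by
    rw [sq (wt z)]; exact mul_le_mul h1 h2 (by positivity) (wt_pos z).le
  calc (wt z ^ 4)⁻¹ = ((wt z ^ 2) ^ 2)⁻¹ := by rw [← pow_mul]
    _ ≤ _ := by gcongr

lemma wt_interp (z : P6) {κ : ℝ} (h0 : 0 < κ) :
    (wt z ^ 2)⁻¹ ≤ κ * jw z.2 + (κ ^ 8)⁻¹ * (wt z ^ 4)⁻¹ := by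
  have hw := wt_pos z
  have hw1 := wt_one_le z
  have hj := jw_pos z.2
  by_cases h : κ ^ 4 * wt z ≤ 1
  · have : (wt z ^ 2)⁻¹ ≤ (κ ^ 8)⁻¹ * (wt z ^ 4)⁻¹ := by
      rw [← mul_inv]
      apply inv_anti₀ (by positivity)
      have : (κ ^ 4 * wt z) ^ 2 ≤ 1 := pow_le_one₀ (by positivity) h
      calc κ ^ 8 * wt z ^ 4 = (κ ^ 4 * wt z) ^ 2 * wt z ^ 2 := by ring
        _ ≤ 1 * wt z ^ 2 := by gcongr
        _ = _ := one_mul _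
    have : 0 ≤ κ * jw z.2 := by positivity
    linarith
  · push Not at h
    have h1 : (wt z ^ 2)⁻¹ ≤ κ * jw z.2 := by
      have e1 : (wt z ^ 2)⁻¹ = wt z ^ (-(1/4) : ℝ) * wt z ^ (-(7/2 : ℝ) / 2) := by
        rw [← Real.rpow_add hw, ← Real.rpow_natCast, ← Real.rpow_neg hw.le]; norm_num
      rw [e1]
      have e2 : wt z ^ (-(7/2 : ℝ) / 2) ≤ jw z.2 := by
        unfold jw
        apply Real.rpow_le_rpow_of_nonpos (by positivity) _ (by norm_num)
        unfold wt; nlinarith [sq_nonneg ‖z.1‖]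
      have e3 : wt z ^ (-(1/4) : ℝ) ≤ κ := by
        have : ((κ ^ 4)⁻¹) ≤ wt z := by
          rw [inv_le_iff_one_le_mul₀ (by positivity)]; nlinarith
        calc wt z ^ (-(1/4) : ℝ) ≤ ((κ ^ 4)⁻¹) ^ (-(1/4) : ℝ) :=
              Real.rpow_le_rpow_of_nonpos (by positivity) this (by norm_num)
          _ = κ := by
              rw [← Real.rpow_natCast, ← Real.rpow_neg h0.le, ← Real.rpow_mul h0.le]; norm_num
      exact mul_le_mul e3 e2 (by positivity) h0.le
    have : 0 ≤ (κ ^ 8)⁻¹ * (wt z ^ 4)⁻¹ := by positivity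
    linarith

/-- A force kernel. -/
structure Ker (U : E3 → ℝ) (c : ℝ) : Prop where
  c1 : 1 ≤ c
  cont : Continuous U
  bdd : ∀ x, |U x| ≤ c
  lip : ∀ x y, |U x - U y| ≤ c * ‖x - y‖
  l2 : ∫⁻ x, ENNReal.ofReal (U x ^ 2) ≤ ENNReal.ofReal c

def cv (U : E3 → ℝ) (g : P6 → ℝ) (x : E3) : ℝ := ∫ z : P6, U (x - z.1) * g z
def FF (U : E3 → ℝ) (g : P6 → ℝ) : P6 → ℝ := fun z => cv U g z.1
def L1 (g : P6 → ℝ) : ℝ := ∫ z, |g z|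


lemma Ker.meas_shift {U : E3 → ℝ} {c : ℝ} (hU : Ker U c) (x : E3) : Measurable fun z : P6 => U (x - z.1) := by
  have := hU.cont.measurable
  fun_prop

lemma Ker.integ {U : E3 → ℝ} {c : ℝ} (hU : Ker U c) (g : SP) (x : E3) : Integrable fun z : P6 => U (x - z.1) * g z := by
  refine g.integrable.bdd_mul (c := c) (hU.meas_shift x).aestronglyMeasurable
    (Filter.Eventually.of_forall fun z => hU.bdd _)

lemma Ker.l2_shift {U : E3 → ℝ} {c : ℝ} (hU : Ker U c) (x : E3) : ∫⁻ y, ENNReal.ofReal (U (x - y) ^ 2) ≤ ENNReal.ofReal c := by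
  have := lintegral_sub_left_eq_self (μ := (volume : Measure E3)) (fun y => ENNReal.ofReal (U y ^ 2)) x
  rw [this]; exact hU.l2

lemma Ker.B0 {U : E3 → ℝ} {c : ℝ} (hU : Ker U c) (g : SP) (x : E3) : |cv U g x| ≤ c * L1 g := by
  unfold cv L1
  have := norm_integral_le_of_norm_le (f := fun z : P6 => U (x - z.1) * g z) (g := fun z => c * |g z|)
    (μ := volume) (g.integrable.abs.const_mul c)
    (Filter.Eventually.of_forall fun z => by
      rw [Real.norm_eq_abs, abs_mul]; exact mul_le_mul_of_nonneg_right (hU.bdd _) (abs_nonneg _))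
  rwa [integral_const_mul] at this

lemma Ker.cv_shift {U : E3 → ℝ} {c : ℝ} (hU : Ker U c) (g : SP) (x y : E3) :
    |cv U g x - cv U g y| ≤ c * ‖x - y‖ * L1 g := by
  unfold cv L1
  rw [← integral_sub (hU.integ g x) (hU.integ g y)]
  have := norm_integral_le_of_norm_le (f := fun z : P6 => U (x - z.1) * g z - U (y - z.1) * g z)
    (g := fun z => c * ‖x - y‖ * |g z|)
    (μ := volume) (g.integrable.abs.const_mul _)
    (Filter.Eventually.of_forall fun z => by
      rw [Real.norm_eq_abs, ← sub_mul, abs_mul]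
      refine mul_le_mul_of_nonneg_right ?_ (abs_nonneg _)
      simpa using hU.lip (x - z.1) (y - z.1))
  rwa [integral_const_mul] at this

lemma Ker.cv_cont {U : E3 → ℝ} {c : ℝ} (hU : Ker U c) (g : SP) : Continuous (cv U g) := by
  have hL : LipschitzWith (Real.toNNReal (c * L1 g)) (cv U g) := by
    refine LipschitzWith.of_dist_le_mul fun x y => ?_
    have h0 : 0 ≤ L1 g := integral_nonneg fun z => abs_nonneg _
    rw [Real.coe_toNNReal _ (mul_nonneg (by linarith [hU.c1]) h0), Real.dist_eq, dist_eq_norm]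
    calc _ ≤ _ := hU.cv_shift g x y
      _ = _ := by ring
  exact hL.continuous

lemma Ker.FF_meas {U : E3 → ℝ} {c : ℝ} (hU : Ker U c) (g : SP) : Measurable (FF U g) :=
  ((hU.cv_cont g).comp continuous_fst).measurable

lemma Ker.B2 {U : E3 → ℝ} {c : ℝ} (hU : Ker U c) (g : SP) (x : E3) :
    ENNReal.ofReal (cv U g x ^ 2) ≤ ENNReal.ofReal c * JJ * Qe 2 g := by
  refine (cs_wt 1 (hU.meas_shift x) g.continuous.measurable).trans ?_
  rw [mul_one]
  gcongr
  calc ∫⁻ z : P6, ENNReal.ofReal (U (x - z.1) ^ 2 * (wt z ^ 2)⁻¹)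
      ≤ ∫⁻ z : P6, ENNReal.ofReal (U (x - z.1) ^ 2) * ENNReal.ofReal (jw z.2) := by
        refine lintegral_mono fun z => ?_
        rw [← ENNReal.ofReal_mul (sq_nonneg _)]
        exact ENNReal.ofReal_le_ofReal (mul_le_mul_of_nonneg_left (wt2_le z) (sq_nonneg _))
    _ = (∫⁻ y, ENNReal.ofReal (U (x - y) ^ 2)) * JJ := by
        rw [Measure.volume_eq_prod]
        have := hU.cont.measurable
        have := jw_meas
        exact lintegral_prod_mul (f := fun y => ENNReal.ofReal (U (x - y) ^ 2)) (g := fun w => ENNReal.ofReal (jw w))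
          (by fun_prop) (by fun_prop)
    _ ≤ _ := by gcongr; exact hU.l2_shift x

lemma Ker.B3 {U : E3 → ℝ} {c : ℝ} (hU : Ker U c) (g : SP) (x y : E3) {κ : ℝ} (h0 : 0 < κ) (h1 : κ ≤ 1) (hxy : ‖x - y‖ ≤ κ ^ 5) :
    ENNReal.ofReal ((cv U g x - cv U g y) ^ 2) ≤
      ENNReal.ofReal κ * (ENNReal.ofReal (4 * c ^ 2) * (JJ + JJ * JJ)) * Qe 2 g := by
  have hc := hU.c1
  unfold cv
  rw [← integral_sub (hU.integ g x) (hU.integ g y)]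
  simp_rw [← sub_mul]
  refine (cs_wt 1 ((hU.meas_shift x).sub (hU.meas_shift y)) g.continuous.measurable).trans ?_
  rw [mul_one]
  gcongr
  have mU := hU.cont.measurable
  have mj := jw_meas
  set K : E3 → ℝ := fun u => U (x - u) - U (y - u) with hK
  have hKm : Measurable K := by rw [hK]; fun_prop
  have K1 : ∀ u, K u ^ 2 ≤ c ^ 2 * κ ^ 10 := by
    intro u
    have := hU.lip (x - u) (y - u)
    rw [sub_sub_sub_cancel_right] at this
    have h2 : |K u| ≤ c * κ ^ 5 := this.trans (by gcongr)
    calc K u ^ 2 = |K u| ^ 2 := (sq_abs _).symm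
      _ ≤ (c * κ ^ 5) ^ 2 := by gcongr
      _ = _ := by ring
  have K2 : ∫⁻ u, ENNReal.ofReal (K u ^ 2) ≤ ENNReal.ofReal (4 * c) := by
    calc ∫⁻ u, ENNReal.ofReal (K u ^ 2) ≤ ∫⁻ u, (2 * ENNReal.ofReal (U (x - u) ^ 2) + 2 * ENNReal.ofReal (U (y - u) ^ 2)) := by
          refine lintegral_mono fun u => ?_
          have h2 : ∀ r : ℝ, (2 : ℝ≥0∞) * ENNReal.ofReal r = ENNReal.ofReal 2 * ENNReal.ofReal r := by intro r; simp
          rw [h2, h2, ← ENNReal.ofReal_mul (by norm_num), ← ENNReal.ofReal_mul (by norm_num),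
            ← ENNReal.ofReal_add (by positivity) (by positivity)]
          refine ENNReal.ofReal_le_ofReal ?_
          simp only [hK]
          nlinarith [sq_nonneg (U (x - u) + U (y - u))]
      _ = 2 * (∫⁻ u, ENNReal.ofReal (U (x - u) ^ 2)) + 2 * ∫⁻ u, ENNReal.ofReal (U (y - u) ^ 2) := by
          rw [lintegral_add_left (by fun_prop), lintegral_const_mul _ (by fun_prop), lintegral_const_mul _ (by fun_prop)]
      _ ≤ 2 * ENNReal.ofReal c + 2 * ENNReal.ofReal c := by
          gcongr
          · exact hU.l2_shift x
          · exact hU.l2_shift y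
      _ = ENNReal.ofReal (4 * c) := by
          rw [ENNReal.ofReal_mul (by norm_num)]
          rw [← two_mul, ← mul_assoc]; norm_num
  calc ∫⁻ z : P6, ENNReal.ofReal (K z.1 ^ 2 * (wt z ^ 2)⁻¹)
      ≤ ∫⁻ z : P6, (ENNReal.ofReal κ * (ENNReal.ofReal (K z.1 ^ 2) * ENNReal.ofReal (jw z.2))
          + ENNReal.ofReal (c ^ 2 * κ ^ 2) * (ENNReal.ofReal (jw z.1) * ENNReal.ofReal (jw z.2))) := by
        refine lintegral_mono fun z => ?_
        have j1 := (jw_pos z.1).le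
        have j2 := (jw_pos z.2).le
        rw [← ENNReal.ofReal_mul (sq_nonneg _), ← ENNReal.ofReal_mul h0.le, ← ENNReal.ofReal_mul j1,
          ← ENNReal.ofReal_mul (by positivity), ← ENNReal.ofReal_add (by positivity) (by positivity)]
        refine ENNReal.ofReal_le_ofReal ?_
        have a1 := mul_le_mul_of_nonneg_left (wt_interp z h0) (sq_nonneg (K z.1))
        have a2 : K z.1 ^ 2 * ((κ ^ 8)⁻¹ * (wt z ^ 4)⁻¹) ≤ (c ^ 2 * κ ^ 10) * ((κ ^ 8)⁻¹ * (jw z.1 * jw z.2)) := by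
          have := wt4_le z
          have := wt_pos z
          have := K1 z.1
          gcongr
        have a3 : (c ^ 2 * κ ^ 10) * ((κ ^ 8)⁻¹ * (jw z.1 * jw z.2)) = c ^ 2 * κ ^ 2 * (jw z.1 * jw z.2) := by
          field_simp
        linarith
    _ = ENNReal.ofReal κ * ((∫⁻ u, ENNReal.ofReal (K u ^ 2)) * JJ) + ENNReal.ofReal (c ^ 2 * κ ^ 2) * (JJ * JJ) := by
        rw [lintegral_add_left (by fun_prop), lintegral_const_mul _ (by fun_prop), lintegral_const_mul _ (by fun_prop)]
        rw [Measure.volume_eq_prod]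
        have p1 := lintegral_prod_mul (μ := (volume : Measure E3)) (ν := (volume : Measure E3)) (f := fun y => ENNReal.ofReal (K y ^ 2)) (g := fun w => ENNReal.ofReal (jw w))
          (by fun_prop) (by fun_prop)
        have p2 := lintegral_prod_mul (μ := (volume : Measure E3)) (ν := (volume : Measure E3)) (f := fun w => ENNReal.ofReal (jw w)) (g := fun w => ENNReal.ofReal (jw w))
          (by fun_prop) (by fun_prop)
        rw [p1, p2]; rfl
    _ ≤ ENNReal.ofReal κ * (ENNReal.ofReal (4 * c ^ 2) * JJ) + ENNReal.ofReal (κ * (4 * c ^ 2)) * (JJ * JJ) := by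
        refine add_le_add (mul_le_mul' le_rfl (mul_le_mul' ?_ le_rfl)) (mul_le_mul' (ENNReal.ofReal_le_ofReal ?_) le_rfl)
        · refine K2.trans (ENNReal.ofReal_le_ofReal ?_); nlinarith
        · have : κ ^ 2 ≤ κ := by nlinarith
          have := mul_le_mul_of_nonneg_left this (sq_nonneg c)
          nlinarith [mul_nonneg h0.le (sq_nonneg c)]
    _ = _ := by rw [ENNReal.ofReal_mul h0.le]; ring

lemma Ker.dff_FF {U : E3 → ℝ} {c : ℝ} (hU : Ker U c) (h : ℝ) (i : Fin 6) (g : SP) :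
    dff h i (FF U g) = FF U (dfS h i g) ∨ dff h i (FF U g) = fun _ => 0 := by
  rcases dir6_norms i with ⟨_, h2⟩ | ⟨h1, _⟩
  · left
    funext z
    unfold dff FF
    have e : cv U g (z + h • dir6 i).1 = cv U (shS h i g) z.1 := by
      unfold cv
      rw [← integral_add_right_eq_self (fun y : P6 => U ((z + h • dir6 i).1 - y.1) * g y) (h • dir6 i)]
      refine integral_congr_ae (Filter.Eventually.of_forall fun y => ?_)
      simp [shS_apply]
    rw [e]
    unfold cv
    rw [← integral_sub (hU.integ _ _) (hU.integ _ _), div_eq_inv_mul, ← integral_const_mul]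
    refine integral_congr_ae (Filter.Eventually.of_forall fun y => ?_)
    simp [dfS]; ring
  · right
    funext z
    have : (dir6 i).1 = 0 := norm_eq_zero.1 h1
    unfold dff FF
    simp [this]

lemma dlf_zero (h : ℝ) (L : List (Fin 6)) : dlf h L (fun _ => 0) = fun _ => 0 := by
  simpa using dlf_smul h L 0 (fun _ => 0)

lemma Ker.dlf_FF {U : E3 → ℝ} {c : ℝ} (hU : Ker U c) (h : ℝ) (S : List (Fin 6)) : ∀ (g : SP),
    dlf h S (FF U g) = FF U (dlS h S g) ∨ dlf h S (FF U g) = fun _ => 0 := by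
  induction S with
  | nil => intro g; left; rfl
  | cons i S ih =>
    intro g
    simp only [dlf, dlS]
    rcases hU.dff_FF h i g with h1 | h1
    · rw [h1]; exact ih _
    · right; rw [h1, dlf_zero]

lemma Ker.D1 {U : E3 → ℝ} {c : ℝ} (hU : Ker U c) {h : ℝ} (h0 : 0 < h) (d : Fin 6) (S : List (Fin 6)) (g : SP) (z : P6) :
    |dlf h (d :: S) (FF U g) z| ≤ c * L1 (dlS h S g) := by
  have hc := hU.c1
  have hL0 : 0 ≤ L1 (dlS h S g) := integral_nonneg fun z => abs_nonneg _
  have hB : 0 ≤ c * L1 (dlS h S g) := mul_nonneg (by linarith) hL0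
  simp only [dlf]
  rw [dlf_dff]
  rcases hU.dlf_FF h S g with e | e
  · rw [e]
    unfold dff FF
    rw [abs_div, abs_of_pos h0, div_le_iff₀ h0]
    refine (hU.cv_shift _ _ _).trans ?_
    have : ‖(z + h • dir6 d).1 - z.1‖ ≤ h := by
      simp only [Prod.fst_add, Prod.smul_fst, add_sub_cancel_left, norm_smul, Real.norm_of_nonneg h0.le]
      rcases dir6_norms d with ⟨a, _⟩ | ⟨a, _⟩ <;> rw [a] <;> simp [h0.le]
    calc c * ‖(z + h • dir6 d).1 - z.1‖ * L1 (dlS h S g) ≤ c * h * L1 (dlS h S g) := by gcongr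
      _ = _ := by ring
  · rw [e]; simpa [dff] using hB

lemma Ker.D2 {U : E3 → ℝ} {c : ℝ} (hU : Ker U c) (h : ℝ) (S : List (Fin 6)) (g : SP) (z : P6) :
    ENNReal.ofReal (dlf h S (FF U g) z ^ 2) ≤ ENNReal.ofReal c * JJ * Qe 2 (dlf h S g) := by
  rcases hU.dlf_FF h S g with e | e
  · rw [e, ← dlS_apply]; exact hU.B2 _ _
  · rw [e]; simp

lemma ofReal_sq_add_le (x y : ℝ) :
    ENNReal.ofReal ((x + y) ^ 2) ≤ 2 * ENNReal.ofReal (x ^ 2) + 2 * ENNReal.ofReal (y ^ 2) := by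
  have h2 : ∀ r : ℝ, (2 : ℝ≥0∞) * ENNReal.ofReal r = ENNReal.ofReal 2 * ENNReal.ofReal r := by intro r; simp
  rw [h2, h2, ← ENNReal.ofReal_mul (by norm_num), ← ENNReal.ofReal_mul (by norm_num),
    ← ENNReal.ofReal_add (by positivity) (by positivity)]
  refine ENNReal.ofReal_le_ofReal ?_
  nlinarith [sq_nonneg (x - y)]

/-- telescoping -/
lemma telesc (ψ : ℕ → ℝ) (h : ℝ) (N : ℕ) :
    ∑ n ∈ Finset.range N, (ψ (n + 1) - ψ n) / h = (ψ N - ψ 0) / h := by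
  rw [← Finset.sum_div, Finset.sum_range_sub]

/-- averaged bound: `G` a quotient sequence of `ψ`. -/
lemma avg_bound {ψ G : ℕ → ℝ} {h : ℝ} {N : ℕ} (hN : 1 ≤ N) (h0 : 0 < h)
    (hG : ∀ n, G n = (ψ (n + 1) - ψ n) / h) :
    ∃ n < N, |G 0| ≤ |G 0 - G n| + |ψ N - ψ 0| / (N * h) := by
  have hNe : (Finset.range N).Nonempty := ⟨0, by simp; omega⟩
  obtain ⟨m, hm, hmax⟩ := Finset.exists_max_image (Finset.range N) (fun n => |G 0 - G n|) hNe
  refine ⟨m, by simpa using hm, ?_⟩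
  have hN0 : (0:ℝ) < N := by exact_mod_cast hN
  have h1 : (N : ℝ) * G 0 = ∑ n ∈ Finset.range N, (G 0 - G n) + (ψ N - ψ 0) / h := by
    rw [← telesc ψ h N, ← Finset.sum_add_distrib]
    have : ∀ n ∈ Finset.range N, (G 0 - G n) + (ψ (n + 1) - ψ n) / h = G 0 := by
      intro n _; rw [hG n]; ring
    rw [Finset.sum_congr rfl this]; simp
  have h2 : |∑ n ∈ Finset.range N, (G 0 - G n)| ≤ N * |G 0 - G m| := by
    refine (Finset.abs_sum_le_sum_abs _ _).trans ?_
    refine (Finset.sum_le_card_nsmul _ _ _ hmax).trans ?_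
    simp
  have h3 : (N : ℝ) * |G 0| ≤ N * |G 0 - G m| + |ψ N - ψ 0| / h := by
    calc (N : ℝ) * |G 0| = |(N : ℝ) * G 0| := by rw [abs_mul, abs_of_pos hN0]
      _ ≤ |∑ n ∈ Finset.range N, (G 0 - G n)| + |(ψ N - ψ 0) / h| := by rw [h1]; exact abs_add_le _ _
      _ ≤ _ := by rw [abs_div, abs_of_pos h0]; gcongr
  have h4 : |ψ N - ψ 0| / (N * h) = (|ψ N - ψ 0| / h) / N := by field_simp
  rw [h4, ← sub_le_iff_le_add', le_div_iff₀ hN0]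
  nlinarith

lemma ofReal_sq_le_of_abs_le {x y : ℝ} (h : |x| ≤ |y|) : ENNReal.ofReal (x ^ 2) ≤ ENNReal.ofReal (y ^ 2) :=
  ENNReal.ofReal_le_ofReal (sq_le_sq.2 h)

lemma Ker.D4 {U : E3 → ℝ} {c : ℝ} (hU : Ker U c) {h : ℝ} (h0 : 0 < h) (d : Fin 6) (S : List (Fin 6))
    (g : SP) (z : P6) {κ : ℝ} (k0 : 0 < κ) (k1 : κ ≤ 1) :
    ENNReal.ofReal (dlf h (d :: S) (FF U g) z ^ 2) ≤
      2 * (ENNReal.ofReal κ * (ENNReal.ofReal (4 * c ^ 2) * (JJ + JJ * JJ)) * Qe 2 (dlf h (d :: S) g))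
      + 32 * (ENNReal.ofReal ((κ ^ 10)⁻¹ ) * (ENNReal.ofReal c * JJ * Qe 2 (dlf h S g))) := by
  have hd2 : ∀ x y, ENNReal.ofReal ((cv U (dlS h S g) x - cv U (dlS h S g) y) ^ 2)
      ≤ 4 * (ENNReal.ofReal c * JJ * Qe 2 (dlf h S g)) := by
    intro x y
    rw [sub_eq_add_neg]
    refine (ofReal_sq_add_le _ _).trans ?_
    rw [neg_sq]
    refine (add_le_add (mul_le_mul' le_rfl (hU.B2 _ _)) (mul_le_mul' le_rfl (hU.B2 _ _))).trans (le_of_eq ?_)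
    rw [dlS_apply]; ring
  by_cases hz : dlf h (d :: S) (FF U g) = fun _ => 0
  · rw [hz]; simp
  have e1 : dlf h (d :: S) (FF U g) = FF U (dlS h (d :: S) g) := by
    rcases hU.dlf_FF h (d :: S) g with e | e
    · exact e
    · exact absurd e hz
  have e2 : dlf h (d :: S) (FF U g) = dff h d (FF U (dlS h S g)) := by
    simp only [dlf]
    rw [dlf_dff]
    rcases hU.dlf_FF h S g with e | e
    · rw [e]
    · exfalso; apply hz
      simp only [dlf]; rw [dlf_dff, e]; funext z; simp [dff]
  have hnd : ‖(dir6 d).1‖ ≤ 1 := by rcases dir6_norms d with ⟨a, _⟩ | ⟨a, _⟩ <;> rw [a]; norm_num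
  set ψ : ℕ → ℝ := fun n => cv U (dlS h S g) (z.1 + (n * h) • (dir6 d).1) with hψ
  set G : ℕ → ℝ := fun n => dlf h (d :: S) (FF U g) (z + (n * h) • dir6 d) with hGd
  have hG : ∀ n, G n = (ψ (n + 1) - ψ n) / h := by
    intro n
    simp only [hGd, hψ]
    rw [e2]
    simp only [dff, FF]
    congr 3
    · simp only [Prod.fst_add, Prod.smul_fst]; push_cast; rw [add_mul, add_smul, one_mul, add_assoc]
  have hG0 : dlf h (d :: S) (FF U g) z = G 0 := by simp [hGd]
  -- final step given N
  have fin : ∀ N : ℕ, 1 ≤ N → κ ^ 5 / 2 ≤ N * h → (∀ n < N, (n : ℝ) * h ≤ κ ^ 5) →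
      ENNReal.ofReal (dlf h (d :: S) (FF U g) z ^ 2) ≤
      2 * (ENNReal.ofReal κ * (ENNReal.ofReal (4 * c ^ 2) * (JJ + JJ * JJ)) * Qe 2 (dlf h (d :: S) g))
      + 16 * (ENNReal.ofReal ((κ ^ 10)⁻¹ ) * (ENNReal.ofReal c * JJ * Qe 2 (dlf h S g)) * 2) := by
    intro N hN hN1 hN2
    obtain ⟨n, hn, hle⟩ := avg_bound hN h0 hG
    have hNh : 0 < N * h := by have : (0:ℝ) < N := by exact_mod_cast hN
                               positivity
    have hle2 : |G 0| ≤ |(|G 0 - G n| + |ψ N - ψ 0| / (N * h))| := hle.trans (le_abs_self _)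
    rw [hG0]
    refine (ofReal_sq_le_of_abs_le hle2).trans ((ofReal_sq_add_le _ _).trans ?_)
    refine add_le_add (mul_le_mul' le_rfl ?_) ?_
    · rw [sq_abs, ← dlS_apply]
      simp only [hGd]
      rw [e1]
      refine hU.B3 _ _ _ k0 k1 ?_
      simp only [Nat.cast_zero, zero_mul, zero_smul, add_zero, Prod.fst_add, Prod.smul_fst, sub_add_cancel_left, norm_neg, norm_smul]
      have h3 := hN2 n hn
      have h4 : 0 ≤ (n : ℝ) * h := by positivity
      rw [Real.norm_of_nonneg h4]
      nlinarith
    · rw [div_pow, sq_abs]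
      have h5 : (ψ N - ψ 0) ^ 2 / (N * h) ^ 2 ≤ (4 * (κ ^ 10)⁻¹) * (ψ N - ψ 0) ^ 2 := by
        rw [div_eq_mul_inv, mul_comm]
        gcongr
        have : (κ ^ 5 / 2) ^ 2 ≤ (N * h) ^ 2 := by gcongr
        calc ((N * h) ^ 2)⁻¹ ≤ ((κ ^ 5 / 2) ^ 2)⁻¹ := by gcongr
          _ = _ := by field_simp; norm_num
      have h6 := hd2 (z.1 + ((N : ℝ) * h) • (dir6 d).1) (z.1 + (((0 : ℕ) : ℝ) * h) • (dir6 d).1)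
      calc 2 * ENNReal.ofReal ((ψ N - ψ 0) ^ 2 / (N * h) ^ 2)
          ≤ 2 * (ENNReal.ofReal (4 * (κ ^ 10)⁻¹) * ENNReal.ofReal ((ψ N - ψ 0) ^ 2)) := by
            rw [← ENNReal.ofReal_mul (by positivity)]
            gcongr
        _ ≤ 2 * (ENNReal.ofReal (4 * (κ ^ 10)⁻¹) * (4 * (ENNReal.ofReal c * JJ * Qe 2 (dlf h S g)))) := by
            gcongr
        _ = _ := by
            rw [ENNReal.ofReal_mul (by norm_num)]
            have : ENNReal.ofReal 4 = 4 := by simp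
            rw [this]; ring
  have hq : 0 < κ ^ 5 / h := by positivity
  have key := fin ⌈κ ^ 5 / h⌉₊ (Nat.ceil_pos.mpr hq) ?_ ?_
  · refine key.trans (le_of_eq ?_)
    ring
  · have := Nat.le_ceil (κ ^ 5 / h)
    rw [div_le_iff₀ h0] at this
    have h5 : 0 < κ ^ 5 := by positivity
    linarith
  · intro n hn
    have := Nat.lt_ceil.mp hn
    rw [lt_div_iff₀ h0] at this
    exact this.le

/-! ### Force identity -/

lemma force_A {V V0 : E3 → ℝ} {c : ℝ} (hae : V =ᵐ[volume] V0) (hd : Differentiable ℝ V0)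
    (hb : ∀ x, |V0 x| ≤ c) (g : SP) (x : E3) :
    (∫ y : E3, V (x - y) * ∫ w : E3, g (y, w)) = ∫ z : P6, V0 (x - z.1) * g z := by
  have h1 : (fun y => V (x - y)) =ᵐ[volume] fun y => V0 (x - y) :=
    (Measure.measurePreserving_sub_left (volume : Measure E3) x).quasiMeasurePreserving.ae_eq_comp hae
  have hVint : Integrable (fun z : P6 => V0 (x - z.1) * g z) := by
    refine g.integrable.bdd_mul (c := c) ?_ (Filter.Eventually.of_forall fun z => hb _)
    exact (hd.continuous.comp (by fun_prop)).aestronglyMeasurable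
  rw [Measure.volume_eq_prod] at hVint ⊢
  rw [integral_prod _ hVint]
  refine integral_congr_ae ?_
  filter_upwards [h1] with y hy
  rw [hy, integral_const_mul]

lemma force_id {V V0 : E3 → ℝ} {c : ℝ} (hae : V =ᵐ[volume] V0) (hd : Differentiable ℝ V0)
    (hb : ∀ x, |V0 x| ≤ c) (hf : ∀ x, ‖fderiv ℝ V0 x‖ ≤ c)
    (hlip : ∀ x y, ‖fderiv ℝ V0 x - fderiv ℝ V0 y‖ ≤ c * ‖x - y‖) (g : SP) (x e : E3) :
    fderiv ℝ (fun x' => ∫ y : E3, V (x' - y) * ∫ w : E3, g (y, w)) x e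
      = cv (fun x => fderiv ℝ V0 x e) g x := by
  have hc0 : 0 ≤ c := (norm_nonneg _).trans (hf 0)
  have hfc : Continuous (fderiv ℝ V0) := by
    have : LipschitzWith (Real.toNNReal c) (fderiv ℝ V0) := by
      refine LipschitzWith.of_dist_le_mul fun x y => ?_
      rw [Real.coe_toNNReal _ hc0, dist_eq_norm, dist_eq_norm]
      exact hlip x y
    exact this.continuous
  have e1 : (fun x' => ∫ y : E3, V (x' - y) * ∫ w : E3, g (y, w)) = fun x' => ∫ z : P6, V0 (x' - z.1) * g z :=
    funext fun x' => force_A hae hd hb g x'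
  rw [e1]
  have hm : ∀ x : E3, AEStronglyMeasurable (fun z : P6 => V0 (x - z.1) * g z) volume := fun x =>
    ((hd.continuous.comp (by fun_prop)).mul g.continuous).aestronglyMeasurable
  have hVint : ∀ x : E3, Integrable (fun z : P6 => V0 (x - z.1) * g z) := fun x => by
    refine g.integrable.bdd_mul (c := c) ?_ (Filter.Eventually.of_forall fun z => hb _)
    exact (hd.continuous.comp (by fun_prop)).aestronglyMeasurable
  have hcF : Continuous fun z : P6 => g z • fderiv ℝ V0 (x - z.1) :=
    g.continuous.smul (hfc.comp (by fun_prop))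
  have key := hasFDerivAt_integral_of_dominated_of_fderiv_le (μ := (volume : Measure P6)) (𝕜 := ℝ)
    (F := fun x z => V0 (x - z.1) * g z) (F' := fun x z => g z • fderiv ℝ V0 (x - z.1)) (x₀ := x)
    (bound := fun z => c * |g z|) (s := Set.univ) Filter.univ_mem
    (Filter.Eventually.of_forall hm) (hVint x) hcF.aestronglyMeasurable
    (Filter.Eventually.of_forall fun z y _ => by
      rw [norm_smul, mul_comm, Real.norm_eq_abs]
      exact mul_le_mul_of_nonneg_right (hf _) (abs_nonneg _))
    (g.integrable.abs.const_mul c)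
    (Filter.Eventually.of_forall fun z y _ => by
      have h1 : HasFDerivAt (fun x : E3 => V0 (x - z.1)) (fderiv ℝ V0 (y - z.1)) y := by
        exact (hd (y - z.1)).hasFDerivAt.comp y ((hasFDerivAt_id y).sub_const z.1)
      exact h1.mul_const (g z))
  rw [key.fderiv, ContinuousLinearMap.integral_apply]
  · unfold cv
    refine integral_congr_ae (Filter.Eventually.of_forall fun z => ?_)
    simp [mul_comm]
  · refine Integrable.mono' (g.integrable.abs.const_mul c) hcF.aestronglyMeasurable
      (Filter.Eventually.of_forall fun z => ?_)
    rw [norm_smul, mul_comm, Real.norm_eq_abs]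
    exact mul_le_mul_of_nonneg_right (hf _) (abs_nonneg _)

/-- All the kernels. -/
lemma kernel_ex (V : E3 → ℝ) (hV1 : Integrable V)
    (hV2 : Integrable fun p : E3 => ‖𝓕 (fun x => (V x : ℂ)) p‖ * (1 + ‖p‖ ^ 2)) :
    ∃ (U : Fin 3 → E3 → ℝ) (c : ℝ), (∀ i, Ker (U i) c) ∧ ∀ (g : SP) (x : E3) (i : Fin 3),
      fderiv ℝ (fun x' => ∫ y : E3, V (x' - y) * ∫ w : E3, g (y, w)) x (EuclideanSpace.single i 1)
      = cv (U i) g x := by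
  obtain ⟨V0, c, hc, hae, hd, hb, hf, hlip⟩ := V_smooth V hV1 hV2
  refine ⟨fun i x => fderiv ℝ V0 x (EuclideanSpace.single i 1), max 1 (max c (2 * c * ∫ x, |V0 x|)), ?_, ?_⟩
  · intro i
    set e : E3 := EuclideanSpace.single i 1 with he
    have hen : ‖e‖ = 1 := by simp [he]
    have hl1 : ∀ x y, |fderiv ℝ V0 x e - fderiv ℝ V0 y e| ≤ c * ‖x - y‖ := fun x y => by
      have := (fderiv ℝ V0 x - fderiv ℝ V0 y).le_opNorm e
      rw [hen, mul_one] at this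
      exact this.trans (hlip x y)
    have hcm : c ≤ max 1 (max c (2 * c * ∫ x, |V0 x|)) := (le_max_left _ _).trans (le_max_right _ _)
    refine ⟨le_max_left _ _, ?_, ?_, ?_, ?_⟩
    · have : LipschitzWith (Real.toNNReal c) (fun x => fderiv ℝ V0 x e) := by
        refine LipschitzWith.of_dist_le_mul fun x y => ?_
        rw [Real.coe_toNNReal _ hc.le, Real.dist_eq, dist_eq_norm]
        exact hl1 x y
      exact this.continuous
    · intro x
      have := (fderiv ℝ V0 x).le_opNorm e
      rw [hen, mul_one] at this
      exact (this.trans (hf x)).trans hcm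
    · intro x y
      exact (hl1 x y).trans (mul_le_mul_of_nonneg_right hcm (norm_nonneg _))
    · refine (V_L2 hc (hV1.congr hae) hd hb hlip e hen).trans (ENNReal.ofReal_le_ofReal ?_)
      exact (le_max_right _ _).trans (le_max_right _ _)
  · intro g x i
    exact force_id hae hd hb hf hlip g x _

/-- the `L¹` norm -/
def L1e (g : P6 → ℝ) : ℝ≥0∞ := ENNReal.ofReal (L1 g ^ 2)

lemma L1_le (g : SP) : ENNReal.ofReal (L1 g ^ 2) ≤ JJ * JJ * Qe 4 g := by
  have h := cs_wt 2 (K := fun z => SignType.sign (g z)) (g := g)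
    (by
      have h1 : Measurable fun z => g z := g.continuous.measurable
      have : (fun z => ((SignType.sign (g z) : SignType) : ℝ)) = fun z => if 0 < g z then 1 else if g z < 0 then -1 else 0 := by
        funext z
        rw [sign_apply]; split_ifs <;> simp
      rw [this]
      exact Measurable.ite (measurableSet_lt measurable_const h1) measurable_const
        (Measurable.ite (measurableSet_lt h1 measurable_const) measurable_const measurable_const)) g.continuous.measurable
  simp only [sign_mul_self] at h
  refine h.trans ?_
  gcongr
  calc ∫⁻ z : P6, ENNReal.ofReal (((SignType.sign (g z) : SignType) : ℝ) ^ 2 * (wt z ^ (2 * 2))⁻¹)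
      ≤ ∫⁻ z : P6, ENNReal.ofReal (jw z.1) * ENNReal.ofReal (jw z.2) := by
        refine lintegral_mono fun z => ?_
        rw [← ENNReal.ofReal_mul (jw_pos _).le]
        apply ENNReal.ofReal_le_ofReal
        refine le_trans ?_ (wt4_le z)
        have : ((SignType.sign (g z) : SignType) : ℝ) ^ 2 ≤ 1 := by
          rcases SignType.sign (g z) with _ | _ | _ <;> simp
        have h0 := wt_pos z
        have h2 : 0 ≤ (wt z ^ (2 * 2))⁻¹ := by positivity
        nlinarith
    _ = JJ * JJ := by
        rw [Measure.volume_eq_prod]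
        rw [lintegral_prod_mul (f := fun x => ENNReal.ofReal (jw x)) (g := fun x => ENNReal.ofReal (jw x))
          (ENNReal.measurable_ofReal.comp jw_meas).aemeasurable (ENNReal.measurable_ofReal.comp jw_meas).aemeasurable]
        rfl

/-! ### The relativistic velocity -/

def nuC (z : P6) : ℝ := (Real.sqrt (1 + ‖z.2‖ ^ 2))⁻¹
def nuA (i : Fin 3) (z : P6) : ℝ := relVel z.2 i

lemma nuA_eq (i : Fin 3) (z : P6) : nuA i z = nuC z * z.2 i := by
  simp [nuA, relVel, nuC]

lemma nuA_bdd (i : Fin 3) (z : P6) : |nuA i z| ≤ 1 := by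
  rw [nuA_eq, nuC]
  have h1 : |z.2 i| ≤ ‖z.2‖ := by simpa using PiLp.norm_apply_le z.2 i
  have h2 : ‖z.2‖ ≤ Real.sqrt (1 + ‖z.2‖ ^ 2) := by
    apply Real.le_sqrt_of_sq_le; linarith
  have h3 : 0 < Real.sqrt (1 + ‖z.2‖ ^ 2) := Real.sqrt_pos.mpr (by positivity)
  rw [abs_mul, abs_of_pos (inv_pos.mpr h3), inv_mul_le_iff₀ h3]
  linarith

lemma nuC_bdd (z : P6) : |nuC z| ≤ 1 := by
  have h3 : 1 ≤ Real.sqrt (1 + ‖z.2‖ ^ 2) := by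
    apply Real.le_sqrt_of_sq_le; nlinarith [sq_nonneg ‖z.2‖]
  unfold nuC
  rw [abs_of_pos (by positivity)]
  exact inv_le_one_of_one_le₀ h3

inductive Alg : (P6 → ℝ) → Prop
  | const (r : ℝ) : Alg fun _ => r
  | a (i : Fin 3) : Alg (nuA i)
  | c : Alg nuC
  | add {f g : P6 → ℝ} : Alg f → Alg g → Alg fun z => f z + g z
  | mul {f g : P6 → ℝ} : Alg f → Alg g → Alg fun z => f z * g z

lemma Alg.bdd {f : P6 → ℝ} (hf : Alg f) : ∃ C, ∀ z, |f z| ≤ C := by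
  induction hf with
  | const r => exact ⟨|r|, fun _ => le_rfl⟩
  | a i => exact ⟨1, nuA_bdd i⟩
  | c => exact ⟨1, nuC_bdd⟩
  | add _ _ h1 h2 =>
    obtain ⟨A, hA⟩ := h1; obtain ⟨B, hB⟩ := h2
    exact ⟨A + B, fun z => (abs_add_le _ _).trans (add_le_add (hA z) (hB z))⟩
  | mul _ _ h1 h2 =>
    obtain ⟨A, hA⟩ := h1; obtain ⟨B, hB⟩ := h2
    exact ⟨A * B, fun z => by rw [abs_mul]; exact mul_le_mul (hA z) (hB z) (abs_nonneg _) ((abs_nonneg _).trans (hA z))⟩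

/-- line derivative relation -/
def LD (i : Fin 6) (f g : P6 → ℝ) : Prop :=
  ∀ (z : P6) (s : ℝ), HasDerivAt (fun s : ℝ => f (z + s • dir6 i)) (g (z + s • dir6 i)) s

def nuQ (i : Fin 6) (z : P6) : ℝ := (dir6 i).2 0 * nuA 0 z + (dir6 i).2 1 * nuA 1 z + (dir6 i).2 2 * nuA 2 z

lemma nuC_LD (i : Fin 6) : LD i nuC (fun z => -1 * (nuQ i z * (nuC z * nuC z))) := by
  intro z s
  set q := (dir6 i).2 with hq
  have h1 : HasDerivAt (fun s : ℝ => z.2 + s • q) q s := by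
    simpa using ((hasDerivAt_id s).smul_const q).const_add z.2
  have h2 : HasDerivAt (fun s : ℝ => 1 + ‖z.2 + s • q‖ ^ 2) (2 * inner ℝ (z.2 + s • q) q) s := by
    exact (h1.norm_sq).const_add 1
  have hp : 0 < 1 + ‖z.2 + s • q‖ ^ 2 := by positivity
  have h3 := (h2.sqrt hp.ne').inv (Real.sqrt_pos.mpr hp).ne'
  have e : (fun s : ℝ => nuC (z + s • dir6 i)) = fun s : ℝ => (Real.sqrt (1 + ‖z.2 + s • q‖ ^ 2))⁻¹ := by
    funext s; simp [nuC, hq]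
  rw [e]
  refine h3.congr_deriv ?_
  have ein : inner ℝ (z.2 + s • q) q = q 0 * (z.2 + s • q) 0 + q 1 * (z.2 + s • q) 1 + q 2 * (z.2 + s • q) 2 := by
    rw [PiLp.inner_apply, Fin.sum_univ_three]; simp
  have hs := (Real.sqrt_pos.mpr hp).ne'
  simp only [nuQ, nuA_eq, nuC, ← hq, Prod.snd_add, Prod.smul_snd]
  rw [ein]
  field_simp

lemma nuA_LD (i : Fin 6) (k : Fin 3) :
    LD i (nuA k) (fun z => -1 * (nuQ i z * (nuC z * nuA k z)) + (dir6 i).2 k * nuC z) := by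
  intro z s
  have h1 := nuC_LD i z s
  have h2 : HasDerivAt (fun s : ℝ => (z + s • dir6 i).2 k) ((dir6 i).2 k) s := by
    have e : (fun s : ℝ => (z + s • dir6 i).2 k) = fun s : ℝ => z.2 k + s * (dir6 i).2 k := by
      funext s; simp
    rw [e]
    simpa using ((hasDerivAt_id s).mul_const ((dir6 i).2 k)).const_add (z.2 k)
  have e : (fun s : ℝ => nuA k (z + s • dir6 i)) = fun s : ℝ => nuC (z + s • dir6 i) * (z + s • dir6 i).2 k := by
    funext s; exact nuA_eq _ _
  rw [e]
  refine (h1.mul h2).congr_deriv ?_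
  simp only [nuA_eq]; ring

lemma nuQ_alg (i : Fin 6) : Alg (nuQ i) := by
  unfold nuQ
  exact ((Alg.const _).mul (.a 0)).add ((Alg.const _).mul (.a 1)) |>.add ((Alg.const _).mul (.a 2))

lemma Alg.ld {f : P6 → ℝ} (hf : Alg f) (i : Fin 6) : ∃ g, Alg g ∧ LD i f g := by
  induction hf with
  | const r => exact ⟨_, .const 0, fun z s => hasDerivAt_const _ _⟩
  | a k => exact ⟨_, ((Alg.const _).mul ((nuQ_alg i).mul (Alg.c.mul (.a k)))).add ((Alg.const _).mul .c), nuA_LD i k⟩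
  | c => exact ⟨_, (Alg.const _).mul ((nuQ_alg i).mul (Alg.c.mul .c)), nuC_LD i⟩
  | add hf hg h1 h2 =>
    obtain ⟨f', A, A'⟩ := h1; obtain ⟨g', B, B'⟩ := h2
    exact ⟨_, A.add B, fun z s => (A' z s).add (B' z s)⟩
  | mul hf hg h1 h2 =>
    obtain ⟨f', A, A'⟩ := h1; obtain ⟨g', B, B'⟩ := h2
    exact ⟨_, (A.mul hg).add (hf.mul B), fun z s => (A' z s).mul (B' z s)⟩

lemma LD.dff {i : Fin 6} {f g : P6 → ℝ} (hfg : LD i f g) (h : ℝ) (j : Fin 6) : LD i (dff h j f) (dff h j g) := by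
  intro z s
  have h1 := hfg (z + h • dir6 j) s
  have := (h1.sub (hfg z s)).div_const h
  unfold _root_.dff
  simp only [add_right_comm z _ (h • dir6 j)]
  exact this

lemma LD.dlf {i : Fin 6} (h : ℝ) (L : List (Fin 6)) : ∀ {f g : P6 → ℝ}, LD i f g → LD i (dlf h L f) (dlf h L g) := by
  induction L with
  | nil => intro f g h; exact h
  | cons j L ih => intro f g hfg; exact ih (hfg.dff h j)

lemma LD.bound {i : Fin 6} {f g : P6 → ℝ} (hfg : LD i f g) {h C : ℝ} (h0 : 0 < h) (hC : ∀ z, |g z| ≤ C) (z : P6) :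
    |_root_.dff h i f z| ≤ C := by
  have := Convex.norm_image_sub_le_of_norm_hasDerivWithin_le (f := fun s : ℝ => f (z + s • dir6 i))
    (f' := fun s => g (z + s • dir6 i)) (s := Set.univ) (x := 0) (y := h) (C := C)
    (fun s _ => (hfg z s).hasDerivWithinAt) (fun s _ => hC _) convex_univ trivial trivial
  simp only [zero_smul, add_zero, sub_zero, Real.norm_eq_abs] at this
  unfold _root_.dff
  rw [abs_div, div_le_iff₀ (abs_pos.mpr h0.ne')]
  exact this

lemma Alg.dlf_bdd (L : List (Fin 6)) : ∀ {f : P6 → ℝ}, Alg f → ∃ C, ∀ h : ℝ, 0 < h → ∀ z, |dlf h L f z| ≤ C := by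
  induction L with
  | nil => intro f hf; obtain ⟨C, hC⟩ := hf.bdd; exact ⟨C, fun _ _ => hC⟩
  | cons i L ih =>
    intro f hf
    obtain ⟨g, hg, hfg⟩ := hf.ld i
    obtain ⟨C, hC⟩ := ih hg
    refine ⟨C, fun h h0 z => ?_⟩
    simp only [dlf]
    rw [dlf_dff]
    exact (hfg.dlf h L).bound h0 (hC h h0) z

lemma nu_bdd (m : ℕ) : ∃ C : ℝ, 1 ≤ C ∧ ∀ (i : Fin 3) (S : List (Fin 6)), S.length ≤ m → ∀ h : ℝ, 0 < h → ∀ z,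
    |dlf h S (nuA i) z| ≤ C := by
  have h : ∀ (i : Fin 3) (S : List (Fin 6)), ∃ C, ∀ h : ℝ, 0 < h → ∀ z, |dlf h S (nuA i) z| ≤ C :=
    fun i S => (Alg.a i).dlf_bdd S
  choose C hC using h
  have hfin := List.finite_length_le (Fin 6) m
  refine ⟨1 + ∑ i : Fin 3, ∑ S ∈ hfin.toFinset, |C i S|, ?_, ?_⟩
  · have : 0 ≤ ∑ i : Fin 3, ∑ S ∈ hfin.toFinset, |C i S| := by positivity
    linarith
  · intro i S hS h h0 z
    refine (hC i S h h0 z).trans ?_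
    have h1 : |C i S| ≤ ∑ S ∈ hfin.toFinset, |C i S| :=
      Finset.single_le_sum (f := fun S => |C i S|) (fun _ _ => abs_nonneg _) (by simpa using hS)
    have h2 : ∑ S ∈ hfin.toFinset, |C i S| ≤ ∑ i : Fin 3, ∑ S ∈ hfin.toFinset, |C i S| :=
      Finset.single_le_sum (f := fun i => ∑ S ∈ hfin.toFinset, |C i S|) (fun _ _ => by positivity) (Finset.mem_univ i)
    linarith [le_abs_self (C i S)]

lemma nuA_cont (i : Fin 3) : Continuous (nuA i) := by
  have : nuA i = fun z : P6 => (Real.sqrt (1 + ‖z.2‖ ^ 2))⁻¹ * z.2 i := by funext z; rw [nuA_eq, nuC]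
  rw [this]
  refine Continuous.mul (Continuous.inv₀ (by fun_prop) fun z => ?_) (by fun_prop)
  exact (Real.sqrt_pos.mpr (by positivity)).ne'

/-! ### Energy inequality -/

lemma two_mul_le (a : ℕ) (f g : P6 → ℝ) (z : P6) :
    ENNReal.ofReal |wt z ^ a * (2 * (f z * g z))| ≤ ENNReal.ofReal (wt z ^ a * f z ^ 2) + ENNReal.ofReal (wt z ^ a * g z ^ 2) := by
  have hw := pow_pos (wt_pos z) a
  rw [← ENNReal.ofReal_add (by positivity) (by positivity)]
  apply ENNReal.ofReal_le_ofReal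
  rw [abs_mul, abs_of_pos hw, ← mul_add]
  refine mul_le_mul_of_nonneg_left ?_ hw.le
  rw [abs_le]; constructor <;> nlinarith [sq_nonneg (f z + g z), sq_nonneg (f z - g z)]

lemma lint_two_mul (a : ℕ) {f : P6 → ℝ} (g : P6 → ℝ) (hf : Measurable f) :
    ∫⁻ z, ENNReal.ofReal |wt z ^ a * (2 * (f z * g z))| ≤ Qe a f + Qe a g := by
  unfold Qe
  have hw := wt_cont.measurable
  rw [← lintegral_add_left (by fun_prop)]
  exact lintegral_mono fun z => two_mul_le a f g z

lemma intQ2 (a : ℕ) {f g : P6 → ℝ} (hf : Measurable f) (hg : Measurable g) (h1 : Qe a f < ⊤) (h2 : Qe a g < ⊤) :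
    Integrable fun z => wt z ^ a * (2 * (f z * g z)) := by
  have hw := wt_cont.measurable
  refine ⟨by fun_prop, ?_⟩
  rw [hasFiniteIntegral_iff_norm]
  exact (lint_two_mul a g hf).trans_lt (ENNReal.add_lt_top.mpr ⟨h1, h2⟩)

lemma intQ (a : ℕ) {f g : P6 → ℝ} (hf : Measurable f) (hg : Measurable g) (h1 : Qe a f < ⊤) (h2 : Qe a g < ⊤) :
    Integrable fun z => wt z ^ a * (f z * g z) := by
  refine ((intQ2 a hf hg h1 h2).const_mul (1/2)).congr (Filter.Eventually.of_forall fun z => ?_)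
  simp only; ring

lemma int_two_mul (a : ℕ) {f : P6 → ℝ} (g : P6 → ℝ) (hf : Measurable f) :
    ENNReal.ofReal |∫ z, wt z ^ a * (2 * (f z * g z))| ≤ Qe a f + Qe a g := by
  refine le_trans ?_ (lint_two_mul a g hf)
  have := enorm_integral_le_lintegral_enorm (μ := volume) (fun z : P6 => wt z ^ a * (2 * (f z * g z)))
  simpa only [Real.enorm_eq_ofReal_abs] using this

lemma Qe_eq (a : ℕ) {f : P6 → ℝ} (hf : Measurable f) (h1 : Qe a f < ⊤) :
    Qe a f = ENNReal.ofReal (∫ z, wt z ^ a * f z ^ 2) := by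
  have h := intQ a hf hf h1 h1
  rw [ofReal_integral_eq_lintegral_ofReal]
  · rfl
  · simpa only [sq] using h
  · exact Filter.Eventually.of_forall fun z => mul_nonneg (pow_pos (wt_pos z) a).le (sq_nonneg _)

lemma fub (a : ℕ) {u g : ℝ → P6 → ℝ} {s t R : ℝ} {B : ℝ≥0∞} (hst : s ≤ t) (hu : ∀ τ, Measurable (u τ))
    (hg : ∀ τ, Measurable (g τ)) (hd : ∀ τ z, HasDerivAt (fun r => u r z) (g τ z) τ)
    (hc : ∀ z, Continuous fun τ => g τ z) (hB : B < ⊤)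
    (h1 : ∀ τ ∈ Set.Icc s t, Qe a (u τ) ≤ B) (h2 : ∀ τ ∈ Set.Icc s t, Qe a (g τ) ≤ B)
    (hR : ∀ τ ∈ Set.Icc s t, |∫ z, wt z ^ a * (2 * (u τ z * g τ z))| ≤ R) :
    |(∫ z, wt z ^ a * u t z ^ 2) - ∫ z, wt z ^ a * u s z ^ 2| ≤ R * (t - s) := by
  have hw := wt_cont.measurable
  have huc : ∀ z, Continuous fun τ => u τ z := fun z =>
    continuous_iff_continuousAt.mpr fun τ => (hd τ z).continuousAt
  have ft : ∀ z, ∫ τ in s..t, wt z ^ a * (2 * (u τ z * g τ z)) = wt z ^ a * u t z ^ 2 - wt z ^ a * u s z ^ 2 := by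
    intro z
    refine intervalIntegral.integral_eq_sub_of_hasDerivAt (f := fun τ => wt z ^ a * u τ z ^ 2) (fun τ _ => ?_) ?_
    · refine (((hd τ z).pow 2).const_mul (wt z ^ a)).congr_deriv ?_
      simp only [Nat.cast_ofNat, Nat.add_one_sub_one, pow_one]; ring
    · have := huc z
      have := hc z
      apply Continuous.intervalIntegrable
      fun_prop
  have mu : StronglyMeasurable (Function.uncurry u) :=
    stronglyMeasurable_uncurry_of_continuous_of_stronglyMeasurable huc fun τ => (hu τ).stronglyMeasurable
  have mg : StronglyMeasurable (Function.uncurry g) :=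
    stronglyMeasurable_uncurry_of_continuous_of_stronglyMeasurable hc fun τ => (hg τ).stronglyMeasurable
  have hGm : Measurable (fun p : ℝ × P6 => wt p.2 ^ a * (2 * (u p.1 p.2 * g p.1 p.2))) := by
    have m1 : Measurable fun p : ℝ × P6 => u p.1 p.2 := mu.measurable
    have m2 : Measurable fun p : ℝ × P6 => g p.1 p.2 := mg.measurable
    fun_prop
  have hGi : Integrable (fun p : ℝ × P6 => wt p.2 ^ a * (2 * (u p.1 p.2 * g p.1 p.2)))
      ((volume.restrict (Set.Ioc s t)).prod volume) := by
    refine ⟨hGm.aestronglyMeasurable, ?_⟩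
    rw [hasFiniteIntegral_iff_norm, lintegral_prod _ (by fun_prop)]
    calc ∫⁻ τ in Set.Ioc s t, ∫⁻ z, ENNReal.ofReal ‖wt z ^ a * (2 * (u τ z * g τ z))‖
        ≤ ∫⁻ τ in Set.Ioc s t, (B + B) := by
          refine setLIntegral_mono measurable_const fun τ hτ => ?_
          exact (lint_two_mul a (g τ) (hu τ)).trans (add_le_add (h1 τ ⟨hτ.1.le, hτ.2⟩) (h2 τ ⟨hτ.1.le, hτ.2⟩))
      _ < ⊤ := by
          rw [setLIntegral_const]
          exact ENNReal.mul_lt_top (ENNReal.add_lt_top.mpr ⟨hB, hB⟩) (by simp)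
  have i1 : ∀ τ ∈ Set.Icc s t, Integrable fun z => wt z ^ a * u τ z ^ 2 := fun τ hτ => by
    have := intQ a (hu τ) (hu τ) ((h1 τ hτ).trans_lt hB) ((h1 τ hτ).trans_lt hB)
    simpa only [sq] using this
  rw [← integral_sub (i1 t ⟨hst, le_rfl⟩) (i1 s ⟨le_rfl, hst⟩)]
  have e1 : (fun z => wt z ^ a * u t z ^ 2 - wt z ^ a * u s z ^ 2) =
      fun z => ∫ τ in Set.Ioc s t, wt z ^ a * (2 * (u τ z * g τ z)) := by
    funext z
    rw [← ft z, intervalIntegral.integral_of_le hst]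
  rw [e1]
  have sw := integral_integral_swap (f := fun τ z => wt z ^ a * (2 * (u τ z * g τ z))) hGi
  rw [← sw, ← intervalIntegral.integral_of_le hst]
  have := intervalIntegral.norm_integral_le_of_norm_le_const (a := s) (b := t) (C := R)
    (f := fun τ => ∫ z, wt z ^ a * (2 * (u τ z * g τ z))) (fun τ hτ => by
      rw [Set.uIoc_of_le hst] at hτ
      exact hR τ ⟨hτ.1.le, hτ.2⟩)
  rwa [abs_of_nonneg (sub_nonneg.mpr hst)] at this

lemma fubQ (a : ℕ) {u g : ℝ → P6 → ℝ} {s t R : ℝ} {B : ℝ≥0∞} (hst : s ≤ t) (hu : ∀ τ, Measurable (u τ))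
    (hg : ∀ τ, Measurable (g τ)) (hd : ∀ τ z, HasDerivAt (fun r => u r z) (g τ z) τ)
    (hc : ∀ z, Continuous fun τ => g τ z) (hB : B < ⊤)
    (h1 : ∀ τ ∈ Set.Icc s t, Qe a (u τ) ≤ B) (h2 : ∀ τ ∈ Set.Icc s t, Qe a (g τ) ≤ B)
    (hR : ∀ τ ∈ Set.Icc s t, |∫ z, wt z ^ a * (2 * (u τ z * g τ z))| ≤ R) :
    Qe a (u t) ≤ Qe a (u s) + ENNReal.ofReal (R * (t - s)) ∧
    Qe a (u s) ≤ Qe a (u t) + ENNReal.ofReal (R * (t - s)) := by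
  have key := fub a hst hu hg hd hc hB h1 h2 hR
  rw [abs_le] at key
  have hp : ∀ τ, 0 ≤ ∫ z, wt z ^ a * u τ z ^ 2 := fun τ =>
    integral_nonneg fun z => mul_nonneg (pow_pos (wt_pos z) a).le (sq_nonneg _)
  have hR0 : 0 ≤ R * (t - s) := mul_nonneg ((abs_nonneg _).trans (hR s ⟨le_rfl, hst⟩)) (sub_nonneg.mpr hst)
  rw [Qe_eq a (hu t) ((h1 t ⟨hst, le_rfl⟩).trans_lt hB), Qe_eq a (hu s) ((h1 s ⟨le_rfl, hst⟩).trans_lt hB),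
    ← ENNReal.ofReal_add (hp _) hR0, ← ENNReal.ofReal_add (hp _) hR0]
  constructor <;> apply ENNReal.ofReal_le_ofReal <;> linarith

def dw (j : Fin 6) (z : P6) : ℝ := 2 * inner ℝ z.1 (dir6 j).1 + 2 * inner ℝ z.2 (dir6 j).2

lemma dw_cont (j : Fin 6) : Continuous (dw j) := by unfold dw; fun_prop

lemma dw_le (j : Fin 6) (z : P6) : |dw j z| ≤ wt z := by
  unfold dw wt
  have h1 := abs_real_inner_le_norm z.1 (dir6 j).1
  have h2 := abs_real_inner_le_norm z.2 (dir6 j).2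
  have h3 := abs_add_le (2 * inner ℝ z.1 (dir6 j).1) (2 * inner ℝ z.2 (dir6 j).2)
  rw [abs_mul, abs_mul, abs_two] at h3
  have h4 : 2 * ‖z.1‖ ≤ 1 + ‖z.1‖ ^ 2 := by nlinarith [sq_nonneg (‖z.1‖ - 1)]
  have h5 : 2 * ‖z.2‖ ≤ 1 + ‖z.2‖ ^ 2 := by nlinarith [sq_nonneg (‖z.2‖ - 1)]
  have h6 := sq_nonneg ‖z.1‖
  have h7 := sq_nonneg ‖z.2‖
  rcases dir6_norms j with ⟨a, b⟩ | ⟨a, b⟩ <;> rw [a] at h1 <;> rw [b] at h2 <;> linarith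

lemma wt_line (j : Fin 6) (z : P6) (s : ℝ) : HasDerivAt (fun s : ℝ => wt (z + s • dir6 j)) (dw j (z + s • dir6 j)) s := by
  have h1 : HasDerivAt (fun s : ℝ => z.1 + s • (dir6 j).1) (dir6 j).1 s := by
    simpa using ((hasDerivAt_id s).smul_const (dir6 j).1).const_add z.1
  have h2 : HasDerivAt (fun s : ℝ => z.2 + s • (dir6 j).2) (dir6 j).2 s := by
    simpa using ((hasDerivAt_id s).smul_const (dir6 j).2).const_add z.2
  exact (h1.norm_sq.const_add 1).add h2.norm_sq

lemma ibp (a : ℕ) (u : SP) {b : P6 → ℝ} {β : ℝ} (hb : Measurable b) (hβ : ∀ z, |b z| ≤ β) (j : Fin 6)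
    (hinv : ∀ z (s : ℝ), b (z + s • dir6 j) = b z) :
    ENNReal.ofReal |∫ z, wt z ^ a * (2 * (u z * (b z * dS j u z)))| ≤ ENNReal.ofReal (a * β) * Qe a u := by
  have hw := wt_cont.measurable
  have hum : Measurable u := u.continuous.measurable
  have hdm : Measurable (dS j u) := (dS j u).continuous.measurable
  have hdw := (dw_cont j).measurable
  have hβ0 : 0 ≤ β := (abs_nonneg _).trans (hβ 0)
  have key := integral_bilinear_hasLineDerivAt_right_eq_neg_left_of_integrable (μ := (volume : Measure P6))
    (f := fun z => wt z ^ a * b z) (f' := fun z => (a * wt z ^ (a - 1) * dw j z) * b z)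
    (g := fun z => u z ^ 2) (g' := fun z => 2 * u z * dS j u z) (v := dir6 j)
    (B := ContinuousLinearMap.mul ℝ ℝ) ?_ ?_ ?_ ?_ ?_
  · have e : (fun z => wt z ^ a * (2 * (u z * (b z * dS j u z)))) =
      fun z => (ContinuousLinearMap.mul ℝ ℝ) (wt z ^ a * b z) (2 * u z * dS j u z) := by
      funext z; simp only [ContinuousLinearMap.mul_apply']; ring
    rw [e, key, abs_neg]
    have h1 := enorm_integral_le_lintegral_enorm (μ := volume) (fun z : P6 => (ContinuousLinearMap.mul ℝ ℝ) ((a * wt z ^ (a - 1) * dw j z) * b z) (u z ^ 2))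
    simp only [Real.enorm_eq_ofReal_abs] at h1
    refine h1.trans ?_
    unfold Qe
    rw [← lintegral_const_mul' _ _ ENNReal.ofReal_ne_top]
    refine lintegral_mono fun z => ?_
    rw [← ENNReal.ofReal_mul (by positivity)]
    apply ENNReal.ofReal_le_ofReal
    simp only [ContinuousLinearMap.mul_apply']
    have hwp := wt_pos z
    rw [abs_mul, abs_mul, abs_mul, abs_mul, Nat.abs_cast, abs_of_pos (pow_pos hwp _), abs_of_nonneg (sq_nonneg (u z))]
    have h2 : (a : ℝ) * wt z ^ (a - 1) * |dw j z| ≤ a * wt z ^ a := by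
      rcases Nat.eq_zero_or_pos a with h | h
      · simp [h]
      · rw [mul_assoc]
        refine mul_le_mul_of_nonneg_left ?_ (Nat.cast_nonneg a)
        calc wt z ^ (a - 1) * |dw j z| ≤ wt z ^ (a - 1) * wt z := by gcongr; exact dw_le j z
          _ = wt z ^ a := by rw [← pow_succ, Nat.sub_add_cancel h]
    calc (a : ℝ) * wt z ^ (a - 1) * |dw j z| * |b z| * u z ^ 2 ≤ (a * wt z ^ a) * β * u z ^ 2 := by
          gcongr; exact hβ z
      _ = _ := by ring
  · have := (intQ a hum hum (Qe_lt_top a u) (Qe_lt_top a u)).bdd_mul (c := a * β)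
      (f := fun z => a * (dw j z * (wt z)⁻¹) * b z) (by fun_prop) (Filter.Eventually.of_forall fun z => ?_)
    · refine this.congr (Filter.Eventually.of_forall fun z => ?_)
      have hwp := wt_pos z
      simp only [ContinuousLinearMap.mul_apply']
      rcases Nat.eq_zero_or_pos a with h | h
      · simp [h]
      · obtain ⟨n, rfl⟩ : ∃ n, a = n + 1 := ⟨a - 1, by omega⟩
        simp only [Nat.add_sub_cancel]
        rw [pow_succ (wt z) n]
        field_simp
    · have hwp := wt_pos z
      rw [Real.norm_eq_abs, abs_mul, abs_mul, abs_mul, Nat.abs_cast, abs_inv, abs_of_pos hwp]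
      have : |dw j z| * (wt z)⁻¹ ≤ 1 := by
        rw [← div_eq_mul_inv, div_le_one hwp]; exact dw_le j z
      calc (a : ℝ) * (|dw j z| * (wt z)⁻¹) * |b z| ≤ a * 1 * β := by gcongr; exact hβ z
        _ = _ := by ring
  · have := (intQ2 a hum hdm (Qe_lt_top a u) (Qe_lt_top a (dS j u))).bdd_mul (c := β) (f := b) (by fun_prop) (Filter.Eventually.of_forall hβ)
    refine this.congr (Filter.Eventually.of_forall fun z => ?_)
    simp only [ContinuousLinearMap.mul_apply']; ring
  · have := (intQ a hum hum (Qe_lt_top a u) (Qe_lt_top a u)).bdd_mul (c := β) (f := b) (by fun_prop) (Filter.Eventually.of_forall hβ)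
    refine this.congr (Filter.Eventually.of_forall fun z => ?_)
    simp only [ContinuousLinearMap.mul_apply']; ring
  · intro z _
    unfold HasLineDerivAt
    simp only [hinv]
    have h1 := wt_line j z 0
    have h2 := (h1.pow a).mul_const (b z)
    simpa using h2
  · intro z _
    have h1 := (S_hasDeriv_line u j z 0).pow 2
    unfold HasLineDerivAt
    refine HasDerivAt.congr_deriv (f' := _) h1 ?_
    simp

/-- vector field -/
def bb (U : Fin 3 → E3 → ℝ) (g : P6 → ℝ) (j : Fin 6) : P6 → ℝ :=
  if h : (j : ℕ) < 3 then nuA ⟨j, h⟩ else fun z => -1 * FF (U ⟨(j : ℕ) - 3, by omega⟩) g z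

lemma bb_inv (U : Fin 3 → E3 → ℝ) (g : P6 → ℝ) (j : Fin 6) (z : P6) (s : ℝ) :
    bb U g j (z + s • dir6 j) = bb U g j z := by
  unfold bb
  split_ifs with h
  · simp [nuA, dir6, h]
  · simp [FF, dir6, h]

def Tf (U : Fin 3 → E3 → ℝ) (g : SP) (z : P6) : ℝ := ∑ j : Fin 6, bb U g j z * dS j g z

structure Sol (U : Fin 3 → E3 → ℝ) (c σ : ℝ) (W : ℝ → SP) : Prop where
  sg : σ ^ 2 = 1
  ker : ∀ i, Ker (U i) c
  der : ∀ t z, HasDerivAt (fun s => W s z) (σ * Tf U (W t) z) t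
  con : ∀ z, Continuous fun t => Tf U (W t) z

lemma bb_meas {U : Fin 3 → E3 → ℝ} {c : ℝ} (hU : ∀ i, Ker (U i) c) (g : SP) (j : Fin 6) : Measurable (bb U g j) := by
  unfold bb
  split_ifs with h
  · exact (nuA_cont _).measurable
  · exact ((hU _).FF_meas g).const_mul _

lemma Tf_meas {U : Fin 3 → E3 → ℝ} {c : ℝ} (hU : ∀ i, Ker (U i) c) (g : SP) : Measurable (Tf U g) := by
  unfold Tf
  exact Finset.measurable_sum _ fun j _ => (bb_meas hU g j).mul (dS j g).continuous.measurable

/-- force bound predicate -/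
def PB (U : Fin 3 → E3 → ℝ) (l : ℕ) (φ : ℕ → ℝ≥0∞) (g : SP) : Prop :=
  (∀ k, φ k ≠ ⊤) ∧ ∀ (i : Fin 3) (S : List (Fin 6)) (h : ℝ) (z : P6), S.length ≤ l → 0 < h → h ≤ 1 →
    ENNReal.ofReal (dlf h S (FF (U i) g) z ^ 2) ≤ φ S.length

def Bd (a l : ℕ) (φ : ℕ → ℝ≥0∞) (g : SP) : ℝ≥0∞ :=
  (1 + φ 0) * En a l g + ∑ i ∈ Finset.range l, (1 + φ (i + 1)) * En a (l - i) g

lemma bb_dlf {U : Fin 3 → E3 → ℝ} {l : ℕ} {φ : ℕ → ℝ≥0∞} {g : SP} (hP : PB U l φ g) {C : ℝ}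
    (hC : ∀ (i : Fin 3) (S : List (Fin 6)), S.length ≤ l → ∀ h : ℝ, 0 < h → ∀ z, |dlf h S (nuA i) z| ≤ C)
    (hC1 : 1 ≤ C) (j : Fin 6) (S : List (Fin 6)) (hS : S.length ≤ l) {h : ℝ} (h0 : 0 < h) (h1 : h ≤ 1) (z : P6) :
    ENNReal.ofReal (dlf h S (bb U g j) z ^ 2) ≤ ENNReal.ofReal (C ^ 2) * (1 + φ S.length) := by
  have hone : 1 ≤ ENNReal.ofReal (C ^ 2) := by
    rw [ENNReal.one_le_ofReal]; nlinarith
  unfold bb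
  split_ifs with hj
  · have : ENNReal.ofReal (dlf h S (nuA ⟨j, hj⟩) z ^ 2) ≤ ENNReal.ofReal (C ^ 2) := by
      apply ENNReal.ofReal_le_ofReal
      have := hC ⟨j, hj⟩ S hS h h0 z
      rw [← sq_abs]; gcongr
    refine this.trans ?_
    exact le_mul_of_one_le_right' (le_self_add)
  · rw [dlf_smul]
    have e : (-1 * dlf h S (FF (U ⟨(j : ℕ) - 3, by omega⟩) g) z) ^ 2 = dlf h S (FF (U ⟨(j : ℕ) - 3, by omega⟩) g) z ^ 2 := by ring
    rw [e]
    refine (hP.2 _ S h z hS h0 h1).trans ?_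
    calc φ S.length ≤ 1 + φ S.length := le_add_self
      _ ≤ _ := le_mul_of_one_le_left' hone

lemma bb_bdd {U : Fin 3 → E3 → ℝ} {l : ℕ} {φ : ℕ → ℝ≥0∞} {g : SP} (hP : PB U l φ g) (j : Fin 6) (z : P6) :
    |bb U g j z| ≤ 1 + (φ 0).toReal := by
  unfold bb
  split_ifs with hj
  · have := nuA_bdd ⟨j, hj⟩ z
    have := ENNReal.toReal_nonneg (a := φ 0)
    linarith
  · have := hP.2 ⟨(j : ℕ) - 3, by omega⟩ [] 1 z (by simp) one_pos le_rfl
    simp only [dlf, List.length_nil] at this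
    rw [ENNReal.ofReal_le_iff_le_toReal (hP.1 0)] at this
    beta_reduce
    rw [neg_one_mul, abs_neg]
    have h2 := abs_nonneg (FF (U ⟨(j : ℕ) - 3, by omega⟩) g z)
    rw [← sq_abs] at this
    nlinarith [sq_nonneg (|FF (U ⟨(j : ℕ) - 3, by omega⟩) g z| - 1)]

/-- commutator -/
def cm (U : Fin 3 → E3 → ℝ) (h : ℝ) (L : List (Fin 6)) (g : SP) (j : Fin 6) : P6 → ℝ :=
  fun z => dlf h L (fun z => bb U g j z * dS j g z) z - bb U g j z * dlf h L (dS j g) z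

lemma cm_meas {U : Fin 3 → E3 → ℝ} {c : ℝ} (hU : ∀ i, Ker (U i) c) (h : ℝ) (L : List (Fin 6)) (g : SP) (j : Fin 6) :
    Measurable (cm U h L g j) := by
  have h1 := bb_meas hU g j
  have h2 : Measurable (dS j g) := (dS j g).continuous.measurable
  exact (dlf_meas (h1.mul h2)).sub (h1.mul (dlf_meas h2))

lemma Qe_dlf_En (a : ℕ) {h : ℝ} (h0 : 0 < h) (h1 : h ≤ 1) {l m : ℕ} (S : List (Fin 6)) (g : SP) (hS : S.length ≤ m) (hm : m ≤ l) :
    Qe a (dlf h S g) ≤ (3 ^ a) ^ l * En a m g := by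
  refine (Qe_dlf3 a h0 h1 S g).trans ?_
  refine mul_le_mul' (pow_le_pow_right₀ (one_le_pow₀ (by norm_num)) (hS.trans hm)) (le_En hS g)

lemma cm_Qe (a l : ℕ) : ∃ C : ℝ≥0∞, C ≠ ⊤ ∧ 1 ≤ C ∧ ∀ {U : Fin 3 → E3 → ℝ} {c : ℝ} {φ : ℕ → ℝ≥0∞} {g : SP}
    (_ : ∀ i, Ker (U i) c) (_ : PB U l φ g) {h : ℝ} (_ : 0 < h) (_ : h ≤ 1) (L : List (Fin 6)) (_ : L.length ≤ l)
    (j : Fin 6), Qe a (cm U h L g j) ≤ C * ∑ i ∈ Finset.range l, (1 + φ (i + 1)) * En a (l - i) g := by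
  obtain ⟨Cν, hC1, hC⟩ := nu_bdd l
  have hone : 1 ≤ ENNReal.ofReal (Cν ^ 2) := by
    rw [ENNReal.one_le_ofReal]; nlinarith
  refine ⟨(4 * 3 ^ a) ^ l * (ENNReal.ofReal (Cν ^ 2) * (3 ^ a) ^ l), ?_, ?_, ?_⟩
  · finiteness
  · refine one_le_mul (one_le_pow₀ (one_le_mul (by norm_num) (one_le_pow₀ (by norm_num)))) (one_le_mul hone (one_le_pow₀ (one_le_pow₀ (by norm_num))))
  · intro U c φ g hU hP h h0 h1 L hL j
    have key := leib2 a h0 h1 L (bb U g j) (dS j g) (fun k => ENNReal.ofReal (Cν ^ 2) * (1 + φ k))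
      (fun k => (3 ^ a) ^ l * En a (k + 1) g) (bb_meas hU g j) (dS j g).continuous.measurable
      (fun S _ hS z => bb_dlf hP hC hC1 j S (hS.trans hL) h0 h1 z)
      (fun S hS => by
        refine (Qe_dlf3 a h0 h1 S (dS j g)).trans ?_
        refine mul_le_mul' (pow_le_pow_right₀ (one_le_pow₀ (by norm_num)) (by omega)) ?_
        exact le_En (L := j :: S) (by simp) g)
    refine key.trans ?_
    rw [mul_assoc]
    refine mul_le_mul' (pow_le_pow_right₀ (one_le_mul (by norm_num) (one_le_pow₀ (by norm_num))) hL) ?_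
    rw [Finset.mul_sum]
    refine (Finset.sum_le_sum_of_subset (Finset.range_subset_range.mpr hL)).trans' ?_
    refine Finset.sum_le_sum fun i hi => ?_
    have hi := Finset.mem_range.mp hi
    calc ENNReal.ofReal (Cν ^ 2) * (1 + φ (i + 1)) * ((3 ^ a) ^ l * En a (L.length - (i + 1) + 1) g)
        = ENNReal.ofReal (Cν ^ 2) * (3 ^ a) ^ l * ((1 + φ (i + 1)) * En a (L.length - (i + 1) + 1) g) := by ring
      _ ≤ _ := by
        gcongr
        exact En_mono (by omega) g

lemma Tf_dlf (U : Fin 3 → E3 → ℝ) (h : ℝ) (L : List (Fin 6)) (g : SP) :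
    dlf h L (Tf U g) = fun z => ∑ j : Fin 6, (bb U g j z * dS j (dlS h L g) z + cm U h L g j z) := by
  unfold Tf
  rw [dlf_sum]
  funext z
  refine Finset.sum_congr rfl fun j _ => ?_
  rw [dS_dlS, dlS_apply, cm]; ring

lemma En_ne (a l : ℕ) (g : SP) : En a l g ≠ ⊤ := (En_lt_top a l g).ne

lemma Bd_ne (a l : ℕ) {φ : ℕ → ℝ≥0∞} (hφ : ∀ k, φ k ≠ ⊤) (g : SP) : Bd a l φ g ≠ ⊤ := by
  unfold Bd
  refine ENNReal.add_ne_top.mpr ⟨ENNReal.mul_ne_top (ENNReal.add_ne_top.mpr ⟨by simp, hφ 0⟩) (En_ne _ _ _), ?_⟩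
  refine (ENNReal.sum_lt_top.mpr fun i _ => ?_).ne
  exact (ENNReal.mul_ne_top (ENNReal.add_ne_top.mpr ⟨by simp, hφ _⟩) (En_ne _ _ _)).lt_top

lemma bdS_Qe (a : ℕ) {U : Fin 3 → E3 → ℝ} {l : ℕ} {φ : ℕ → ℝ≥0∞} {g : SP} (hP : PB U l φ g) (j : Fin 6) {f : P6 → ℝ} (hf : Measurable f) :
    Qe a (fun z => bb U g j z * f z) ≤ (1 + φ 0) * Qe a f := by
  refine Qe_mul a (fun z => ?_) hf
  unfold bb
  split_ifs with hj
  · refine le_trans (b := ENNReal.ofReal 1) (ENNReal.ofReal_le_ofReal ?_) ?_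
    · have := nuA_bdd ⟨j, hj⟩ z
      rw [← sq_abs]; have := abs_nonneg (nuA ⟨j, hj⟩ z); nlinarith
    · simp
  · have := hP.2 ⟨(j : ℕ) - 3, by omega⟩ [] 1 z (by simp) one_pos le_rfl
    simp only [dlf, List.length_nil] at this
    beta_reduce
    rw [neg_one_mul, neg_sq]
    exact this.trans le_add_self

/-- spatial energy estimate -/
lemma en_space (a l : ℕ) : ∃ C : ℝ≥0∞, C ≠ ⊤ ∧ 1 ≤ C ∧ ∀ {U : Fin 3 → E3 → ℝ} {c : ℝ} {φ : ℕ → ℝ≥0∞} {g : SP}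
    (_ : ∀ i, Ker (U i) c) (_ : PB U l φ g) {h : ℝ} (_ : 0 < h) (_ : h ≤ 1) (L : List (Fin 6)) (_ : L.length ≤ l),
    ENNReal.ofReal |∫ z, wt z ^ a * (2 * (dlf h L g z * dlf h L (Tf U g) z))| ≤ C * Bd a l φ g := by
  obtain ⟨K, hK, hK1, hcm⟩ := cm_Qe a l
  refine ⟨6 * (((a : ℝ≥0∞) + 1) * ((3 ^ a) ^ l * K)), ?_, ?_, ?_⟩
  · finiteness
  · exact one_le_mul (by norm_num) (one_le_mul (by simp) (one_le_mul (one_le_pow₀ (one_le_pow₀ (by norm_num))) hK1))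
  intro U c φ g hU hP h h0 h1 L hL
  set u := dlS h L g with hu
  have hum : Measurable u := u.continuous.measurable
  have hcmj := fun j => hcm hU hP h0 h1 L hL j
  have hSum : ∑ i ∈ Finset.range l, (1 + φ (i + 1)) * En a (l - i) g ≠ ⊤ := by
    have := Bd_ne a l hP.1 g
    unfold Bd at this
    exact (ENNReal.add_ne_top.mp this).2
  have hcmf : ∀ j, Qe a (cm U h L g j) < ⊤ := fun j =>
    (hcmj j).trans_lt (ENNReal.mul_lt_top hK.lt_top hSum.lt_top)
  have i1 : ∀ j, Integrable fun z => wt z ^ a * (2 * (u z * (bb U g j z * dS j u z))) := fun j => by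
    have hm : Measurable (dS j u) := (dS j u).continuous.measurable
    refine intQ2 a hum ((bb_meas hU g j).mul hm) (Qe_lt_top a u) ?_
    exact (bdS_Qe a hP j hm).trans_lt (ENNReal.mul_lt_top (ENNReal.add_lt_top.mpr ⟨by simp, (hP.1 0).lt_top⟩) (Qe_lt_top _ _))
  have i2 : ∀ j, Integrable fun z => wt z ^ a * (2 * (u z * cm U h L g j z)) := fun j =>
    intQ2 a hum (cm_meas hU h L g j) (Qe_lt_top a u) (hcmf j)
  have e : (fun z => wt z ^ a * (2 * (dlf h L g z * dlf h L (Tf U g) z))) = fun z =>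
      ∑ j : Fin 6, (wt z ^ a * (2 * (u z * (bb U g j z * dS j u z))) + wt z ^ a * (2 * (u z * cm U h L g j z))) := by
    funext z
    rw [Tf_dlf, ← dlS_apply]
    simp only [Finset.mul_sum]
    refine Finset.sum_congr rfl fun j _ => ?_
    ring
  have i3 : ∀ j, Integrable fun z => (wt z ^ a * (2 * (u z * (bb U g j z * dS j u z))) + wt z ^ a * (2 * (u z * cm U h L g j z))) :=
    fun j => (i1 j).add (i2 j)
  rw [e, integral_finsetSum _ fun j _ => i3 j]
  have hu2 : Qe a u ≤ (3 ^ a) ^ l * En a l g := by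
    rw [hu, dlS_apply]; exact Qe_dlf_En a h0 h1 L g hL le_rfl
  have hb : ∀ j, ENNReal.ofReal |∫ z, (wt z ^ a * (2 * (u z * (bb U g j z * dS j u z))) + wt z ^ a * (2 * (u z * cm U h L g j z)))|
      ≤ ((a : ℝ≥0∞) + 1) * ((3 ^ a) ^ l * K) * Bd a l φ g := by
    intro j
    rw [integral_add (i1 j) (i2 j)]
    refine (ENNReal.ofReal_le_ofReal (abs_add_le _ _)).trans ?_
    rw [ENNReal.ofReal_add (abs_nonneg _) (abs_nonneg _)]
    have h3 := ibp a u (bb_meas hU g j) (bb_bdd hP j) j (bb_inv U g j)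
    have h4 := int_two_mul a (cm U h L g j) hum
    have h5 : ENNReal.ofReal (a * (1 + (φ 0).toReal)) = a * (1 + φ 0) := by
      rw [ENNReal.ofReal_mul (Nat.cast_nonneg a), ENNReal.ofReal_add zero_le_one ENNReal.toReal_nonneg,
        ENNReal.ofReal_toReal (hP.1 0)]
      simp
    rw [h5] at h3
    refine (add_le_add h3 h4).trans ?_
    unfold Bd
    set Sg := ∑ i ∈ Finset.range l, (1 + φ (i + 1)) * En a (l - i) g with hSg
    calc a * (1 + φ 0) * Qe a u + (Qe a u + Qe a (cm U h L g j))
        ≤ a * (1 + φ 0) * Qe a u + ((1 + φ 0) * Qe a u + K * Sg) := by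
          gcongr
          · exact le_mul_of_one_le_left' le_self_add
          · exact hcmj j
      _ = ((a : ℝ≥0∞) + 1) * ((1 + φ 0) * Qe a u) + K * Sg := by ring
      _ ≤ ((a : ℝ≥0∞) + 1) * ((1 + φ 0) * ((3 ^ a) ^ l * En a l g)) + K * Sg := by gcongr
      _ ≤ ((a : ℝ≥0∞) + 1) * ((1 + φ 0) * (((3 ^ a) ^ l * K) * En a l g)) + ((a : ℝ≥0∞) + 1) * ((3 ^ a) ^ l * K) * Sg := by
          gcongr
          · exact le_mul_of_one_le_right' hK1
          · rw [← mul_assoc]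
            exact le_mul_of_one_le_left' (one_le_mul (by simp) (one_le_pow₀ (one_le_pow₀ (by norm_num))))
      _ = _ := by ring
  calc ENNReal.ofReal |∑ j : Fin 6, ∫ z, (wt z ^ a * (2 * (u z * (bb U g j z * dS j u z))) + wt z ^ a * (2 * (u z * cm U h L g j z)))|
      ≤ ∑ j : Fin 6, ENNReal.ofReal |∫ z, (wt z ^ a * (2 * (u z * (bb U g j z * dS j u z))) + wt z ^ a * (2 * (u z * cm U h L g j z)))| := by
        rw [← ENNReal.ofReal_sum_of_nonneg fun _ _ => abs_nonneg _]
        exact ENNReal.ofReal_le_ofReal (Finset.abs_sum_le_sum_abs _ _)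
    _ ≤ ∑ j : Fin 6, ((a : ℝ≥0∞) + 1) * ((3 ^ a) ^ l * K) * Bd a l φ g := Finset.sum_le_sum fun j _ => hb j
    _ = _ := by simp; ring

lemma dlf_deriv (h : ℝ) (L : List (Fin 6)) : ∀ {f : ℝ → P6 → ℝ} {G : P6 → ℝ} {τ : ℝ},
    (∀ z, HasDerivAt (fun r => f r z) (G z) τ) → ∀ z, HasDerivAt (fun r => dlf h L (f r) z) (dlf h L G z) τ := by
  induction L with
  | nil => intro f G τ hf z; exact hf z
  | cons i L ih =>
    intro f G τ hf z
    exact ih (f := fun r => dff h i (f r)) (G := dff h i G) (fun z => ((hf _).sub (hf z)).div_const h) z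

lemma dlf_cont_t (h : ℝ) (L : List (Fin 6)) : ∀ {f : ℝ → P6 → ℝ},
    (∀ z, Continuous (fun r => f r z)) → ∀ z, Continuous (fun r => dlf h L (f r) z) := by
  induction L with
  | nil => intro f hf z; exact hf z
  | cons i L ih =>
    intro f hf z
    exact ih (f := fun r => dff h i (f r)) (fun z => ((hf _).sub (hf z)).div_const h) z

lemma Qe_dffh (a : ℕ) (h : ℝ) : ∃ K : ℝ≥0∞, K ≠ ⊤ ∧ ∀ (i : Fin 6) {f : P6 → ℝ}, Measurable f →
    Qe a (dff h i f) ≤ K * Qe a f := by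
  refine ⟨ENNReal.ofReal ((h⁻¹) ^ 2) * (2 * ENNReal.ofReal ((1 + |h| + h ^ 2) ^ a) + 2), by finiteness, ?_⟩
  intro i f hf
  have e : dff h i f = fun z => h⁻¹ * (shf h i f z + -1 * f z) := by
    funext z; simp only [dff, shf]; ring
  rw [e, Qe_const_mul, mul_assoc]
  gcongr
  refine (Qe_add a (shf_meas hf)).trans ?_
  rw [Qe_const_mul, add_mul, mul_assoc]
  have := Qe_shf a h i f
  gcongr
  simp

lemma Qe_dlfh (a : ℕ) (h : ℝ) (L : List (Fin 6)) : ∃ K : ℝ≥0∞, K ≠ ⊤ ∧ ∀ {f : P6 → ℝ}, Measurable f →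
    Qe a (dlf h L f) ≤ K * Qe a f := by
  obtain ⟨k, hk, hk'⟩ := Qe_dffh a h
  induction L with
  | nil => exact ⟨1, by simp, fun _ => by simp [dlf]⟩
  | cons i L ih =>
    obtain ⟨K, hK, hK'⟩ := ih
    refine ⟨K * k, by finiteness, fun hf => (hK' (dff_meas hf)).trans ?_⟩
    rw [mul_assoc]
    gcongr
    exact hk' i hf

lemma Qe_sum6 (a : ℕ) {f : Fin 6 → P6 → ℝ} (hf : ∀ j, Measurable (f j)) :
    Qe a (fun z => ∑ j, f j z) ≤ 6 * ∑ j, Qe a (f j) := by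
  have hw := wt_cont.measurable
  unfold Qe
  rw [← lintegral_finsetSum _ fun j _ => by have := hf j; fun_prop, ← lintegral_const_mul' _ _ (by simp)]
  refine lintegral_mono fun z => ?_
  have hwp := pow_pos (wt_pos z) a
  have h6 : (6 : ℝ≥0∞) = ENNReal.ofReal 6 := by simp
  rw [← ENNReal.ofReal_sum_of_nonneg fun j _ => by positivity, h6, ← ENNReal.ofReal_mul (by norm_num)]
  apply ENNReal.ofReal_le_ofReal
  rw [← Finset.mul_sum, mul_left_comm]
  refine mul_le_mul_of_nonneg_left ?_ hwp.le
  have := sq_sum_le_card_mul_sum_sq (s := (Finset.univ : Finset (Fin 6))) (f := fun j => f j z)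
  simpa using this

lemma Tf_Qe (a : ℕ) {U : Fin 3 → E3 → ℝ} {l : ℕ} (hl : 1 ≤ l) {c : ℝ} {φ : ℕ → ℝ≥0∞} {g : SP} (hU : ∀ i, Ker (U i) c) (hP : PB U l φ g) :
    Qe a (Tf U g) ≤ 36 * Bd a l φ g := by
  unfold Tf
  have hm : ∀ j, Measurable (dS j g) := fun j => (dS j g).continuous.measurable
  refine (Qe_sum6 a fun j => (bb_meas hU g j).mul (hm j)).trans ?_
  have : ∀ j, Qe a (fun z => bb U g j z * dS j g z) ≤ Bd a l φ g := fun j => by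
    refine (bdS_Qe a hP j (hm j)).trans ?_
    unfold Bd
    refine le_trans ?_ le_self_add
    gcongr
    exact le_En (L := [j]) (by simpa using hl) g
  calc 6 * ∑ j, Qe a (fun z => bb U g j z * dS j g z) ≤ 6 * ∑ _j : Fin 6, Bd a l φ g := by
        gcongr with j; exact this j
    _ = _ := by simp; ring

theorem EN (a l : ℕ) (hl : 1 ≤ l) : ∃ C : ℝ≥0∞, C ≠ ⊤ ∧ 1 ≤ C ∧ ∀ {U : Fin 3 → E3 → ℝ} {c σ : ℝ} {W : ℝ → SP},
    Sol U c σ W → ∀ {s t : ℝ}, s ≤ t → ∀ (φ : ℝ → ℕ → ℝ≥0∞), (∀ τ ∈ Set.Icc s t, PB U l (φ τ) (W τ)) →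
    ∀ R : ℝ, (∀ τ ∈ Set.Icc s t, C * Bd a l (φ τ) (W τ) ≤ ENNReal.ofReal R) →
    En a l (W t) ≤ En a l (W s) + ENNReal.ofReal (R * (t - s)) ∧
    En a l (W s) ≤ En a l (W t) + ENNReal.ofReal (R * (t - s)) := by
  obtain ⟨C, hC, hC1, hen⟩ := en_space a l
  refine ⟨C, hC, hC1, ?_⟩
  intro U c σ W hW s t hst φ hφ R hR
  have hBR : ∀ τ ∈ Set.Icc s t, Bd a l (φ τ) (W τ) ≤ ENNReal.ofReal R := fun τ hτ =>
    (le_mul_of_one_le_left' hC1).trans (hR τ hτ)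
  have hR0' : 0 ≤ max R 0 := le_max_right _ _
  have key : ∀ (L : List (Fin 6)), L.length ≤ l → ∀ h : ℝ, 0 < h → h ≤ 1 →
      Qe a (dlf h L (W t)) ≤ Qe a (dlf h L (W s)) + ENNReal.ofReal (R * (t - s)) ∧
      Qe a (dlf h L (W s)) ≤ Qe a (dlf h L (W t)) + ENNReal.ofReal (R * (t - s)) := by
    intro L hL h h0 h1
    obtain ⟨K, hK, hK'⟩ := Qe_dlfh a h L
    have hRm : max R 0 * (t - s) = max (R * (t - s)) 0 := by
      rw [max_mul_of_nonneg _ _ (sub_nonneg.mpr hst), zero_mul]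
    have hRR : ENNReal.ofReal (R * (t - s)) = ENNReal.ofReal (max R 0 * (t - s)) := by
      rw [hRm]; simp
    rw [hRR]
    refine fubQ a (u := fun τ => dlf h L (W τ)) (g := fun τ z => σ * dlf h L (Tf U (W τ)) z)
      (B := (3 ^ a) ^ l * ENNReal.ofReal R + K * (36 * ENNReal.ofReal R)) hst
      (fun τ => dlf_meas (W τ).continuous.measurable)
      (fun τ => (dlf_meas (Tf_meas hW.ker (W τ))).const_mul σ) ?_ ?_ (by finiteness) ?_ ?_ ?_
    · intro τ z
      have := dlf_deriv h L (f := fun r => W r) (G := fun z => σ * Tf U (W τ) z) (τ := τ) (fun z => hW.der τ z) z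
      rwa [dlf_smul] at this
    · intro z
      exact (dlf_cont_t h L hW.con z).const_mul σ
    · intro τ hτ
      refine le_trans ?_ le_self_add
      refine (Qe_dlf_En a h0 h1 L (W τ) hL le_rfl).trans ?_
      gcongr
      refine le_trans ?_ (hBR τ hτ)
      unfold Bd
      exact le_trans (le_mul_of_one_le_left' le_self_add) le_self_add
    · intro τ hτ
      rw [Qe_const_mul, hW.sg, ENNReal.ofReal_one, one_mul]
      refine le_trans ?_ le_add_self
      refine (hK' (Tf_meas hW.ker _)).trans ?_
      gcongr
      refine (Tf_Qe a hl hW.ker (hφ τ hτ)).trans ?_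
      gcongr
      exact hBR τ hτ
    · intro τ hτ
      have h3 := (hen hW.ker (hφ τ hτ) h0 h1 L hL).trans (hR τ hτ)
      have h4 : |σ| = 1 := by
        rw [← abs_one, ← sq_eq_sq_iff_abs_eq_abs, hW.sg]; norm_num
      have e : (fun z => wt z ^ a * (2 * (dlf h L (W τ) z * (σ * dlf h L (Tf U (W τ)) z)))) =
          fun z => σ * (wt z ^ a * (2 * (dlf h L (W τ) z * dlf h L (Tf U (W τ)) z))) := by
        funext z; ring
      rw [e, integral_const_mul, abs_mul, h4, one_mul]
      have h5 := h3.trans (ENNReal.ofReal_le_ofReal (le_max_left R 0))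
      rwa [ENNReal.ofReal_le_ofReal_iff hR0'] at h5
  have lim : ∀ (A B : SP), (∀ (L : List (Fin 6)), L.length ≤ l → ∀ h : ℝ, 0 < h → h ≤ 1 →
      Qe a (dlf h L A) ≤ Qe a (dlf h L B) + ENNReal.ofReal (R * (t - s))) →
      En a l A ≤ En a l B + ENNReal.ofReal (R * (t - s)) := by
    intro A B hAB
    refine iSup₂_le fun L hL => ?_
    refine le_trans ?_ (add_le_add (le_En hL B) le_rfl)
    have hT : Filter.Tendsto (fun n => ENNReal.ofReal ((1 + hn n + hn n ^ 2) ^ a) ^ L.length * Qe a (plS L B) + ENNReal.ofReal (R * (t - s)))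
        Filter.atTop (nhds (1 * Qe a (plS L B) + ENNReal.ofReal (R * (t - s)))) :=
      (ENNReal.Tendsto.mul_const (K_tendsto a L.length) (Or.inr (Qe_lt_top a _).ne)).add_const _
    rw [one_mul] at hT
    refine Qe_plS_le a L A hT fun n => ?_
    refine (hAB L hL (hn n) (hn_pos n) (hn_le n)).trans ?_
    gcongr
    exact Qe_dlf a (hn_pos n) L B
  exact ⟨lim _ _ fun L hL h h0 h1 => (key L hL h h0 h1).1, lim _ _ fun L hL h h0 h1 => (key L hL h h0 h1).2⟩

/-! ### L¹ conservation -/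

lemma fub0 {u g : ℝ → P6 → ℝ} {s t : ℝ} {B : ℝ≥0∞} (hst : s ≤ t)
    (hg : ∀ τ, Measurable (g τ)) (hd : ∀ τ z, HasDerivAt (fun r => u r z) (g τ z) τ)
    (hc : ∀ z, Continuous fun τ => g τ z) (hB : B < ⊤)
    (h1 : ∀ τ, Integrable (u τ)) (h2 : ∀ τ ∈ Set.Icc s t, ∫⁻ z, ENNReal.ofReal |g τ z| ≤ B)
    (hR : ∀ τ ∈ Set.Icc s t, ∫ z, g τ z = 0) :
    (∫ z, u t z) = ∫ z, u s z := by
  have ft : ∀ z, ∫ τ in s..t, g τ z = u t z - u s z := by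
    intro z
    exact intervalIntegral.integral_eq_sub_of_hasDerivAt (fun τ _ => hd τ z) ((hc z).intervalIntegrable _ _)
  have mg : StronglyMeasurable (Function.uncurry g) :=
    stronglyMeasurable_uncurry_of_continuous_of_stronglyMeasurable hc fun τ => (hg τ).stronglyMeasurable
  have hGm : Measurable (fun p : ℝ × P6 => g p.1 p.2) := mg.measurable
  have hGi : Integrable (fun p : ℝ × P6 => g p.1 p.2)
      ((volume.restrict (Set.Ioc s t)).prod volume) := by
    refine ⟨hGm.aestronglyMeasurable, ?_⟩
    rw [hasFiniteIntegral_iff_norm, lintegral_prod _ (by fun_prop)]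
    calc ∫⁻ τ in Set.Ioc s t, ∫⁻ z, ENNReal.ofReal ‖g τ z‖
        ≤ ∫⁻ τ in Set.Ioc s t, B := by
          refine setLIntegral_mono measurable_const fun τ hτ => ?_
          exact h2 τ ⟨hτ.1.le, hτ.2⟩
      _ < ⊤ := by
          rw [setLIntegral_const]
          exact ENNReal.mul_lt_top hB (by simp)
  rw [← sub_eq_zero, ← integral_sub (h1 t) (h1 s)]
  have e1 : (fun z => u t z - u s z) = fun z => ∫ τ in Set.Ioc s t, g τ z := by
    funext z
    rw [← ft z, intervalIntegral.integral_of_le hst]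
  rw [e1]
  have sw := integral_integral_swap (f := fun τ z => g τ z) hGi
  rw [← sw, ← intervalIntegral.integral_of_le hst]
  rw [intervalIntegral.integral_congr (g := fun _ => 0)]
  · simp
  · intro τ hτ
    rw [Set.uIcc_of_le hst] at hτ
    exact hR τ hτ

lemma L1_lint {f : P6 → ℝ} (hf : Measurable f) : ∫⁻ z, ENNReal.ofReal |f z| ≤ JJ * JJ + Qe 4 f := by
  have hw := wt_cont.measurable
  have e : JJ * JJ = ∫⁻ z : P6, ENNReal.ofReal (jw z.1) * ENNReal.ofReal (jw z.2) := by
    rw [Measure.volume_eq_prod]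
    rw [lintegral_prod_mul (f := fun x => ENNReal.ofReal (jw x)) (g := fun x => ENNReal.ofReal (jw x))
      (ENNReal.measurable_ofReal.comp jw_meas).aemeasurable (ENNReal.measurable_ofReal.comp jw_meas).aemeasurable]
    rfl
  rw [e]
  unfold Qe
  rw [← lintegral_add_right _ (by fun_prop)]
  refine lintegral_mono fun z => ?_
  have hwp := wt_pos z
  rw [← ENNReal.ofReal_mul (jw_pos _).le, ← ENNReal.ofReal_add (mul_pos (jw_pos _) (jw_pos _)).le (by positivity)]
  apply ENNReal.ofReal_le_ofReal
  have h1 := wt4_le z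
  have h2 : |f z| ≤ (wt z ^ 4)⁻¹ + wt z ^ 4 * f z ^ 2 := by
    rw [← sq_abs]
    have hx := abs_nonneg (f z)
    have hy : 0 < wt z ^ 4 := by positivity
    set x := |f z|
    set y := wt z ^ 4
    rw [← sub_nonneg]
    have : y⁻¹ + y * x ^ 2 - x = y⁻¹ * (1 + (y * x) ^ 2 - y * x) := by field_simp
    rw [this]
    have : 0 ≤ 1 + (y * x) ^ 2 - y * x := by nlinarith [sq_nonneg (y * x - 1)]
    positivity
  linarith

def be (ε x : ℝ) : ℝ := Real.sqrt (x ^ 2 + ε ^ 2) - ε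
def be' (ε x : ℝ) : ℝ := x / Real.sqrt (x ^ 2 + ε ^ 2)

lemma be_pos {ε : ℝ} (h : 0 < ε) (x : ℝ) : 0 < x ^ 2 + ε ^ 2 := by positivity
lemma be_der {ε : ℝ} (h : 0 < ε) (x : ℝ) : HasDerivAt (be ε) (be' ε x) x := by
  have h1 : HasDerivAt (fun x : ℝ => x ^ 2 + ε ^ 2) (2 * x) x := by
    simpa using (hasDerivAt_pow 2 x).add_const (ε ^ 2)
  have h2 := (h1.sqrt (be_pos h x).ne').sub_const ε
  refine h2.congr_deriv ?_
  unfold be'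
  rw [mul_div_mul_left _ _ two_ne_zero]
lemma be_abs {ε : ℝ} (h : 0 < ε) (x : ℝ) : |be ε x| ≤ |x| := by
  unfold be
  have h1 : ε ≤ Real.sqrt (x ^ 2 + ε ^ 2) := Real.le_sqrt_of_sq_le (by nlinarith [sq_nonneg x])
  rw [abs_of_nonneg (by linarith)]
  have h2 : Real.sqrt (x ^ 2 + ε ^ 2) ≤ |x| + ε := by
    rw [Real.sqrt_le_left (by positivity)]
    nlinarith [sq_abs x, abs_nonneg x]
  linarith
lemma be'_abs {ε : ℝ} (h : 0 < ε) (x : ℝ) : |be' ε x| ≤ 1 := by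
  unfold be'
  have h1 := Real.sqrt_pos.mpr (be_pos h x)
  rw [abs_div, abs_of_pos h1, div_le_one h1]
  exact Real.abs_le_sqrt (by nlinarith [sq_nonneg ε])
lemma be'_cont {ε : ℝ} (h : 0 < ε) : Continuous (be' ε) := by
  unfold be'
  exact continuous_id.div (by fun_prop) fun x => (Real.sqrt_pos.mpr (be_pos h x)).ne'
lemma be_cont {ε : ℝ} : Continuous (be ε) := by
  unfold be; fun_prop

lemma transp {U : Fin 3 → E3 → ℝ} {l : ℕ} {c : ℝ} {φ : ℕ → ℝ≥0∞} {g : SP} (hU : ∀ i, Ker (U i) c) (hP : PB U l φ g)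
    {ε : ℝ} (hε : 0 < ε) : ∫ z, be' ε (g z) * Tf U g z = 0 := by
  have i1 : ∀ j, Integrable fun z => bb U g j z * (be' ε (g z) * dS j g z) := fun j => by
    have : Integrable fun z => be' ε (g z) * dS j g z :=
      (dS j g).integrable.bdd_mul (c := 1) ((be'_cont hε).comp g.continuous).aestronglyMeasurable
        (Filter.Eventually.of_forall fun z => be'_abs hε _)
    exact this.bdd_mul (bb_meas hU g j).aestronglyMeasurable (Filter.Eventually.of_forall (bb_bdd hP j))
  have e : (fun z => be' ε (g z) * Tf U g z) = fun z => ∑ j, bb U g j z * (be' ε (g z) * dS j g z) := by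
    funext z; unfold Tf; rw [Finset.mul_sum]
    exact Finset.sum_congr rfl fun j _ => by ring
  rw [e, integral_finsetSum _ fun j _ => i1 j]
  refine Finset.sum_eq_zero fun j _ => ?_
  have key := integral_bilinear_hasLineDerivAt_right_eq_neg_left_of_integrable (μ := (volume : Measure P6))
    (f := bb U g j) (f' := fun z => 0)
    (g := fun z => be ε (g z)) (g' := fun z => be' ε (g z) * dS j g z) (v := dir6 j)
    (B := ContinuousLinearMap.mul ℝ ℝ) (by simp) (by simpa using i1 j) ?_ ?_ ?_
  · simpa using key
  · have : Integrable fun z => be ε (g z) := by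
      refine g.integrable.mono (be_cont.comp g.continuous).aestronglyMeasurable (Filter.Eventually.of_forall fun z => ?_)
      exact be_abs hε _
    simpa using this.bdd_mul (bb_meas hU g j).aestronglyMeasurable (Filter.Eventually.of_forall (bb_bdd hP j))
  · intro z _
    unfold HasLineDerivAt
    simp only [bb_inv]
    exact hasDerivAt_const _ _
  · intro z _
    unfold HasLineDerivAt
    have h1 := S_hasDeriv_line g j z 0
    have h2 := (be_der hε (g (z + (0:ℝ) • dir6 j))).comp (0:ℝ) h1
    refine HasDerivAt.congr_deriv (f' := _) h2 ?_
    simp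

theorem L1_cons {U : Fin 3 → E3 → ℝ} {c σ : ℝ} {W : ℝ → SP} (hW : Sol U c σ W) {s t : ℝ} (hst : s ≤ t)
    (φ : ℝ → ℕ → ℝ≥0∞) (hφ : ∀ τ ∈ Set.Icc s t, PB U 1 (φ τ) (W τ)) (R : ℝ)
    (hR : ∀ τ ∈ Set.Icc s t, Bd 4 1 (φ τ) (W τ) ≤ ENNReal.ofReal R) : L1 (W t) = L1 (W s) := by
  have hWc : ∀ z, Continuous fun τ => W τ z := fun z =>
    continuous_iff_continuousAt.mpr fun τ => (hW.der τ z).continuousAt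
  have step : ∀ ε : ℝ, 0 < ε → ∫ z, be ε (W t z) = ∫ z, be ε (W s z) := by
    intro ε hε
    refine fub0 (u := fun τ z => be ε (W τ z)) (g := fun τ z => be' ε (W τ z) * (σ * Tf U (W τ) z))
      (B := JJ * JJ + 36 * ENNReal.ofReal R) hst ?_ ?_ ?_ ?_ ?_ ?_ ?_
    · intro τ
      exact ((be'_cont hε).comp (W τ).continuous).measurable.mul ((Tf_meas hW.ker _).const_mul σ)
    · intro τ z
      exact (be_der hε (W τ z)).comp τ (hW.der τ z)
    · intro z
      exact ((be'_cont hε).comp (hWc z)).mul ((hW.con z).const_mul σ)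
    · have := JJ_lt
      exact ENNReal.add_lt_top.mpr ⟨ENNReal.mul_lt_top this this, by finiteness⟩
    · intro τ
      refine (W τ).integrable.mono (be_cont.comp (W τ).continuous).aestronglyMeasurable (Filter.Eventually.of_forall fun z => ?_)
      exact be_abs hε _
    · intro τ hτ
      have h4 : |σ| = 1 := by
        rw [← abs_one, ← sq_eq_sq_iff_abs_eq_abs, hW.sg]; norm_num
      calc ∫⁻ z, ENNReal.ofReal |be' ε (W τ z) * (σ * Tf U (W τ) z)| ≤ ∫⁻ z, ENNReal.ofReal |Tf U (W τ) z| := by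
            refine lintegral_mono fun z => ENNReal.ofReal_le_ofReal ?_
            rw [abs_mul, abs_mul, h4, one_mul]
            exact mul_le_of_le_one_left (abs_nonneg _) (be'_abs hε _)
        _ ≤ JJ * JJ + Qe 4 (Tf U (W τ)) := L1_lint (Tf_meas hW.ker _)
        _ ≤ _ := by
            gcongr
            refine (Tf_Qe 4 le_rfl hW.ker (hφ τ hτ)).trans ?_
            gcongr
            exact hR τ hτ
    · intro τ hτ
      have := transp hW.ker (hφ τ hτ) hε
      calc ∫ z, be' ε (W τ z) * (σ * Tf U (W τ) z) = ∫ z, σ * (be' ε (W τ z) * Tf U (W τ) z) := by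
            congr 1; funext z; ring
        _ = 0 := by rw [integral_const_mul, this, mul_zero]
  have lim : ∀ g : SP, Filter.Tendsto (fun n => ∫ z, be (hn n) (g z)) Filter.atTop (nhds (L1 g)) := by
    intro g
    refine tendsto_integral_of_dominated_convergence (fun z => |g z|)
      (fun n => (be_cont.comp g.continuous).aestronglyMeasurable) g.integrable.abs
      (fun n => Filter.Eventually.of_forall fun z => be_abs (hn_pos n) _) (Filter.Eventually.of_forall fun z => ?_)
    have h1 : Continuous fun ε : ℝ => be ε (g z) := by unfold be; fun_prop
    have h2 := (h1.tendsto 0).comp hn_tendsto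
    have h3 : be 0 (g z) = |g z| := by simp [be, Real.sqrt_sq_eq_abs]
    rw [h3] at h2
    exact h2
  refine tendsto_nhds_unique (lim (W t)) ?_
  have := lim (W s)
  refine this.congr fun n => (step (hn n) (hn_pos n)).symm

def eR (a l : ℕ) (g : SP) : ℝ := (En a l g).toReal
def jR : ℝ := JJ.toReal

lemma eR_nonneg (a l : ℕ) (g : SP) : 0 ≤ eR a l g := ENNReal.toReal_nonneg
lemma jR_nonneg : 0 ≤ jR := ENNReal.toReal_nonneg
lemma En_eq (a l : ℕ) (g : SP) : En a l g = ENNReal.ofReal (eR a l g) :=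
  (ENNReal.ofReal_toReal (En_ne a l g)).symm
lemma JJ_eq : JJ = ENNReal.ofReal jR := (ENNReal.ofReal_toReal JJ_lt.ne).symm
lemma eR_mono {a l l' : ℕ} (h : l ≤ l') (g : SP) : eR a l g ≤ eR a l' g :=
  ENNReal.toReal_mono (En_ne _ _ _) (En_mono h g)
lemma eR_mono_a {a b l : ℕ} (h : a ≤ b) (g : SP) : eR a l g ≤ eR b l g := by
  refine ENNReal.toReal_mono (En_ne _ _ _) ?_
  unfold En
  refine iSup_mono fun L => iSup_mono fun hL => ?_
  unfold Qe
  refine lintegral_mono fun z => ENNReal.ofReal_le_ofReal ?_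
  beta_reduce
  exact mul_le_mul_of_nonneg_right (pow_le_pow_right₀ (wt_one_le z) h) (sq_nonneg _)

lemma L1_nonneg (g : P6 → ℝ) : 0 ≤ L1 g := integral_nonneg fun z => abs_nonneg _

lemma L1_sq (g : SP) (l : ℕ) : L1 g ^ 2 ≤ jR ^ 2 * eR 4 l g := by
  have h1 := L1_le g
  have h2 : Qe 4 g ≤ En 4 l g := le_En (L := []) (Nat.zero_le _) g
  have h3 : ENNReal.ofReal (L1 g ^ 2) ≤ ENNReal.ofReal (jR ^ 2 * eR 4 l g) := by
    refine h1.trans ((mul_le_mul' le_rfl h2).trans (le_of_eq ?_))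
    rw [En_eq, JJ_eq, ← ENNReal.ofReal_mul jR_nonneg, ← ENNReal.ofReal_mul (mul_nonneg jR_nonneg jR_nonneg), sq]
  have := jR_nonneg
  have := eR_nonneg 4 l g
  rwa [ENNReal.ofReal_le_ofReal_iff (by positivity)] at h3

def BdR (a l : ℕ) (ψ : ℕ → ℝ) (g : SP) : ℝ :=
  (1 + ψ 0) * eR a l g + ∑ i ∈ Finset.range l, (1 + ψ (i + 1)) * eR a (l - i) g

lemma BdR_nonneg {a l : ℕ} {ψ : ℕ → ℝ} (h : ∀ k, 0 ≤ ψ k) (g : SP) : 0 ≤ BdR a l ψ g := by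
  unfold BdR
  have := fun k => eR_nonneg a k g
  have h0 := h 0
  refine add_nonneg (mul_nonneg (by linarith) (this _)) (Finset.sum_nonneg fun i _ => ?_)
  have := h (i+1)
  exact mul_nonneg (by linarith) (eR_nonneg _ _ _)

lemma Bd_ofReal {a l : ℕ} {ψ : ℕ → ℝ} (h : ∀ k, 0 ≤ ψ k) (g : SP) :
    Bd a l (fun k => ENNReal.ofReal (ψ k)) g = ENNReal.ofReal (BdR a l ψ g) := by
  have h1 : ∀ k, (1 : ℝ≥0∞) + ENNReal.ofReal (ψ k) = ENNReal.ofReal (1 + ψ k) := fun k => by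
    rw [ENNReal.ofReal_add zero_le_one (h k), ENNReal.ofReal_one]
  have h1' : ∀ k, 0 ≤ 1 + ψ k := fun k => by have := h k; linarith
  unfold Bd BdR
  simp only [h1, En_eq]
  have h2 : ∀ k m, ENNReal.ofReal (1 + ψ k) * ENNReal.ofReal (eR a m g) = ENNReal.ofReal ((1 + ψ k) * eR a m g) :=
    fun k m => (ENNReal.ofReal_mul (h1' k)).symm
  simp only [h2]
  have hn : ∀ k m, 0 ≤ (1 + ψ k) * eR a m g := fun k m => mul_nonneg (h1' k) (eR_nonneg _ _ _)
  rw [ENNReal.ofReal_add (hn _ _) (Finset.sum_nonneg fun i _ => hn _ _),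
    ENNReal.ofReal_sum_of_nonneg fun i _ => hn _ _]

def PBR (U : Fin 3 → E3 → ℝ) (l : ℕ) (ψ : ℕ → ℝ) (g : SP) : Prop :=
  (∀ k, 0 ≤ ψ k) ∧ PB U l (fun k => ENNReal.ofReal (ψ k)) g

theorem ENR (a l : ℕ) (hl : 1 ≤ l) : ∃ C : ℝ, 1 ≤ C ∧ ∀ {U : Fin 3 → E3 → ℝ} {c σ : ℝ} {W : ℝ → SP},
    Sol U c σ W → ∀ {s t : ℝ}, s ≤ t → ∀ (ψ : ℝ → ℕ → ℝ), (∀ τ ∈ Set.Icc s t, PBR U l (ψ τ) (W τ)) →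
    ∀ R : ℝ, (∀ τ ∈ Set.Icc s t, C * BdR a l (ψ τ) (W τ) ≤ R) →
    |eR a l (W t) - eR a l (W s)| ≤ R * (t - s) := by
  obtain ⟨C, hC, hC1, h⟩ := EN a l hl
  refine ⟨C.toReal, ?_, ?_⟩
  · rw [← ENNReal.toReal_one]; exact ENNReal.toReal_mono hC hC1
  intro U c σ W hW s t hst ψ hψ R hR
  have hC0 : 0 ≤ C.toReal := ENNReal.toReal_nonneg
  have hR0 : 0 ≤ R := le_trans (mul_nonneg hC0 (BdR_nonneg (hψ s ⟨le_rfl, hst⟩).1 _)) (hR s ⟨le_rfl, hst⟩)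
  obtain ⟨k1, k2⟩ := h hW hst (fun τ k => ENNReal.ofReal (ψ τ k)) (fun τ hτ => (hψ τ hτ).2) R (fun τ hτ => by
    rw [Bd_ofReal (hψ τ hτ).1, ← ENNReal.ofReal_toReal hC, ← ENNReal.ofReal_mul hC0]
    exact ENNReal.ofReal_le_ofReal (hR τ hτ))
  have hp : 0 ≤ R * (t - s) := mul_nonneg hR0 (by linarith)
  have n1 := eR_nonneg a l (W s)
  have n2 := eR_nonneg a l (W t)
  rw [En_eq, En_eq, ← ENNReal.ofReal_add n1 hp, ENNReal.ofReal_le_ofReal_iff (by positivity)] at k1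
  rw [En_eq, En_eq, ← ENNReal.ofReal_add n2 hp, ENNReal.ofReal_le_ofReal_iff (by positivity)] at k2
  rw [abs_le]; constructor <;> linarith

lemma L1_consR {U : Fin 3 → E3 → ℝ} {c σ : ℝ} {W : ℝ → SP} (hW : Sol U c σ W) {s t : ℝ} (hst : s ≤ t)
    (ψ : ℝ → ℕ → ℝ) (hψ : ∀ τ ∈ Set.Icc s t, PBR U 1 (ψ τ) (W τ)) (R : ℝ)
    (hR : ∀ τ ∈ Set.Icc s t, BdR 4 1 (ψ τ) (W τ) ≤ R) : L1 (W t) = L1 (W s) :=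
  L1_cons hW hst (fun τ k => ENNReal.ofReal (ψ τ k)) (fun τ hτ => (hψ τ hτ).2) R fun τ hτ => by
    rw [Bd_ofReal (hψ τ hτ).1]; exact ENNReal.ofReal_le_ofReal (hR τ hτ)

lemma PBR.mono {U : Fin 3 → E3 → ℝ} {l l' : ℕ} {ψ : ℕ → ℝ} {g : SP} (h : PBR U l' ψ g) (hl : l ≤ l') : PBR U l ψ g :=
  ⟨h.1, h.2.1, fun i S r z hS => h.2.2 i S r z (hS.trans hl)⟩

/-- force bounds for the weight-4 estimate -/
def ψ4 (c : ℝ) (g : SP) : ℕ → ℝ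
  | 0 => c ^ 2 * L1 g ^ 2
  | 1 => c ^ 2 * L1 g ^ 2
  | (j + 2) => c ^ 2 * (jR ^ 2 * (81 ^ 6 * eR 4 (j + 1) g))

lemma ψ4_two (c : ℝ) (g : SP) (j : ℕ) : ψ4 c g (j + 2) = c ^ 2 * (jR ^ 2 * (81 ^ 6 * eR 4 (j + 1) g)) := rfl

lemma D1sq {U : E3 → ℝ} {c : ℝ} (hU : Ker U c) {h : ℝ} (h0 : 0 < h) (d : Fin 6) (S : List (Fin 6)) (g : SP) (z : P6) :
    dlf h (d :: S) (FF U g) z ^ 2 ≤ c ^ 2 * L1 (dlS h S g) ^ 2 := by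
  have := hU.D1 h0 d S g z
  rw [← sq_abs, ← mul_pow]; gcongr

lemma ψ4_nonneg (c : ℝ) (g : SP) (k : ℕ) : 0 ≤ ψ4 c g k := by
  have := jR_nonneg
  match k with
  | 0 => unfold ψ4; positivity
  | 1 => unfold ψ4; positivity
  | (j + 2) => unfold ψ4; have := eR_nonneg 4 (j+1) g; positivity

lemma B0sq {U : E3 → ℝ} {c : ℝ} (hU : Ker U c) (g : SP) (z : P6) : FF U g z ^ 2 ≤ c ^ 2 * L1 g ^ 2 := by
  have := hU.B0 g z.1
  unfold FF
  rw [← sq_abs, ← mul_pow]; gcongr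

lemma PB4 {U : Fin 3 → E3 → ℝ} {c : ℝ} (hU : ∀ i, Ker (U i) c) (g : SP) : PBR U 7 (ψ4 c g) g := by
  refine ⟨ψ4_nonneg c g, fun k => ENNReal.ofReal_ne_top, ?_⟩
  intro i S h z hS h0 h1
  apply ENNReal.ofReal_le_ofReal
  match S with
  | [] => exact B0sq (hU i) g z
  | [d] => exact D1sq (hU i) h0 d [] g z
  | (d :: d' :: S) =>
    refine (D1sq (hU i) h0 d (d' :: S) g z).trans ?_
    simp only [List.length_cons] at hS ⊢
    rw [show S.length + 1 + 1 = S.length + 2 from rfl, ψ4_two]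
    gcongr
    have h1 := L1_le (dlS h (d' :: S) g)
    rw [dlS_apply] at h1
    have h2 := Qe_dlf_En 4 h0 (by assumption) (m := S.length + 1) (l := 6) (d' :: S) g (by simp) (by omega)
    have h3 := h1.trans (mul_le_mul' le_rfl h2)
    rw [En_eq, JJ_eq, ← ENNReal.ofReal_mul jR_nonneg] at h3
    have e : ((3:ℝ≥0∞) ^ 4) ^ 6 = ENNReal.ofReal (81 ^ 6) := by
      rw [ENNReal.ofReal_pow (by norm_num)]
      norm_num
    have p1 := jR_nonneg
    have p2 := eR_nonneg 4 (S.length + 1) g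
    rw [e, ← ENNReal.ofReal_mul (by positivity), ← ENNReal.ofReal_mul (by positivity),
      ENNReal.ofReal_le_ofReal_iff (by positivity)] at h3
    rw [dlS_apply]
    linarith

/-- force bounds for the weight-2 estimate -/
def ψ2 (c κ : ℝ) (k : ℕ) (g : SP) : ℕ → ℝ
  | 0 => c ^ 2 * L1 g ^ 2
  | 1 => c ^ 2 * L1 g ^ 2
  | (j + 2) => if j + 2 < k then c * jR * (9 ^ 6 * eR 2 (j + 2) g)
      else 2 * (κ * (4 * c ^ 2 * (jR + jR * jR)) * (9 ^ 6 * eR 2 k g))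
        + 32 * ((κ ^ 10)⁻¹ * (c * jR * (9 ^ 6 * eR 2 (k - 1) g)))

lemma ψ2_two (c κ : ℝ) (k : ℕ) (g : SP) (j : ℕ) : ψ2 c κ k g (j + 2) =
    if j + 2 < k then c * jR * (9 ^ 6 * eR 2 (j + 2) g)
      else 2 * (κ * (4 * c ^ 2 * (jR + jR * jR)) * (9 ^ 6 * eR 2 k g))
        + 32 * ((κ ^ 10)⁻¹ * (c * jR * (9 ^ 6 * eR 2 (k - 1) g))) := rfl

lemma ψ2_nonneg {c κ : ℝ} (hc : 0 ≤ c) (hκ : 0 ≤ κ) (k : ℕ) (g : SP) (j : ℕ) : 0 ≤ ψ2 c κ k g j := by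
  have := jR_nonneg
  match j with
  | 0 => unfold ψ2; positivity
  | 1 => unfold ψ2; positivity
  | (j + 2) =>
    rw [ψ2_two]
    have := fun j => eR_nonneg 2 j g
    have := this (j+2)
    have := eR_nonneg 2 k g
    have := eR_nonneg 2 (k-1) g
    split_ifs <;> positivity

lemma nine6 : ((3:ℝ≥0∞) ^ 2) ^ 6 = ENNReal.ofReal (9 ^ 6) := by
  rw [ENNReal.ofReal_pow (by norm_num)]
  norm_num

lemma PB2 {U : Fin 3 → E3 → ℝ} {c κ : ℝ} (hU : ∀ i, Ker (U i) c) (k0 : 0 < κ) (k1 : κ ≤ 1) {k : ℕ}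
    (hk : k ≤ 6) (g : SP) : PBR U k (ψ2 c κ k g) g := by
  have hc : 1 ≤ c := (hU 0).c1
  refine ⟨ψ2_nonneg (by linarith) k0.le k g, fun k => ENNReal.ofReal_ne_top, ?_⟩
  intro i S h z hS h0 h1
  match S with
  | [] => exact ENNReal.ofReal_le_ofReal (B0sq (hU i) g z)
  | [d] => exact ENNReal.ofReal_le_ofReal (D1sq (hU i) h0 d [] g z)
  | (d :: d' :: S) =>
    simp only [List.length_cons] at hS ⊢
    have p1 := jR_nonneg
    have p2 := eR_nonneg 2 (S.length + 2) g
    have p3 := eR_nonneg 2 (k - 1) g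
    have p4 := eR_nonneg 2 k g
    rw [show S.length + 1 + 1 = S.length + 2 from rfl, ψ2_two]
    split_ifs with hlt
    · refine ((hU i).D2 h _ g z).trans ?_
      have h2 := Qe_dlf_En 2 h0 h1 (m := S.length + 2) (l := 6) (d :: d' :: S) g (by simp) (by omega)
      refine (mul_le_mul' le_rfl h2).trans (le_of_eq ?_)
      rw [nine6, En_eq, JJ_eq, ← ENNReal.ofReal_mul (by positivity), ← ENNReal.ofReal_mul (by positivity),
        ← ENNReal.ofReal_mul (by positivity)]
    · refine ((hU i).D4 h0 d (d' :: S) g z k0 k1).trans ?_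
      have h2 := Qe_dlf_En 2 h0 h1 (m := k) (l := 6) (d :: d' :: S) g (by simp; omega) (by omega)
      have h3 := Qe_dlf_En 2 h0 h1 (m := k - 1) (l := 6) (d' :: S) g (by simp; omega) (by omega)
      rw [nine6, En_eq, ← ENNReal.ofReal_mul (by positivity)] at h2 h3
      rw [ENNReal.ofReal_add (by positivity) (by positivity)]
      refine add_le_add ?_ ?_
      · refine (mul_le_mul' le_rfl (mul_le_mul' le_rfl h2)).trans (le_of_eq ?_)
        rw [JJ_eq, ← ENNReal.ofReal_mul p1, ← ENNReal.ofReal_add p1 (by positivity), ← ENNReal.ofReal_mul (by positivity),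
          ← ENNReal.ofReal_mul (by positivity), ← ENNReal.ofReal_mul (by positivity),
          ENNReal.ofReal_mul (p := 2) (by norm_num)]
        norm_num
      · refine (mul_le_mul' le_rfl (mul_le_mul' le_rfl (mul_le_mul' le_rfl h3))).trans (le_of_eq ?_)
        rw [JJ_eq, ← ENNReal.ofReal_mul (by positivity), ← ENNReal.ofReal_mul (by positivity),
          ← ENNReal.ofReal_mul (by positivity), 
          ENNReal.ofReal_mul (p := 32) (by norm_num)]
        norm_num

lemma gron {f r : ℝ → ℝ} {a b A K H : ℝ} (hab : a ≤ b) (hf : ContinuousOn f (Set.Icc a b)) (hr : ContinuousOn r (Set.Icc a b))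
    (h : ∀ s t, a ≤ s → s ≤ t → t ≤ b → ∀ R, (∀ τ ∈ Set.Icc s t, r τ ≤ R) → f t - f s ≤ R * (t - s))
    (hA : 0 ≤ A) (hK : 0 ≤ K) (hH : 0 ≤ H) (hf0 : 0 ≤ f a)
    (hb : ∀ τ ∈ Set.Icc a b, r τ ≤ A * f τ + H * Real.exp (K * (τ - a))) :
    f b ≤ (f a + H) * Real.exp ((A + K + 1) * (b - a)) := by
  have main : ∀ ε : ℝ, 0 < ε → f b ≤ (f a + H + ε) * Real.exp ((A + K + 1) * (b - a)) := by
    intro ε hε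
    have hB' : ∀ x, HasDerivAt (fun x => (f a + H + ε) * Real.exp ((A + K + 1) * (x - a)))
        ((f a + H + ε) * (Real.exp ((A + K + 1) * (x - a)) * (A + K + 1))) x := by
      intro x
      have h1 : HasDerivAt (fun x => (A + K + 1) * (x - a)) (A + K + 1) x := by
        simpa using ((hasDerivAt_id x).sub_const a).const_mul (A + K + 1)
      exact h1.exp.const_mul _
    refine image_le_of_liminf_slope_right_lt_deriv_boundary (f := f) (f' := r) hf ?_ ?_ hB' ?_ ⟨hab, le_rfl⟩
    · intro x hx ρ hρ
      obtain ⟨ρ', h1, h2⟩ := exists_between hρ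
      have hc := hr x ⟨hx.1, hx.2.le⟩
      have hev : ∀ᶠ z in nhdsWithin x (Set.Icc a b), r z < ρ' := hc.eventually (gt_mem_nhds h1)
      rw [eventually_nhdsWithin_iff, Metric.eventually_nhds_iff] at hev
      obtain ⟨δ, hδ, hev⟩ := hev
      apply Filter.Eventually.frequently
      have : Set.Ioo x (min b (x + δ)) ∈ nhdsWithin x (Set.Ioi x) :=
        Ioo_mem_nhdsGT (lt_min hx.2 (by linarith))
      filter_upwards [this] with z hz
      have hz2 := lt_min_iff.1 hz.2
      have := h x z hx.1 hz.1.le hz2.1.le ρ' (fun τ hτ => by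
        refine (hev ?_ ⟨hx.1.trans hτ.1, hτ.2.trans hz2.1.le⟩).le
        rw [Real.dist_eq, abs_lt]; constructor <;> linarith [hτ.1, hτ.2, hz2.2])
      rw [slope_def_field, div_lt_iff₀ (by linarith [hz.1])]
      nlinarith [hz.1]
    · simp; linarith
    · intro x hx he
      have h1 := hb x ⟨hx.1, hx.2.le⟩
      rw [he] at h1
      refine h1.trans_lt ?_
      have h3 : Real.exp (K * (x - a)) ≤ Real.exp ((A + K + 1) * (x - a)) := by
        apply Real.exp_le_exp.2
        have := hx.1
        gcongr <;> linarith
      have h4 := Real.exp_pos ((A + K + 1) * (x - a))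
      set X := Real.exp ((A + K + 1) * (x - a))
      have h5 : H * Real.exp (K * (x - a)) ≤ H * X := by gcongr
      have h6 : 0 < ε * X := by positivity
      have h7 : 0 ≤ (f a + H + ε) * X * K := by positivity
      have h8 : 0 ≤ f a * X := by positivity
      nlinarith
  have hlim : Filter.Tendsto (fun ε : ℝ => (f a + H + ε) * Real.exp ((A + K + 1) * (b - a))) (nhdsWithin 0 (Set.Ioi 0))
      (nhds ((f a + H + 0) * Real.exp ((A + K + 1) * (b - a)))) := by
    refine Filter.Tendsto.mono_left ?_ nhdsWithin_le_nhds
    refine Continuous.tendsto ?_ 0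
    fun_prop
  rw [add_zero] at hlim
  exact ge_of_tendsto hlim (Filter.eventually_of_mem self_mem_nhdsWithin main)

lemma ψ4_le {c B : ℝ} (g : SP) (hB : eR 4 6 g ≤ B) {k : ℕ} (hk : k ≤ 7) : ψ4 c g k ≤ c ^ 2 * (jR ^ 2 * (81 ^ 6 * B)) := by
  have p1 := jR_nonneg
  have p2 := eR_nonneg 4 6 g
  have p3 : 0 ≤ B := p2.trans hB
  have hL : c ^ 2 * L1 g ^ 2 ≤ c ^ 2 * (jR ^ 2 * (81 ^ 6 * B)) := by
    have := L1_sq g 6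
    refine mul_le_mul_of_nonneg_left ?_ (sq_nonneg _)
    refine this.trans ?_
    gcongr
    linarith
  match k with
  | 0 => exact hL
  | 1 => exact hL
  | (j + 2) =>
    rw [ψ4_two]
    have := (eR_mono (a := 4) (show j + 1 ≤ 6 by omega) g).trans hB
    gcongr

lemma BdR4_le {c B : ℝ} (g : SP) (hB : eR 4 6 g ≤ B) {a l : ℕ} (ha : a ≤ 4) (hl : l ≤ 6) :
    BdR a l (ψ4 c g) g ≤ 7 * ((1 + c ^ 2 * (jR ^ 2 * (81 ^ 6 * B))) * B) := by
  have p1 := jR_nonneg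
  have p2 := eR_nonneg 4 6 g
  have p3 : 0 ≤ B := p2.trans hB
  have t : ∀ k m, k ≤ 7 → m ≤ 6 → (1 + ψ4 c g k) * eR a m g ≤ (1 + c ^ 2 * (jR ^ 2 * (81 ^ 6 * B))) * B := by
    intro k m hk hm
    have h1 := ψ4_le (c := c) g hB hk
    have h2 := (eR_mono (a := a) hm g).trans ((eR_mono_a ha g).trans hB)
    have h3 := eR_nonneg a m g
    gcongr
  unfold BdR
  have hX : 0 ≤ (1 + c ^ 2 * (jR ^ 2 * (81 ^ 6 * B))) * B := by positivity
  have hs : ∑ i ∈ Finset.range l, (1 + ψ4 c g (i + 1)) * eR a (l - i) g ≤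
      ∑ i ∈ Finset.range l, (1 + c ^ 2 * (jR ^ 2 * (81 ^ 6 * B))) * B := by
    refine Finset.sum_le_sum fun i hi => t _ _ ?_ ?_
    · have := Finset.mem_range.1 hi; omega
    · omega
  rw [Finset.sum_const, Finset.card_range, nsmul_eq_mul] at hs
  have hl' : (l : ℝ) ≤ 6 := by exact_mod_cast hl
  have := t 0 l (by omega) hl
  nlinarith

lemma st_cont {U : Fin 3 → E3 → ℝ} {c σ : ℝ} {W : ℝ → SP} (hW : Sol U c σ W) {s t B : ℝ}
    (hB : ∀ τ ∈ Set.Icc s t, eR 4 6 (W τ) ≤ B) {a l : ℕ} (ha : a ≤ 4) (hl1 : 1 ≤ l) (hl : l ≤ 6) :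
    ContinuousOn (fun τ => eR a l (W τ)) (Set.Icc s t) := by
  obtain ⟨C, hC1, hC⟩ := ENR a l hl1
  set R := C * (7 * ((1 + c ^ 2 * (jR ^ 2 * (81 ^ 6 * B))) * B)) with hR
  have key : ∀ s' ∈ Set.Icc s t, ∀ t' ∈ Set.Icc s t, s' ≤ t' → |eR a l (W t') - eR a l (W s')| ≤ R * (t' - s') := by
    intro s' hs' t' ht' hst
    refine hC hW hst (fun τ => ψ4 c (W τ)) (fun τ _ => (PB4 hW.ker (W τ)).mono (by omega)) R ?_
    intro τ hτ
    exact mul_le_mul_of_nonneg_left (BdR4_le _ (hB τ ⟨hs'.1.trans hτ.1, hτ.2.trans ht'.2⟩) ha hl) (by linarith)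
  refine (LipschitzOnWith.of_dist_le_mul (K := R.toNNReal) ?_).continuousOn
  intro x hx y hy
  have hRle : R ≤ (R.toNNReal : ℝ) := Real.le_coe_toNNReal R
  rw [Real.dist_eq, Real.dist_eq]
  rcases le_total x y with hxy | hxy
  · rw [abs_sub_comm, abs_sub_comm x, abs_of_nonneg (sub_nonneg.2 hxy)]
    exact (key x hx y hy hxy).trans (mul_le_mul_of_nonneg_right hRle (by linarith))
  · rw [abs_of_nonneg (sub_nonneg.2 hxy)]
    exact (key y hy x hx hxy).trans (mul_le_mul_of_nonneg_right hRle (by linarith))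

lemma st_L1 {U : Fin 3 → E3 → ℝ} {c σ : ℝ} {W : ℝ → SP} (hW : Sol U c σ W) {s t B : ℝ} 
    (hB : ∀ τ ∈ Set.Icc s t, eR 4 6 (W τ) ≤ B) : ∀ τ ∈ Set.Icc s t, L1 (W τ) = L1 (W s) := by
  intro τ hτ
  refine L1_consR hW hτ.1 (fun τ => ψ4 c (W τ)) (fun τ _ => (PB4 hW.ker (W τ)).mono (by omega)) 
    (7 * ((1 + c ^ 2 * (jR ^ 2 * (81 ^ 6 * B))) * B)) ?_
  intro τ' hτ'
  exact BdR4_le _ (hB τ' ⟨hτ'.1, hτ'.2.trans hτ.2⟩) le_rfl (by omega)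

lemma BdR4_struct {c : ℝ} (g : SP) {l : ℕ} (hl1 : 1 ≤ l) :
    BdR 4 l (ψ4 c g) g ≤ (l + 1) * ((1 + c ^ 2 * L1 g ^ 2) * eR 4 l g +
      (if l = 1 then 0 else (c ^ 2 * (jR ^ 2 * 81 ^ 6) * eR 4 (l - 1) g ^ 2))) := by
  have p1 := jR_nonneg
  have p := fun m => eR_nonneg 4 m g
  set E := (if l = 1 then 0 else (c ^ 2 * (jR ^ 2 * 81 ^ 6) * eR 4 (l - 1) g ^ 2)) with hE
  have hE0 : 0 ≤ E := by rw [hE]; have := p (l-1); split_ifs <;> positivity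
  have t : ∀ i < l, (1 + ψ4 c g (i + 1)) * eR 4 (l - i) g ≤ (1 + c ^ 2 * L1 g ^ 2) * eR 4 l g + E := by
    intro i hi
    match i with
    | 0 => 
      have : (1 + ψ4 c g (0 + 1)) * eR 4 (l - 0) g = (1 + c ^ 2 * L1 g ^ 2) * eR 4 l g := rfl
      linarith
    | (j + 1) =>
      rw [show j + 1 + 1 = j + 2 from rfl, ψ4_two]
      have hE' : E = c ^ 2 * (jR ^ 2 * 81 ^ 6) * eR 4 (l - 1) g ^ 2 := by rw [hE, if_neg (by omega)]
      have h1 : eR 4 (j + 1) g ≤ eR 4 (l - 1) g := eR_mono (by omega) g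
      have h2 : eR 4 (l - (j + 1)) g ≤ eR 4 (l - 1) g := eR_mono (by omega) g
      have h3 : eR 4 (l - (j + 1)) g ≤ eR 4 l g := eR_mono (by omega) g
      have h4 : eR 4 (j + 1) g * eR 4 (l - (j + 1)) g ≤ eR 4 (l - 1) g ^ 2 := by
        rw [sq]; exact mul_le_mul h1 h2 (p _) (p _)
      have h5 : 0 ≤ c ^ 2 * L1 g ^ 2 * eR 4 l g := mul_nonneg (by positivity) (p _)
      have h6 : c ^ 2 * (jR ^ 2 * 81 ^ 6) * (eR 4 (j + 1) g * eR 4 (l - (j + 1)) g) ≤ E := by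
        rw [hE']; gcongr
      nlinarith
  unfold BdR
  have hs := Finset.sum_le_sum (s := Finset.range l) fun i hi => t i (Finset.mem_range.1 hi)
  rw [Finset.sum_const, Finset.card_range, nsmul_eq_mul] at hs
  have : (1 + ψ4 c g 0) * eR 4 l g = (1 + c ^ 2 * L1 g ^ 2) * eR 4 l g := rfl
  rw [this]
  linarith

lemma H2l (c : ℝ) (l : ℕ) (hl1 : 1 ≤ l) (hl : l ≤ 6) : ∀ n T : ℝ, ∃ B : ℝ, ∀ {U : Fin 3 → E3 → ℝ} {σ : ℝ} {W : ℝ → SP},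
    Sol U c σ W → ∀ {s t : ℝ}, s ≤ t → t - s ≤ T → (∃ B', ∀ τ ∈ Set.Icc s t, eR 4 6 (W τ) ≤ B') → eR 4 6 (W s) ≤ n →
    eR 4 l (W t) ≤ B := by
  induction l, hl1 using Nat.le_induction with
  | base =>
    intro n T
    obtain ⟨C, hC1, hC⟩ := ENR 4 1 le_rfl
    refine ⟨(n + 0) * Real.exp ((C * (2 * (1 + c ^ 2 * (jR ^ 2 * n))) + 0 + 1) * T), ?_⟩
    intro U σ W hW s t hst hT ⟨B', hB'⟩ hn
    have hn0 : 0 ≤ n := (eR_nonneg _ _ _).trans hn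
    have hc := st_cont hW hB' (a := 4) (l := 1) le_rfl le_rfl (by omega)
    have hL := st_L1 hW hB'
    have hLs : L1 (W s) ^ 2 ≤ jR ^ 2 * n := (L1_sq (W s) 6).trans (by gcongr)
    have p := eR_nonneg 4 1 (W s)
    have g := gron (f := fun τ => eR 4 1 (W τ)) (r := fun τ => C * (2 * (1 + c ^ 2 * (jR ^ 2 * n))) * eR 4 1 (W τ))
      (A := C * (2 * (1 + c ^ 2 * (jR ^ 2 * n)))) (K := 0) (H := 0) hst hc (continuousOn_const.mul hc)
      (fun s' t' hs' hst' ht' R hR => by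
        refine (le_abs_self _).trans (hC hW hst' (fun τ => ψ4 c (W τ)) (fun τ _ => (PB4 hW.ker (W τ)).mono (by omega)) R ?_)
        intro τ hτ
        refine le_trans ?_ (hR τ hτ)
        have h1 := BdR4_struct (c := c) (W τ) (l := 1) le_rfl
        rw [if_pos rfl, hL τ ⟨hs'.trans hτ.1, hτ.2.trans ht'⟩] at h1
        rw [mul_assoc]
        refine mul_le_mul_of_nonneg_left (h1.trans ?_) (by linarith)
        have := eR_nonneg 4 1 (W τ)
        have : (1 + c ^ 2 * L1 (W s) ^ 2) * eR 4 1 (W τ) ≤ (1 + c ^ 2 * (jR ^ 2 * n)) * eR 4 1 (W τ) := by gcongr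
        push_cast
        linarith) (by positivity) le_rfl le_rfl p (fun τ _ => by simp)
    refine g.trans ?_
    have := (eR_mono (a := 4) (show 1 ≤ 6 by omega) (W s)).trans hn
    gcongr
  | succ l hl1 ih =>
    intro n T
    obtain ⟨B0, hB0⟩ := ih (by omega) n T
    obtain ⟨C, hC1, hC⟩ := ENR 4 (l + 1) (by omega)
    set A := C * ((l + 2) * (1 + c ^ 2 * (jR ^ 2 * n))) with hA
    set H := C * ((l + 2) * (c ^ 2 * (jR ^ 2 * 81 ^ 6) * B0 ^ 2)) with hH
    refine ⟨(n + H) * Real.exp ((A + 0 + 1) * T), ?_⟩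
    intro U σ W hW s t hst hT ⟨B', hB'⟩ hn
    have hn0 : 0 ≤ n := (eR_nonneg _ _ _).trans hn
    have hA0 : 0 ≤ A := by positivity
    have hH0 : 0 ≤ H := by positivity
    have hc := st_cont hW hB' (a := 4) (l := l + 1) le_rfl (by omega) (by omega)
    have hL := st_L1 hW hB'
    have hLs : L1 (W s) ^ 2 ≤ jR ^ 2 * n := (L1_sq (W s) 6).trans (by gcongr)
    have p := eR_nonneg 4 (l + 1) (W s)
    have g := gron (f := fun τ => eR 4 (l + 1) (W τ)) (r := fun τ => A * eR 4 (l + 1) (W τ) + H)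
      (A := A) (K := 0) (H := H) hst hc ((continuousOn_const.mul hc).add continuousOn_const)
      (fun s' t' hs' hst' ht' R hR => by
        refine (le_abs_self _).trans (hC hW hst' (fun τ => ψ4 c (W τ)) (fun τ _ => (PB4 hW.ker (W τ)).mono (by omega)) R ?_)
        intro τ hτ
        refine le_trans ?_ (hR τ hτ)
        have h1 := BdR4_struct (c := c) (W τ) (l := l + 1) (by omega)
        have hτ2 : τ ∈ Set.Icc s t := ⟨hs'.trans hτ.1, hτ.2.trans ht'⟩
        rw [if_neg (by omega), hL τ hτ2] at h1
        have hle : eR 4 l (W τ) ≤ B0 := hB0 hW hτ2.1 (by linarith [hτ2.2])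
          ⟨B', fun τ' hτ' => hB' τ' ⟨hτ'.1, hτ'.2.trans hτ2.2⟩⟩ hn
        have e : A * eR 4 (l + 1) (W τ) + H = C * ((l + 2) * ((1 + c ^ 2 * (jR ^ 2 * n)) * eR 4 (l + 1) (W τ) +
          c ^ 2 * (jR ^ 2 * 81 ^ 6) * B0 ^ 2)) := by rw [hA, hH]; ring
        rw [e]
        refine mul_le_mul_of_nonneg_left (h1.trans ?_) (by linarith)
        have p1 := eR_nonneg 4 (l + 1) (W τ)
        have p2 := eR_nonneg 4 l (W τ)
        have e2 : ((l + 1 : ℕ) : ℝ) + 1 = l + 2 := by push_cast; ring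
        rw [e2, Nat.add_sub_cancel]
        gcongr) hA0 le_rfl hH0 p (fun τ _ => by simp)
    refine g.trans ?_
    have := (eR_mono (a := 4) (show l + 1 ≤ 6 by omega) (W s)).trans hn
    gcongr

lemma Sol.refl {U : Fin 3 → E3 → ℝ} {c σ : ℝ} {W : ℝ → SP} (hW : Sol U c σ W) : Sol U c (-σ) (fun τ => W (-τ)) where
  sg := by rw [neg_sq]; exact hW.sg
  ker := hW.ker
  der := fun t z => by
    have h := (hW.der (-t) z).comp t (hasDerivAt_neg t)
    refine HasDerivAt.congr_deriv (f' := _) h ?_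
    ring
  con := fun z => (hW.con z).comp continuous_neg

lemma bdd_cpt {P : ℝ → ℝ} {S : Set ℝ} (hS : IsCompact S) (h : ∀ t ∈ S, ∃ ε > 0, ∃ B, ∀ τ, |τ - t| < ε → P τ ≤ B) :
    ∃ B, ∀ τ ∈ S, P τ ≤ B := by
  refine hS.induction_on (p := fun S => ∃ B, ∀ τ ∈ S, P τ ≤ B) ⟨0, by simp⟩ ?_ ?_ ?_
  · rintro s t hst ⟨B, hB⟩; exact ⟨B, fun τ hτ => hB τ (hst hτ)⟩
  · rintro s t ⟨B, hB⟩ ⟨B', hB'⟩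
    refine ⟨max B B', ?_⟩
    rintro τ (hτ | hτ)
    · exact (hB τ hτ).trans (le_max_left _ _)
    · exact (hB' τ hτ).trans (le_max_right _ _)
  · intro t ht
    obtain ⟨ε, hε, B, hB⟩ := h t ht
    exact ⟨Metric.ball t ε, mem_nhdsWithin_of_mem_nhds (Metric.ball_mem_nhds t hε), B, fun τ hτ => hB τ hτ⟩

lemma baire_bdd {P : ℝ → ℝ} (H1 : ∀ n : ℝ, ∃ n' : ℝ, ∀ t ∈ closure {t | P t ≤ n}, P t ≤ n')
    (H2 : ∀ n T : ℝ, ∃ B : ℝ, ∀ s t, |t - s| ≤ T → (∃ B', ∀ τ ∈ Set.uIcc s t, P τ ≤ B') → P s ≤ n → P t ≤ B) (a b : ℝ) :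
    ∃ B, ∀ τ ∈ Set.Icc a b, P τ ≤ B := by
  set G : Set ℝ := {t | ∃ ε > 0, ∃ B, ∀ τ, |τ - t| < ε → P τ ≤ B} with hG
  have hGo : IsOpen G := by
    rw [Metric.isOpen_iff]
    rintro t ⟨ε, hε, B, hB⟩
    refine ⟨ε / 2, by linarith, fun x hx => ⟨ε / 2, by linarith, B, fun τ hτ => hB τ ?_⟩⟩
    rw [Metric.mem_ball, Real.dist_eq] at hx
    have := abs_sub_le τ x t
    linarith
  suffices hK : Gᶜ = ∅ by
    refine bdd_cpt isCompact_Icc fun t _ => ?_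
    have : t ∈ G := by
      by_contra h
      have : t ∈ Gᶜ := h
      rw [hK] at this; exact this
    exact this
  by_contra hne
  have hne' : (Gᶜ).Nonempty := Set.nonempty_iff_ne_empty.2 hne
  have hKc : IsClosed Gᶜ := hGo.isClosed_compl
  have : Nonempty (Gᶜ : Set ℝ) := hne'.to_subtype
  have : CompleteSpace (Gᶜ : Set ℝ) := hKc.completeSpace_coe
  obtain ⟨m, hm⟩ := nonempty_interior_of_iUnion_of_closed (X := (Gᶜ : Set ℝ))
    (f := fun n : ℕ => Subtype.val ⁻¹' closure {t | P t ≤ n}) (fun n => isClosed_closure.preimage continuous_subtype_val)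
    (by
      rw [Set.eq_univ_iff_forall]; intro x
      obtain ⟨n, hn⟩ := exists_nat_ge (P x)
      exact Set.mem_iUnion.2 ⟨n, subset_closure hn⟩)
  obtain ⟨⟨t0, ht0⟩, hx⟩ := hm
  rw [mem_interior_iff_mem_nhds, Metric.mem_nhds_iff] at hx
  obtain ⟨ε, hε, hball⟩ := hx
  obtain ⟨n', hn'⟩ := H1 m
  have hKb : ∀ t ∈ Gᶜ, |t - t0| < ε → P t ≤ n' := by
    intro t ht htt
    exact hn' t (hball (show (⟨t, ht⟩ : (Gᶜ : Set ℝ)) ∈ Metric.ball _ _ from htt))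
  obtain ⟨B, hB⟩ := H2 n' ε
  apply ht0
  refine ⟨ε, hε, max n' B, ?_⟩
  intro t ht
  by_cases htK : t ∈ Gᶜ
  · exact (hKb t htK ht).trans (le_max_left _ _)
  refine le_trans ?_ (le_max_right _ _)
  have hcp : IsCompact (Gᶜ ∩ Set.uIcc t0 t) := isCompact_uIcc.inter_left hKc
  obtain ⟨a, ⟨haK, ha⟩, hmin⟩ := hcp.exists_isMinOn ⟨t0, ht0, Set.left_mem_uIcc⟩
    (f := fun x => |x - t|) (by fun_prop)
  have hgap : ∀ τ ∈ Set.uIcc a t, τ ≠ a → τ ∈ G := by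
    intro τ hτ hne
    by_contra hτG
    have h1 : τ ∈ Set.uIcc t0 t := Set.uIcc_subset_uIcc ha Set.right_mem_uIcc hτ
    have h2 := hmin ⟨hτG, h1⟩
    simp only [Set.mem_ofPred_eq] at h2
    rcases Set.mem_uIcc.1 hτ with h | h
    · rw [abs_of_nonpos (by linarith), abs_of_nonpos (by linarith)] at h2
      exact hne (by linarith)
    · rw [abs_of_nonneg (by linarith), abs_of_nonneg (by linarith)] at h2
      exact hne (by linarith)
  have hat : |t - a| ≤ |t - t0| := by
    rcases Set.mem_uIcc.1 ha with h | h
    · rw [abs_of_nonneg (by linarith), abs_of_nonneg (by linarith)]; linarith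
    · rw [abs_of_nonpos (by linarith), abs_of_nonpos (by linarith)]; linarith
  have hat0 : |a - t0| ≤ |t - t0| := by
    rcases Set.mem_uIcc.1 ha with h | h
    · rw [abs_of_nonneg (by linarith), abs_of_nonneg (by linarith)]; linarith
    · rw [abs_of_nonpos (by linarith), abs_of_nonpos (by linarith)]; linarith
  refine hB a t (by linarith) ?_ (hKb a haK (by linarith))
  obtain ⟨B2, hB2⟩ := H2 (P t) ε
  refine ⟨max (P a) B2, fun τ hτ => ?_⟩
  by_cases hτa : τ = a
  · rw [hτa]; exact le_max_left _ _
  refine le_trans ?_ (le_max_right _ _)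
  have hτt : |τ - t| ≤ |t - a| := by
    rcases Set.mem_uIcc.1 hτ with h | h
    · rw [abs_of_nonpos (by linarith), abs_of_nonneg (by linarith)]; linarith
    · rw [abs_of_nonneg (by linarith), abs_of_nonpos (by linarith)]; linarith
  refine hB2 t τ (by linarith) ?_ le_rfl
  refine bdd_cpt isCompact_uIcc fun x hx => ?_
  have hxu : x ∈ Set.uIcc a t := Set.uIcc_subset_uIcc Set.right_mem_uIcc hτ hx
  refine hgap x hxu ?_
  rintro rfl
  rcases Set.mem_uIcc.1 hτ with h | h <;> rcases Set.mem_uIcc.1 hx with h' | h'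
  · exact hτa (by linarith)
  · exact hτa (by linarith)
  · exact hτa (by linarith)
  · exact hτa (by linarith)

lemma H1c {W : ℝ → SP} (hW : ∀ z, Continuous fun t => W t z) (n : ℝ) :
    ∀ t ∈ closure {t | eR 4 6 (W t) ≤ n}, eR 4 6 (W t) ≤ 81 ^ 6 * n := by
  intro t ht
  obtain ⟨u, hu, hut⟩ := mem_closure_iff_seq_limit.1 ht
  have hn0 : 0 ≤ n := (eR_nonneg _ _ _).trans (hu 0)
  have key : En 4 6 (W t) ≤ ENNReal.ofReal (81 ^ 6 * n) := by
    refine iSup₂_le fun L hL => ?_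
    refine Qe_plS_le 4 L (W t) (c := fun _ => ENNReal.ofReal (81 ^ 6 * n)) tendsto_const_nhds fun m => ?_
    refine (Qe_fatou 4 (g := fun k => dlf (hn m) L (W (u k))) (fun k => dlf_meas (W (u k)).continuous.measurable) ?_).trans ?_
    · intro z
      exact ((dlf_cont_t (hn m) L (f := fun r => W r) hW z).tendsto t).comp hut
    · refine Filter.liminf_le_of_le (by isBoundedDefault) fun b hb => ?_
      obtain ⟨k, hk⟩ := hb.exists
      refine hk.trans ?_
      refine (Qe_dlf_En 4 (hn_pos m) (hn_le m) (m := 6) (l := 6) L _ hL le_rfl).trans ?_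
      rw [En_eq, ENNReal.ofReal_mul (by positivity)]
      refine mul_le_mul' (le_of_eq ?_) (ENNReal.ofReal_le_ofReal (hu k))
      rw [ENNReal.ofReal_pow (by norm_num)]
      norm_num
  rwa [En_eq, ENNReal.ofReal_le_ofReal_iff (by positivity)] at key

theorem loc_bdd {U : Fin 3 → E3 → ℝ} {c σ : ℝ} {W : ℝ → SP} (hW : Sol U c σ W) (a b : ℝ) :
    ∃ B, ∀ τ ∈ Set.Icc a b, eR 4 6 (W τ) ≤ B := by
  have hWc : ∀ z, Continuous fun τ => W τ z := fun z =>
    continuous_iff_continuousAt.mpr fun τ => (hW.der τ z).continuousAt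
  refine baire_bdd (fun n => ⟨_, H1c hWc n⟩) ?_ a b
  intro n T
  obtain ⟨B, hB⟩ := H2l c 6 (by omega) le_rfl n T
  refine ⟨B, fun s t hT ⟨B', hB'⟩ hn => ?_⟩
  rcases le_total s t with h | h
  · rw [Set.uIcc_of_le h] at hB'
    rw [abs_of_nonneg (by linarith)] at hT
    exact hB hW h hT ⟨B', hB'⟩ hn
  · rw [Set.uIcc_of_ge h] at hB'
    rw [abs_of_nonpos (by linarith)] at hT
    have := hB hW.refl (s := -s) (t := -t) (by linarith) (by linarith) ⟨B', fun τ hτ => hB' _ ⟨by linarith [hτ.2], by linarith [hτ.1]⟩⟩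
      (by simpa using hn)
    simpa using this

def th (j : Fin 6) (z : P6) : ℝ := 2 * (dw j z * (wt z)⁻¹)

lemma th_meas (j : Fin 6) : Measurable (th j) := by
  have hw := wt_cont.measurable
  have hdw := (dw_cont j).measurable
  unfold th; fun_prop

lemma th_le (j : Fin 6) (z : P6) : |th j z| ≤ 2 := by
  unfold th
  have hwp := wt_pos z
  rw [abs_mul, abs_mul, abs_inv, abs_of_pos hwp, abs_two]
  have : |dw j z| * (wt z)⁻¹ ≤ 1 := by
    rw [← div_eq_mul_inv, div_le_one hwp]; exact dw_le j z
  linarith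

lemma ibp2 (u : SP) (j : Fin 6) : ∫ z, wt z ^ 2 * (dS j u z) ^ 2 =
    - ∫ z, (wt z * (dS j (dS j u) z + th j z * dS j u z)) * (wt z * u z) := by
  have hum : Measurable u := u.continuous.measurable
  have hdm : Measurable (dS j u) := (dS j u).continuous.measurable
  have hd2m : Measurable (dS j (dS j u)) := (dS j (dS j u)).continuous.measurable
  have htm := th_meas j
  have key := integral_bilinear_hasLineDerivAt_right_eq_neg_left_of_integrable (μ := (volume : Measure P6))
    (f := fun z => wt z ^ 2 * dS j u z) (f' := fun z => (2 * wt z * dw j z) * dS j u z + wt z ^ 2 * dS j (dS j u) z)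
    (g := fun z => u z) (g' := fun z => dS j u z) (v := dir6 j)
    (B := ContinuousLinearMap.mul ℝ ℝ) ?_ ?_ ?_ ?_ ?_
  · simp only [ContinuousLinearMap.mul_apply'] at key
    have e1 : (fun z => wt z ^ 2 * (dS j u z) ^ 2) = fun z => wt z ^ 2 * dS j u z * dS j u z := by
      funext z; ring
    rw [e1, key]
    congr 2
    funext z
    have hwp := wt_pos z
    unfold th
    field_simp
    ring
  · have i1 := (intQ 2 hdm hum (Qe_lt_top 2 (dS j u)) (Qe_lt_top 2 u)).bdd_mul (c := 2)
      (f := th j) htm.aestronglyMeasurable (Filter.Eventually.of_forall (th_le j))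
    have i2 := intQ 2 hd2m hum (Qe_lt_top 2 (dS j (dS j u))) (Qe_lt_top 2 u)
    refine (i1.add i2).congr (Filter.Eventually.of_forall fun z => ?_)
    have hwp := wt_pos z
    simp only [ContinuousLinearMap.mul_apply', Pi.add_apply]
    unfold th
    field_simp
  · refine (intQ 2 hdm hdm (Qe_lt_top 2 (dS j u)) (Qe_lt_top 2 (dS j u))).congr (Filter.Eventually.of_forall fun z => ?_)
    simp only [ContinuousLinearMap.mul_apply']; ring
  · refine (intQ 2 hdm hum (Qe_lt_top 2 (dS j u)) (Qe_lt_top 2 u)).congr (Filter.Eventually.of_forall fun z => ?_)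
    simp only [ContinuousLinearMap.mul_apply']; ring
  · intro z _
    unfold HasLineDerivAt
    have h1 := (wt_line j z 0).pow 2
    have h2 := h1.mul (S_hasDeriv_line (dS j u) j z 0)
    refine HasDerivAt.congr_deriv (f' := _) h2 ?_
    simp
  · intro z _
    have h1 := S_hasDeriv_line u j z 0
    unfold HasLineDerivAt
    refine HasDerivAt.congr_deriv (f' := _) h1 ?_
    simp

lemma interp0 (u : SP) (j : Fin 6) : Qe 2 (dS j u) ^ 2 ≤ (2 * Qe 2 (dS j (dS j u)) + 8 * Qe 2 (dS j u)) * Qe 2 u := by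
  have hw := wt_cont.measurable
  have hum : Measurable u := u.continuous.measurable
  have hdm : Measurable (dS j u) := (dS j u).continuous.measurable
  have hd2m : Measurable (dS j (dS j u)) := (dS j (dS j u)).continuous.measurable
  have htm := th_meas j
  have h := cs_int (f := fun z => wt z * (dS j (dS j u) z + th j z * dS j u z)) (g := fun z => wt z * u z)
    (by fun_prop) (by fun_prop)
  have hnn : 0 ≤ ∫ z, wt z ^ 2 * (dS j u z) ^ 2 := integral_nonneg fun z => by positivity
  rw [Qe_eq 2 hdm (Qe_lt_top 2 _)] 
  rw [← ENNReal.ofReal_pow hnn]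
  have e := ibp2 u j
  rw [← Qe_eq 2 hdm (Qe_lt_top 2 _), e, neg_sq]
  refine h.trans ?_
  refine mul_le_mul' ?_ (le_of_eq ?_)
  · unfold Qe
    rw [← lintegral_const_mul' _ _ (by norm_num), ← lintegral_const_mul' _ _ (by norm_num), ← lintegral_add_left (by fun_prop)]
    refine lintegral_mono fun z => ?_
    have hwp := wt_pos z
    have e2 : ∀ x : ℝ, (2 : ℝ≥0∞) * ENNReal.ofReal x = ENNReal.ofReal (2 * x) := fun x => by
      rw [ENNReal.ofReal_mul (by norm_num)]; norm_num
    have e8 : ∀ x : ℝ, (8 : ℝ≥0∞) * ENNReal.ofReal x = ENNReal.ofReal (8 * x) := fun x => by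
      rw [ENNReal.ofReal_mul (by norm_num)]; norm_num
    rw [e2, e8, ← ENNReal.ofReal_add (by positivity) (by positivity)]
    apply ENNReal.ofReal_le_ofReal
    have ht := th_le j z
    have ht2 : th j z ^ 2 ≤ 4 := by rw [← sq_abs]; nlinarith [abs_nonneg (th j z)]
    have h1 : (dS j (dS j u) z + th j z * dS j u z) ^ 2 ≤ 2 * dS j (dS j u) z ^ 2 + 8 * dS j u z ^ 2 := by
      have : th j z ^ 2 * dS j u z ^ 2 ≤ 4 * dS j u z ^ 2 := by gcongr
      nlinarith [sq_nonneg (dS j (dS j u) z - th j z * dS j u z)]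
    rw [mul_pow]
    nlinarith [mul_le_mul_of_nonneg_left h1 (sq_nonneg (wt z))]
  · unfold Qe
    refine lintegral_congr fun z => ?_
    rw [mul_pow]

lemma interp (l : ℕ) (g : SP) : eR 2 (l + 1) g ^ 2 ≤ 10 * (eR 2 l g * eR 2 (l + 2) g) := by
  have p0 := eR_nonneg 2 l g
  have p1 := eR_nonneg 2 (l + 1) g
  have p2 := eR_nonneg 2 (l + 2) g
  have m1 : eR 2 l g ≤ eR 2 (l + 2) g := eR_mono (by omega) g
  have key : ∀ L : List (Fin 6), L.length ≤ l + 1 → Qe 2 (plS L g) ^ 2 ≤ ENNReal.ofReal (10 * (eR 2 l g * eR 2 (l + 2) g)) := by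
    intro L hL
    match L with
    | [] =>
      have h1 : Qe 2 (plS [] g) ≤ ENNReal.ofReal (eR 2 l g) := by rw [← En_eq]; exact le_En (by simp) g
      calc _ ≤ ENNReal.ofReal (eR 2 l g) ^ 2 := by gcongr
        _ = ENNReal.ofReal (eR 2 l g ^ 2) := by rw [ENNReal.ofReal_pow p0]
        _ ≤ _ := by apply ENNReal.ofReal_le_ofReal; nlinarith
    | (i :: L) =>
      simp only [List.length_cons] at hL
      have h1 : Qe 2 (plS L g) ≤ ENNReal.ofReal (eR 2 l g) := by rw [← En_eq]; exact le_En (by omega) g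
      have h2 : Qe 2 (dS i (plS L g)) ≤ ENNReal.ofReal (eR 2 (l + 2) g) := by
        rw [← En_eq, ← plS_dS]; exact le_En (L := i :: L) (by simp; omega) g
      have h3 : Qe 2 (dS i (dS i (plS L g))) ≤ ENNReal.ofReal (eR 2 (l + 2) g) := by
        rw [← En_eq, ← plS_dS, ← plS_dS]; exact le_En (L := i :: i :: L) (by simp; omega) g
      show Qe 2 (plS L (dS i g)) ^ 2 ≤ _
      rw [plS_dS]
      refine (interp0 _ i).trans ((mul_le_mul' (add_le_add (mul_le_mul' le_rfl h3) (mul_le_mul' le_rfl h2)) h1).trans (le_of_eq ?_))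
      rw [← add_mul, ENNReal.ofReal_mul (by norm_num), ENNReal.ofReal_mul p0]
      norm_num
      ring
  have h1 : En 2 (l + 1) g ≤ ENNReal.ofReal (Real.sqrt (10 * (eR 2 l g * eR 2 (l + 2) g))) := by
    refine iSup₂_le fun L hL => ?_
    have := key L hL
    rw [← Real.sq_sqrt (show 0 ≤ 10 * (eR 2 l g * eR 2 (l + 2) g) by positivity), ENNReal.ofReal_pow (Real.sqrt_nonneg _)] at this
    exact (ENNReal.pow_le_pow_left_iff two_ne_zero).1 this
  rw [En_eq, ENNReal.ofReal_le_ofReal_iff (Real.sqrt_nonneg _)] at h1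
  rw [← Real.sq_sqrt (show 0 ≤ 10 * (eR 2 l g * eR 2 (l + 2) g) by positivity)]
  gcongr

lemma interp34 (g : SP) : eR 2 3 g * eR 2 4 g ≤ 100 * (eR 2 2 g * eR 2 5 g) := by
  have h1 := interp 2 g
  have h2 := interp 3 g
  have p2 := eR_nonneg 2 2 g
  have p3 := eR_nonneg 2 3 g
  have p4 := eR_nonneg 2 4 g
  have p5 := eR_nonneg 2 5 g
  norm_num at h1 h2
  rcases (mul_nonneg p3 p4).eq_or_lt with h | h
  · rw [← h]; positivity
  · refine le_of_mul_le_mul_right ?_ h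
    calc eR 2 3 g * eR 2 4 g * (eR 2 3 g * eR 2 4 g) = eR 2 3 g ^ 2 * eR 2 4 g ^ 2 := by ring
      _ ≤ (10 * (eR 2 2 g * eR 2 4 g)) * (10 * (eR 2 3 g * eR 2 5 g)) := by gcongr
      _ = _ := by ring

lemma mid (g : SP) {j k : ℕ} (hj : 2 ≤ j) (hjk : j < k) (hk : k ≤ 6) :
    eR 2 j g * eR 2 (k + 1 - j) g ≤ 100 * (eR 2 (min 2 (k - 1)) g * eR 2 (k - 1) g) := by
  have p2 := eR_nonneg 2 2 g
  have p3 := eR_nonneg 2 3 g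
  have p4 := eR_nonneg 2 4 g
  have p5 := eR_nonneg 2 5 g
  have h1 := interp 2 g
  have h2 := interp34 g
  have q3 := mul_nonneg p2 p3
  have q4 := mul_nonneg p2 p4
  have q5 := mul_nonneg p2 p5
  have q2 := mul_nonneg p2 p2
  norm_num at h1
  interval_cases k <;> interval_cases j <;> norm_num <;> nlinarith

lemma BdR2_term {c κ : ℝ} (hc : 1 ≤ c) (k0 : 0 < κ) (g : SP) {k : ℕ} (hk : k ≤ 6) (hκ : κ * eR 2 1 g ≤ 1) {i : ℕ} (hi : i < k) :
    (1 + ψ2 c κ k g (i + 1)) * eR 2 (k - i) g ≤ (1 + c ^ 2 * L1 g ^ 2 + 8 * c ^ 2 * (jR + jR * jR) * 9 ^ 6) * eR 2 k g +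
      c * jR * 9 ^ 6 * (100 * eR 2 (min 2 (k - 1)) g + 32 * ((κ ^ 10)⁻¹ * eR 2 1 g)) * eR 2 (k - 1) g := by
  have J0 := jR_nonneg
  have pk := eR_nonneg 2 k g
  have pk1 := eR_nonneg 2 (k - 1) g
  have pm := eR_nonneg 2 (min 2 (k - 1)) g
  have p1 := eR_nonneg 2 1 g
  have hX : 0 ≤ 8 * c ^ 2 * (jR + jR * jR) * 9 ^ 6 := by positivity
  have hXe : 0 ≤ 8 * c ^ 2 * (jR + jR * jR) * 9 ^ 6 * eR 2 k g := by positivity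
  have hLe : 0 ≤ c ^ 2 * L1 g ^ 2 * eR 2 k g := by positivity
  have hY1 : 0 ≤ c * jR * 9 ^ 6 * (100 * eR 2 (min 2 (k - 1)) g) * eR 2 (k - 1) g := by positivity
  have hY2 : 0 ≤ c * jR * 9 ^ 6 * (32 * ((κ ^ 10)⁻¹ * eR 2 1 g)) * eR 2 (k - 1) g := by positivity
  match i with
  | 0 =>
    have : (1 + ψ2 c κ k g (0 + 1)) * eR 2 (k - 0) g = (1 + c ^ 2 * L1 g ^ 2) * eR 2 k g := rfl
    rw [this]; linarith
  | (j + 1) =>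
    rw [show j + 1 + 1 = j + 2 from rfl, ψ2_two]
    have hle : eR 2 (k - (j + 1)) g ≤ eR 2 k g := eR_mono (by omega) g
    split_ifs with hlt
    · have hm := mid g (j := j + 2) (by omega) hlt hk
      rw [show k + 1 - (j + 2) = k - (j + 1) by omega] at hm
      have := mul_le_mul_of_nonneg_left hm (show 0 ≤ c * jR * 9 ^ 6 by positivity)
      linarith
    · have e : k - (j + 1) = 1 := by omega
      rw [e] at hle ⊢
      have := mul_le_mul_of_nonneg_left hκ hXe
      linarith

lemma BdR2_struct {c κ : ℝ} (hc : 1 ≤ c) (k0 : 0 < κ) (g : SP) {k : ℕ} (hk : k ≤ 6) (hκ : κ * eR 2 1 g ≤ 1) :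
    BdR 2 k (ψ2 c κ k g) g ≤ (k + 1) * ((1 + c ^ 2 * L1 g ^ 2 + 8 * c ^ 2 * (jR + jR * jR) * 9 ^ 6) * eR 2 k g +
      c * jR * 9 ^ 6 * (100 * eR 2 (min 2 (k - 1)) g + 32 * ((κ ^ 10)⁻¹ * eR 2 1 g)) * eR 2 (k - 1) g) := by
  have J0 := jR_nonneg
  have pk := eR_nonneg 2 k g
  have pk1 := eR_nonneg 2 (k - 1) g
  have pm := eR_nonneg 2 (min 2 (k - 1)) g
  have p1 := eR_nonneg 2 1 g
  have hXe : 0 ≤ 8 * c ^ 2 * (jR + jR * jR) * 9 ^ 6 * eR 2 k g := by positivity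
  have hY : 0 ≤ c * jR * 9 ^ 6 * (100 * eR 2 (min 2 (k - 1)) g + 32 * ((κ ^ 10)⁻¹ * eR 2 1 g)) * eR 2 (k - 1) g := by positivity
  have hs := Finset.sum_le_sum (s := Finset.range k) fun i hi => BdR2_term hc k0 g hk hκ (Finset.mem_range.1 hi)
  rw [Finset.sum_const, Finset.card_range, nsmul_eq_mul] at hs
  unfold BdR
  have : (1 + ψ2 c κ k g 0) * eR 2 k g = (1 + c ^ 2 * L1 g ^ 2) * eR 2 k g := rfl
  rw [this]
  linarith

lemma fin_const {x y t e e0 : ℝ} (hx : 0 ≤ x) (hy : 0 ≤ y) (ht : 0 ≤ t) (he : 0 ≤ e0) (h : e ≤ x * Real.exp (y * t) * e0) :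
    e ≤ (x + y) * Real.exp ((x + y) * t) * e0 := by
  refine h.trans ?_
  gcongr <;> linarith

set_option maxHeartbeats 1000000 in
theorem st3 (c D : ℝ) (hc : 1 ≤ c) (hD : 0 ≤ D) (k : ℕ) (hk1 : 1 ≤ k) (hk : k ≤ 6) : ∃ C : ℝ, 0 ≤ C ∧
    ∀ {U : Fin 3 → E3 → ℝ} {σ : ℝ} {W : ℝ → SP}, Sol U c σ W → eR 4 2 (W 0) ≤ D → ∀ t : ℝ, 0 ≤ t →
    eR 2 k (W t) ≤ C * Real.exp (C * t) * eR 2 k (W 0) := by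
  induction k using Nat.strong_induction_on with
  | _ k ih =>
  have J0 := jR_nonneg
  rcases hk1.eq_or_lt with rfl | hk2
  · obtain ⟨C, hC1, hC⟩ := ENR 2 1 le_rfl
    set A := C * (2 * (1 + c ^ 2 * (jR ^ 2 * D))) with hA
    have hA0 : 0 ≤ A := by positivity
    refine ⟨1 + (A + 0 + 1), by positivity, ?_⟩
    intro U σ W hW h0 t ht
    obtain ⟨B', hB'⟩ := loc_bdd hW 0 t
    have hcn := st_cont hW hB' (a := 2) (l := 1) (by omega) le_rfl (by omega)
    have hL := st_L1 hW hB'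
    have hLs : L1 (W 0) ^ 2 ≤ jR ^ 2 * D := (L1_sq (W 0) 2).trans (by gcongr)
    have p := eR_nonneg 2 1 (W 0)
    have g := gron (f := fun τ => eR 2 1 (W τ)) (r := fun τ => A * eR 2 1 (W τ))
      (A := A) (K := 0) (H := 0) ht hcn (continuousOn_const.mul hcn)
      (fun s' t' hs' hst' ht' R hR => by
        refine (le_abs_self _).trans (hC hW hst' (fun τ => ψ4 c (W τ)) (fun τ _ => (PB4 hW.ker (W τ)).mono (by omega)) R ?_)
        intro τ hτ
        refine le_trans ?_ (hR τ hτ)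
        have h1 : BdR 2 1 (ψ4 c (W τ)) (W τ) = 2 * ((1 + c ^ 2 * L1 (W τ) ^ 2) * eR 2 1 (W τ)) := by
          unfold BdR
          rw [Finset.sum_range_one]
          have e0 : ψ4 c (W τ) 0 = c ^ 2 * L1 (W τ) ^ 2 := rfl
          have e1 : ψ4 c (W τ) (0 + 1) = c ^ 2 * L1 (W τ) ^ 2 := rfl
          rw [e0, e1]; simp only [Nat.sub_zero]; ring
        rw [h1, hL τ ⟨hs'.trans hτ.1, hτ.2.trans ht'⟩, hA, mul_assoc, mul_assoc]
        have := eR_nonneg 2 1 (W τ)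
        gcongr) hA0 le_rfl le_rfl p (fun τ _ => by simp)
    simp only [sub_zero] at g
    refine fin_const zero_le_one (by positivity) ht p (g.trans (le_of_eq ?_))
    ring
  · obtain ⟨C1, hC1, b1⟩ := ih 1 hk2 le_rfl (by omega)
    obtain ⟨Cm, hCm, bm⟩ := ih (min 2 (k - 1)) (by omega) (by omega) (by omega)
    obtain ⟨Cp, hCp, bp⟩ := ih (k - 1) (by omega) (by omega) (by omega)
    obtain ⟨C, hC0, hC⟩ := ENR 2 k hk1
    set X := 1 + c ^ 2 * (jR ^ 2 * D) + 8 * c ^ 2 * (jR + jR * jR) * 9 ^ 6 with hX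
    set Z := c * jR * 9 ^ 6 * (100 * (Cm * D) + 32 * (1 + C1 * D) ^ 11) * Cp with hZ
    set K := Cm + Cp + 11 * C1 with hK
    set A := C * ((k + 1) * X) with hA
    have hX0 : 0 ≤ X := by positivity
    have hZ0 : 0 ≤ Z := by positivity
    have hK0 : 0 ≤ K := by positivity
    have hA0 : 0 ≤ A := by positivity
    refine ⟨(1 + C * ((k + 1) * Z)) + (A + K + 1), by positivity, ?_⟩
    intro U σ W hW h0 t ht
    obtain ⟨B', hB'⟩ := loc_bdd hW 0 t
    have hcn := st_cont hW hB' (a := 2) (l := k) (by omega) hk1 hk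
    have hL := st_L1 hW hB'
    have hLs : L1 (W 0) ^ 2 ≤ jR ^ 2 * D := (L1_sq (W 0) 2).trans (by gcongr)
    have p := eR_nonneg 2 k (W 0)
    have h20 : eR 2 2 (W 0) ≤ D := (eR_mono_a (by omega) _).trans h0
    have h10 : eR 2 1 (W 0) ≤ D := (eR_mono (by omega) _).trans h20
    have hm0 : eR 2 (min 2 (k - 1)) (W 0) ≤ D := (eR_mono (by omega) _).trans h20
    have hp0 : eR 2 (k - 1) (W 0) ≤ eR 2 k (W 0) := eR_mono (by omega) _
    set κ : ℝ → ℝ := fun τ => (Real.exp (C1 * τ) * (1 + C1 * D))⁻¹ with hκ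
    have g := gron (f := fun τ => eR 2 k (W τ)) (r := fun τ => A * eR 2 k (W τ) + C * ((k + 1) * Z) * eR 2 k (W 0) * Real.exp (K * (τ - 0)))
      (A := A) (K := K) (H := C * ((k + 1) * Z) * eR 2 k (W 0)) ht hcn ((continuousOn_const.mul hcn).add (by fun_prop))
      (fun s' t' hs' hst' ht' R hR => by
        have hκ0 : ∀ τ, 0 < κ τ := fun τ => by rw [hκ]; positivity
        have hκ1 : ∀ τ, 0 ≤ τ → κ τ ≤ 1 := fun τ hτ => by
          rw [hκ]
          refine inv_le_one_of_one_le₀ (one_le_mul_of_one_le_of_one_le (Real.one_le_exp (by positivity)) ?_)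
          have : 0 ≤ C1 * D := by positivity
          linarith
        refine (le_abs_self _).trans (hC hW hst' (fun τ => ψ2 c (κ τ) k (W τ)) (fun τ hτ => PB2 hW.ker (hκ0 τ) (hκ1 τ (hs'.trans hτ.1)) hk (W τ)) R ?_)
        intro τ hτ
        refine le_trans ?_ (hR τ hτ)
        have hτ0 : 0 ≤ τ := hs'.trans hτ.1
        have q1 : eR 2 1 (W τ) ≤ C1 * Real.exp (C1 * τ) * D := (b1 hW h0 τ hτ0).trans (by gcongr)
        have qm : eR 2 (min 2 (k - 1)) (W τ) ≤ Cm * Real.exp (Cm * τ) * D := (bm hW h0 τ hτ0).trans (by gcongr)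
        have qp : eR 2 (k - 1) (W τ) ≤ Cp * Real.exp (Cp * τ) * eR 2 k (W 0) := (bp hW h0 τ hτ0).trans (by gcongr)
        have p1 := eR_nonneg 2 1 (W τ)
        have pk := eR_nonneg 2 k (W τ)
        have pm := eR_nonneg 2 (min 2 (k - 1)) (W τ)
        have pp := eR_nonneg 2 (k - 1) (W τ)
        have q1' : eR 2 1 (W τ) ≤ Real.exp (C1 * τ) * (1 + C1 * D) := by
          have := Real.exp_pos (C1 * τ); linarith
        have hκe : κ τ * eR 2 1 (W τ) ≤ 1 := by
          rw [hκ]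
          rw [inv_mul_le_iff₀ (by positivity), mul_one]; exact q1'
        have h1 := BdR2_struct hc (hκ0 τ) (W τ) hk hκe
        rw [hL τ ⟨hτ0, hτ.2.trans ht'⟩] at h1
        have hκ11 : ((κ τ) ^ 10)⁻¹ * eR 2 1 (W τ) ≤ Real.exp (11 * C1 * τ) * (1 + C1 * D) ^ 11 := by
          have : ((κ τ) ^ 10)⁻¹ = (Real.exp (C1 * τ) * (1 + C1 * D)) ^ 10 := by
            rw [hκ]; rw [inv_pow, inv_inv]
          rw [this]
          calc _ ≤ (Real.exp (C1 * τ) * (1 + C1 * D)) ^ 10 * (Real.exp (C1 * τ) * (1 + C1 * D)) := by gcongr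
            _ = Real.exp (C1 * τ) ^ 11 * (1 + C1 * D) ^ 11 := by ring
            _ = _ := by rw [← Real.exp_nat_mul]; push_cast; ring_nf
        have hexpm : Real.exp (Cm * τ) * Real.exp (Cp * τ) ≤ Real.exp (K * τ) := by
          rw [← Real.exp_add]; apply Real.exp_le_exp.2
          have : 0 ≤ 11 * C1 * τ := by positivity
          rw [hK]; linarith
        have hexp1 : Real.exp (11 * C1 * τ) * Real.exp (Cp * τ) ≤ Real.exp (K * τ) := by
          rw [← Real.exp_add]; apply Real.exp_le_exp.2
          have : 0 ≤ Cm * τ := by positivity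
          rw [hK]; linarith
        have hY : c * jR * 9 ^ 6 * (100 * eR 2 (min 2 (k - 1)) (W τ) + 32 * ((κ τ ^ 10)⁻¹ * eR 2 1 (W τ))) * eR 2 (k - 1) (W τ) ≤
            Z * eR 2 k (W 0) * Real.exp (K * τ) := by
          calc _ ≤ c * jR * 9 ^ 6 * (100 * (Cm * Real.exp (Cm * τ) * D) + 32 * (Real.exp (11 * C1 * τ) * (1 + C1 * D) ^ 11)) *
                (Cp * Real.exp (Cp * τ) * eR 2 k (W 0)) := by gcongr
            _ = c * jR * 9 ^ 6 * (100 * (Cm * D) * (Real.exp (Cm * τ) * Real.exp (Cp * τ)) +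
                 32 * (1 + C1 * D) ^ 11 * (Real.exp (11 * C1 * τ) * Real.exp (Cp * τ))) * Cp * eR 2 k (W 0) := by ring
            _ ≤ c * jR * 9 ^ 6 * (100 * (Cm * D) * Real.exp (K * τ) +
                 32 * (1 + C1 * D) ^ 11 * Real.exp (K * τ)) * Cp * eR 2 k (W 0) := by gcongr
            _ = _ := by rw [hZ]; ring
        have hXe : (1 + c ^ 2 * L1 (W 0) ^ 2 + 8 * c ^ 2 * (jR + jR * jR) * 9 ^ 6) * eR 2 k (W τ) ≤ X * eR 2 k (W τ) := by
          rw [hX]; gcongr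
        have e : A * eR 2 k (W τ) + C * ((k + 1) * Z) * eR 2 k (W 0) * Real.exp (K * (τ - 0)) =
          C * ((k + 1) * (X * eR 2 k (W τ) + Z * eR 2 k (W 0) * Real.exp (K * τ))) := by rw [hA, sub_zero]; ring
        rw [e]
        refine mul_le_mul_of_nonneg_left (h1.trans ?_) (by linarith)
        gcongr) hA0 hK0 (by positivity) p (fun τ _ => le_rfl)
    simp only [sub_zero] at g
    refine fin_const (by positivity) (by positivity) ht p (g.trans (le_of_eq ?_))
    ring

def lb (β : Fin 6 → ℕ) : List (Fin 6) :=
  List.replicate (β 5) 5 ++ (List.replicate (β 4) 4 ++ (List.replicate (β 3) 3 ++ (List.replicate (β 2) 2 ++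
    (List.replicate (β 1) 1 ++ List.replicate (β 0) 0))))

lemma pd_iter (i : Fin 6) (n : ℕ) : ∀ f : SP, (pdP (dir6 i))^[n] (fun z => f z) = fun z => plS (List.replicate n i) f z := by
  induction n with
  | zero => intro f; rfl
  | succ n ih =>
    intro f
    rw [Function.iterate_succ_apply]
    have : pdP (dir6 i) (fun z => f z) = fun z => dS i f z := by
      funext z; rw [dS_apply]; rfl
    rw [this, ih]; rfl

lemma mderiv_eq (β : Fin 6 → ℕ) (f : SP) : mderivP β (fun z => f z) = fun z => plS (lb β) f z := by
  unfold mderivP lb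
  simp only [plS_append]
  rw [pd_iter, pd_iter, pd_iter, pd_iter, pd_iter, pd_iter]

lemma lb_length (β : Fin 6 → ℕ) : (lb β).length = ∑ i, β i := by
  unfold lb
  simp only [List.length_append, List.length_replicate, Fin.sum_univ_six]
  ring

lemma lb_perm (L : List (Fin 6)) : (lb fun i => L.count i).Perm L := by
  rw [List.perm_iff_count]
  intro i
  unfold lb
  fin_cases i <;> simp [List.count_replicate]

def FS (s : ℕ) : Finset (Fin 6 → ℕ) := Fintype.piFinset fun _ => Finset.range (s + 1)

lemma sob_sq (s a : ℕ) (f : SP) : sobNorm s a (fun z => f z) ^ 2 =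
    ∑ β ∈ FS s, if (∑ i, β i) ≤ s then (Qe a (plS (lb β) f)).toReal else 0 := by
  have e : ∀ β : Fin 6 → ℕ, (if (∑ i, β i) ≤ s then
      ∫ z : P6, (1 + ‖z.1‖ ^ 2 + ‖z.2‖ ^ 2) ^ a * (mderivP β (fun z => f z) z) ^ 2 else 0) =
      if (∑ i, β i) ≤ s then (Qe a (plS (lb β) f)).toReal else 0 := by
    intro β
    split_ifs with h
    · rw [mderiv_eq, Qe_eq a (plS (lb β) f).continuous.measurable (Qe_lt_top a _), ENNReal.toReal_ofReal]
      · rfl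
      · exact integral_nonneg fun z => mul_nonneg (pow_nonneg (wt_pos z).le _) (sq_nonneg _)
    · rfl
  unfold sobNorm
  simp only [e]
  rw [tsum_eq_sum (s := FS s), Real.sq_sqrt]
  · exact Finset.sum_nonneg fun β _ => by split_ifs <;> positivity
  · intro β hβ
    rw [if_neg]
    intro h
    apply hβ
    unfold FS
    rw [Fintype.mem_piFinset]
    intro i
    rw [Finset.mem_range]
    have := Finset.single_le_sum (f := β) (fun _ _ => Nat.zero_le _) (Finset.mem_univ i)
    omega

lemma sob_le (s a : ℕ) (f : SP) : sobNorm s a (fun z => f z) ^ 2 ≤ (FS s).card * eR a s f := by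
  rw [sob_sq, ← nsmul_eq_mul]
  refine Finset.sum_le_card_nsmul _ _ _ fun β _ => ?_
  split_ifs with h
  · exact ENNReal.toReal_mono (En_ne _ _ _) (le_En (by rw [lb_length]; exact h) f)
  · exact eR_nonneg _ _ _

lemma le_sob (s a : ℕ) (f : SP) : eR a s f ≤ sobNorm s a (fun z => f z) ^ 2 := by
  unfold eR
  refine ENNReal.toReal_le_of_le_ofReal (sq_nonneg _) ?_
  refine iSup₂_le fun L hL => ?_
  rw [← plS_perm (lb_perm L) f, ← ENNReal.ofReal_toReal (Qe_lt_top a _).ne]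
  apply ENNReal.ofReal_le_ofReal
  rw [sob_sq]
  have hs : ∑ i, L.count i ≤ s := by
    rw [← lb_length (fun i => L.count i), (lb_perm L).length_eq]; exact hL
  have hmem : (fun i => L.count i) ∈ FS s := by
    unfold FS
    rw [Fintype.mem_piFinset]
    intro i
    rw [Finset.mem_range]
    have := Finset.single_le_sum (f := fun i => L.count i) (fun _ _ => Nat.zero_le _) (Finset.mem_univ i)
    omega
  have := Finset.single_le_sum (f := fun β : Fin 6 → ℕ => if (∑ i, β i) ≤ s then (Qe a (plS (lb β) f)).toReal else 0)
    (fun β _ => by split_ifs <;> positivity) hmem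
  simp only [if_pos hs] at this
  exact this

lemma fd_left (f : SP) (x v u : E3) : fderiv ℝ (fun x' => f (x', v)) x u = fderiv ℝ f (x, v) (u, 0) := by
  have h1 : HasFDerivAt f (fderiv ℝ f (x, v)) (x, v) := (f.differentiable (x, v)).hasFDerivAt
  have h2 := h1.comp x (hasFDerivAt_prodMk_left (𝕜 := ℝ) x v)
  have := h2.fderiv
  simp only [Function.comp_def] at this
  rw [this]; simp

lemma fd_right (f : SP) (x v u : E3) : fderiv ℝ (fun v' => f (x, v')) v u = fderiv ℝ f (x, v) (0, u) := by
  have h1 : HasFDerivAt f (fderiv ℝ f (x, v)) (x, v) := (f.differentiable (x, v)).hasFDerivAt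
  have h2 := h1.comp v (hasFDerivAt_prodMk_right (𝕜 := ℝ) x v)
  have := h2.fderiv
  simp only [Function.comp_def] at this
  rw [this]; simp

lemma fd_rel (f : SP) (z : P6) (u : E3) : fderiv ℝ f z (u, 0) = ∑ i : Fin 3, u i * fderiv ℝ f z (EuclideanSpace.single i 1, 0) := by
  have e : ((u, 0) : P6) = ∑ i : Fin 3, u i • ((EuclideanSpace.single i (1:ℝ), 0) : P6) := by
    have h1 : u = ∑ i : Fin 3, u i • EuclideanSpace.single i (1:ℝ) := by
      ext j; simp [Fin.sum_univ_three]; fin_cases j <;> simp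
    ext1
    · rw [Prod.fst_sum]; exact h1
    · rw [Prod.snd_sum]; simp
  conv_lhs => rw [e]
  rw [map_sum]
  exact Finset.sum_congr rfl fun i _ => by rw [map_smul, smul_eq_mul]

lemma Tf_expand (U : Fin 3 → E3 → ℝ) (g : SP) (x v : E3) : -1 * Tf U g (x, v) =
    - fderiv ℝ (fun x' => g (x', v)) x (relVel v) + ∑ i : Fin 3, cv (U i) g x * fderiv ℝ (fun v' => g (x, v')) v (EuclideanSpace.single i 1) := by
  rw [fd_left, fd_rel]
  simp only [fd_right]
  unfold Tf
  have hn : ∀ i, nuA i (x, v) = relVel v i := fun _ => rfl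
  simp only [dS_apply, bb, dir6, FF, Fin.sum_univ_six, Fin.sum_univ_three]
  simp
  simp only [hn]
  ring

lemma mkSol {V : E3 → ℝ} {U : Fin 3 → E3 → ℝ} {c : ℝ} (hU : ∀ i, Ker (U i) c)
    (hF : ∀ (g : SP) x i, fderiv ℝ (fun x' => ∫ y, V (x' - y) * ∫ w, g (y, w)) x (EuclideanSpace.single i 1) = cv (U i) g x)
    (W : ℝ → SP) (h1 : ∀ z : P6, ContDiff ℝ (⊤ : ℕ∞) fun t => W t z)
    (h2 : ∀ (t : ℝ) (x v : E3),
        HasDerivAt (fun s => W s (x, v))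
          (- fderiv ℝ (fun x' => W t (x', v)) x (relVel v)
            + ∑ i : Fin 3,
              fderiv ℝ (fun x' => ∫ y : E3, V (x' - y) * ∫ w : E3, W t (y, w)) x
                  (EuclideanSpace.single i 1) *
                fderiv ℝ (fun v' => W t (x, v')) v (EuclideanSpace.single i 1)) t) : Sol U c (-1) W := by
  have hd : ∀ t z, HasDerivAt (fun s => W s z) (-1 * Tf U (W t) z) t := by
    rintro t ⟨x, v⟩
    rw [Tf_expand]
    have := h2 t x v
    simp only [hF] at this
    exact this
  refine ⟨by norm_num, hU, hd, fun z => ?_⟩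
  have h3 : Continuous (deriv fun t => W t z) := (h1 z).continuous_deriv (by simp)
  have h4 : (fun t => Tf U (W t) z) = fun t => - deriv (fun t => W t z) t := by
    funext t; rw [(hd t z).deriv]; ring
  rw [h4]; exact h3.neg

lemma finish {N C0 t X Y : ℝ} (hN : 0 ≤ N) (hC0 : 0 ≤ C0) (ht : 0 ≤ t) (hY : 0 ≤ Y)
    (h : X ^ 2 ≤ N * (C0 * Real.exp (C0 * t) * Y ^ 2)) :
    X ≤ (N * C0 + C0 + 1) * Real.exp ((N * C0 + C0 + 1) * t) * Y := by
  have hNC : 0 ≤ N * C0 := by positivity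
  refine le_of_sq_le_sq (h.trans ?_) (by positivity)
  have h1 : N * C0 ≤ (N * C0 + C0 + 1) ^ 2 := by nlinarith
  have h2 : Real.exp (C0 * t) ≤ Real.exp ((N * C0 + C0 + 1) * t) ^ 2 := by
    rw [← Real.exp_nat_mul]
    apply Real.exp_le_exp.2
    push_cast
    have : 0 ≤ N * C0 * t := by positivity
    have : 0 ≤ C0 * t := by positivity
    nlinarith
  calc N * (C0 * Real.exp (C0 * t) * Y ^ 2) = (N * C0) * Real.exp (C0 * t) * Y ^ 2 := by ring
    _ ≤ (N * C0 + C0 + 1) ^ 2 * Real.exp ((N * C0 + C0 + 1) * t) ^ 2 * Y ^ 2 := by gcongr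
    _ = _ := by ring

end Helpers

/-- Propagation of regularity for the relativistic Vlasov equation
`∂_t W_t + ν(v)·∇_x W_t = ∇(V∗ρ_t)·∇_v W_t`, `ρ_t(x) = ∫ W_t(x,v) dv`:
for `k ∈ {1,…,6}` and `D > 0` there is `C > 0` (depending only on `k`, `V`, `D`)
such that `‖W_0‖_{H²_4} ≤ D` implies `‖W_t‖_{H^k_2} ≤ C e^{C|t|} ‖W_0‖_{H^k_2}`. -/
theorem stmt16 (V : E3 → ℝ) (hV1 : Integrable V)
    (hV2 : Integrable fun p : E3 => ‖𝓕 (fun x => (V x : ℂ)) p‖ * (1 + ‖p‖ ^ 2)) :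
    ∀ k : ℕ, 1 ≤ k → k ≤ 6 → ∀ D : ℝ, 0 < D →
    ∃ C > (0 : ℝ), ∀ W : ℝ → SchwartzMap P6 ℝ,
      (∀ z : P6, ContDiff ℝ (⊤ : ℕ∞) fun t => W t z) →
      (∀ (t : ℝ) (x v : E3),
        HasDerivAt (fun s => W s (x, v))
          (- fderiv ℝ (fun x' => W t (x', v)) x (relVel v)
            + ∑ i : Fin 3,
              fderiv ℝ (fun x' => ∫ y : E3, V (x' - y) * ∫ w : E3, W t (y, w)) x
                  (EuclideanSpace.single i 1) *
                fderiv ℝ (fun v' => W t (x, v')) v (EuclideanSpace.single i 1)) t) →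
      sobNorm 2 4 (fun z => W 0 z) ≤ D →
      ∀ t : ℝ,
        sobNorm k 2 (fun z => W t z) ≤
          C * Real.exp (C * |t|) * sobNorm k 2 (fun z => W 0 z) := by
  intro k hk1 hk D hD
  obtain ⟨U, c, hU, hF⟩ := kernel_ex V hV1 hV2
  obtain ⟨C0, hC0, h⟩ := st3 c (D ^ 2) (hU 0).c1 (sq_nonneg D) k hk1 hk
  refine ⟨((FS k).card : ℝ) * C0 + C0 + 1, by positivity, ?_⟩
  intro W h1 h2 h0 t
  have hS := mkSol hU hF W h1 h2
  have hs0 : ∀ s a (f : SP), 0 ≤ sobNorm s a (fun z => f z) := fun s a f => Real.sqrt_nonneg _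
  have hE : eR 4 2 (W 0) ≤ D ^ 2 := (le_sob 2 4 (W 0)).trans (pow_le_pow_left₀ (hs0 _ _ _) h0 2)
  have key : eR 2 k (W t) ≤ C0 * Real.exp (C0 * |t|) * eR 2 k (W 0) := by
    rcases le_total 0 t with ht | ht
    · rw [abs_of_nonneg ht]; exact h hS hE t ht
    · rw [abs_of_nonpos ht]
      have := h hS.refl (by simpa using hE) (-t) (by linarith)
      simpa using this
  refine finish (Nat.cast_nonneg _) hC0 (abs_nonneg t) (hs0 _ _ _) ?_
  refine (sob_le k 2 (W t)).trans ?_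
  refine mul_le_mul_of_nonneg_left (key.trans ?_) (Nat.cast_nonneg _)
  exact mul_le_mul_of_nonneg_left (le_sob k 2 (W 0)) (by positivity)

end
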